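/- Let K be an infinite field with char(K) ≠ 2 and fix integers n ≥ m ≥ 2. Then for all d sufficiently large with respect to n and m, max{D(Q,(2,…,2)) : Q ∈ 𝒬(n,d,m)} = 3n, where 𝒬(n,d,m) is the set of strongly connected quivers with n vertices, d arrows and maximal degree of primitive closed paths equal to m. -/

import Mathlib

open Classical BigOperators

/-- A quiver (finite oriented graph data): a type of vertices, a type of arrows,
and source (tail `a''`) and target (head `a'`) maps. -/
structure QuiverData where
  V : Type
  A : Type
  src : A → V
  tgt : A → V

namespace QuiverData

variable (Q : QuiverData)

/-- `Q.IsPathFrom u v l` : the list of arrows `l` is a (possibly empty) path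
from `u` to `v`, i.e. `l = [a₁, …, a_s]` with `a₁'' = u`, `aᵢ' = a_{i+1}''`, `a_s' = v`. -/
def IsPathFrom : Q.V → Q.V → List Q.A → Prop
  | u, v, [] => u = v
  | u, v, a :: l => Q.src a = u ∧ IsPathFrom (Q.tgt a) v l

/-- A (non-empty) closed path in the vertex `v`. -/
def IsClosedAt (v : Q.V) (l : List Q.A) : Prop :=
  l ≠ [] ∧ Q.IsPathFrom v v l

/-- A (non-empty) closed path. -/
def IsClosed (l : List Q.A) : Prop := ∃ v, Q.IsClosedAt v l

/-- `deg_w(l)`: the degree of the closed path `l` in the vertex `w`,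
i.e. the number of `i` with `aᵢ' = w`. -/
noncomputable def vdeg (l : List Q.A) (w : Q.V) : ℕ :=
  Nat.card {i : Fin l.length // Q.tgt (l.get i) = w}

/-- `deg_b(l)`: the number of occurrences of the arrow `b` in the path `l`. -/
noncomputable def adeg (l : List Q.A) (b : Q.A) : ℕ :=
  Nat.card {i : Fin l.length // l.get i = b}

/-- The number of occurrences in `l` of arrows from the set `S`. -/
noncomputable def sdeg (l : List Q.A) (S : Set Q.A) : ℕ :=
  Nat.card {i : Fin l.length // l.get i ∈ S}

/-- A primitive closed path in `v`: a closed path without self-intersections,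
i.e. `deg_w = 1` for every vertex `w` of the path. -/
def IsPrimitiveAt (v : Q.V) (l : List Q.A) : Prop :=
  Q.IsClosedAt v l ∧ ∀ a ∈ l, Q.vdeg l (Q.tgt a) = 1

/-- A primitive closed path. -/
def IsPrimitive (l : List Q.A) : Prop := ∃ v, Q.IsPrimitiveAt v l

/-- `m(Q) = m` : `m` is the maximal degree of primitive closed paths in `Q`. -/
def MaxPrimDeg (m : ℕ) : Prop :=
  (∃ l, Q.IsPrimitive l ∧ l.length = m) ∧ ∀ l, Q.IsPrimitive l → l.length ≤ m

/-- `Q` is strongly connected: there is a closed path containing all vertices;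
a quiver with one vertex and no arrows is also strongly connected. -/
def StronglyConnected : Prop :=
  (∃ v l, Q.IsClosedAt v l ∧ ∀ w, ∃ a ∈ l, Q.tgt a = w) ∨
    (Subsingleton Q.V ∧ IsEmpty Q.A)

/-- Formal negation on the set (closed paths with a formal sign) ∪ {0};
`none` is the symbol `0`, and `some (e, l)` is `(-1)^e·l`. -/
def negO : Option (Bool × List Q.A) → Option (Bool × List Q.A)
  | none => none
  | some (e, l) => some (!e, l)

/-- The equivalence `≡` on the set of closed paths of `Q`, enlarged by an additional
symbol `0` (represented by `none`) and formal signs (`some (e, l)` is `(-1)^e·l`).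
The parameter `c2` is the proposition "the characteristic of the ground field is 2"
(so that the formal sign `(-1)^σ` is trivial exactly when `c2` holds).
It is the smallest equivalence, compatible with formal negation, such that for paths
`a`, `b` with `ab` a closed path and incident closed paths `a₁, a₂, …`:
(1) `ab ≡ ba`; (2) `a_{σ(1)}⋯a_{σ(t)} ≡ (-1)^σ a₁⋯a_t` for `t ≥ 2` and `σ ∈ S_t`
(generated here by transpositions of adjacent factors);
(3) `a₁²a₂ ≡ 0`; (4) if `c2` then `a₁² ≡ 0`, while if `¬c2` then `a₁a₂a₃a₄ ≡ 0`. -/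
inductive PEquiv (c2 : Prop) : Option (Bool × List Q.A) → Option (Bool × List Q.A) → Prop
  | refl (x) : PEquiv c2 x x
  | symm {x y} : PEquiv c2 x y → PEquiv c2 y x
  | trans {x y z} : PEquiv c2 x y → PEquiv c2 y z → PEquiv c2 x z
  | neg {x y} : PEquiv c2 x y → PEquiv c2 (Q.negO x) (Q.negO y)
  | cyc (u v : Q.V) (a b : List Q.A) (e : Bool) :
      Q.IsPathFrom u v a → Q.IsPathFrom v u b → a ++ b ≠ [] →
      PEquiv c2 (some (e, a ++ b)) (some (e, b ++ a))
  | swap (v : Q.V) (w₁ c d w₂ : List Q.A) (e : Bool) :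
      Q.IsPathFrom v v w₁ → Q.IsClosedAt v c → Q.IsClosedAt v d → Q.IsPathFrom v v w₂ →
      PEquiv c2 (some (e, w₁ ++ c ++ d ++ w₂))
        (some (if c2 then e else !e, w₁ ++ d ++ c ++ w₂))
  | sq_mul (v : Q.V) (c d : List Q.A) (e : Bool) :
      Q.IsClosedAt v c → Q.IsClosedAt v d →
      PEquiv c2 (some (e, c ++ c ++ d)) none
  | sq (v : Q.V) (c : List Q.A) (e : Bool) :
      c2 → Q.IsClosedAt v c → PEquiv c2 (some (e, c ++ c)) none
  | four (v : Q.V) (c₁ c₂ c₃ c₄ : List Q.A) (e : Bool) :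
      ¬c2 → Q.IsClosedAt v c₁ → Q.IsClosedAt v c₂ → Q.IsClosedAt v c₃ → Q.IsClosedAt v c₄ →
      PEquiv c2 (some (e, c₁ ++ c₂ ++ c₃ ++ c₄)) none
  | sign_triv (e : Bool) (l : List Q.A) :
      c2 → PEquiv c2 (some (e, l)) (some (!e, l))

/-- `l₁ ≡ l₂` for closed paths. -/
def PathEquiv (c2 : Prop) (l₁ l₂ : List Q.A) : Prop :=
  Q.PEquiv c2 (some (false, l₁)) (some (false, l₂))

/-- `l ≡ 0`. -/
def EquivZero (c2 : Prop) (l : List Q.A) : Prop :=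
  Q.PEquiv c2 (some (false, l)) none

/-! ### Invariants of quivers for the dimension vector `(2,…,2)` -/

/-- Variables `x_{ij}(a)` of the polynomial ring: for each arrow `a` the entries of the
`2 × 2` generic matrix `X_a`. -/
def Var : Type := Q.A × Fin 2 × Fin 2

variable (K : Type) [Field K]

/-- The substitution describing the base-change action of the group
`∏_{v} GL₂(K)` (given by a family of invertible matrices `g`) on the variables:
`x_{ij}(a)` is sent to the `(i,j)` entry of `g_{a'} X_a g_{a''}⁻¹`. -/
noncomputable def actVar (g : Q.V → Matrix (Fin 2) (Fin 2) K) (p : Q.Var) :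
    MvPolynomial Q.Var K :=
  ∑ k : Fin 2, ∑ l : Fin 2,
    MvPolynomial.C (g (Q.tgt p.1) p.2.1 k * (g (Q.src p.1))⁻¹ l p.2.2) *
      MvPolynomial.X (p.1, k, l)

/-- `f` belongs to the algebra of invariants `Inv(Q,(2,…,2))`. -/
def IsInvariant (f : MvPolynomial Q.Var K) : Prop :=
  ∀ g : Q.V → Matrix (Fin 2) (Fin 2) K, (∀ v, IsUnit (g v).det) →
    MvPolynomial.aeval (Q.actVar K g) f = f

/-- The space `Inv(Q,(2,…,2))⁺` of invariants without constant term (the span of the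
homogeneous invariants of positive degree). -/
def PlusSet : Set (MvPolynomial Q.Var K) :=
  {f | Q.IsInvariant K f ∧ MvPolynomial.constantCoeff f = 0}

/-- `f` is decomposable: it lies in the ideal `(Inv⁺)²`, i.e. in the `K`-span of
products of two invariants of positive degree. -/
def Decomposable (f : MvPolynomial Q.Var K) : Prop :=
  f ∈ Submodule.span K
    {x : MvPolynomial Q.Var K | ∃ p ∈ Q.PlusSet K, ∃ q ∈ Q.PlusSet K, x = p * q}

/-- The generic `2 × 2` matrix `X_a` of an arrow `a`. -/
noncomputable def genMat (a : Q.A) : Matrix (Fin 2) (Fin 2) (MvPolynomial Q.Var K) :=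
  Matrix.of fun i j => MvPolynomial.X (a, i, j)

/-- For a path `l = a₁⋯a_s`, the matrix product `X_{a_s} ⋯ X_{a_1}`. -/
noncomputable def pathMat (l : List Q.A) : Matrix (Fin 2) (Fin 2) (MvPolynomial Q.Var K) :=
  ((l.map (Q.genMat K)).reverse).prod

/-- `tr(X_{a_s} ⋯ X_{a_1})` for a path `l = a₁⋯a_s`. -/
noncomputable def pathTr (l : List Q.A) : MvPolynomial Q.Var K :=
  Matrix.trace (Q.pathMat K l)

/-- `det(X_{a_s} ⋯ X_{a_1})` for a path `l = a₁⋯a_s`. -/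
noncomputable def pathDet (l : List Q.A) : MvPolynomial Q.Var K :=
  Matrix.det (Q.pathMat K l)

/-- `σ_k(X_{a_s} ⋯ X_{a_1})`, the `k`-th coefficient of the characteristic polynomial
of the `2 × 2` matrix `X_{a_s} ⋯ X_{a_1}` (which vanishes for `k > 2`). -/
noncomputable def pathSigma (k : ℕ) (l : List Q.A) : MvPolynomial Q.Var K :=
  if k = 0 then 1 else if k = 1 then Q.pathTr K l
    else if k = 2 then Q.pathDet K l else 0

/-- `D(Q,(2,…,2))`: the maximal degree of an indecomposable homogeneous invariant,
i.e. the least upper bound for the degrees of elements of a minimal homogeneous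
system of generators of `Inv(Q,(2,…,2))`. -/
noncomputable def Dnum : ℕ :=
  sSup {k | ∃ f : MvPolynomial Q.Var K,
    Q.IsInvariant K f ∧ f.IsHomogeneous k ∧ ¬ Q.Decomposable K f}

end QuiverData

/-- `max {D(Q,(2,…,2)) | Q ∈ 𝒬(n,d,m)}` where `𝒬(n,d,m)` is the set of strongly
connected quivers with `n` vertices (vertex set `Fin n`), `d` arrows (arrow set `Fin d`)
and maximal degree of primitive closed paths equal to `m`. -/
noncomputable def QuiverData.maxD (K : Type) [Field K] (n d m : ℕ) : ℕ :=
  sSup {N | ∃ s t : Fin d → Fin n,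
    (QuiverData.mk (Fin n) (Fin d) s t).StronglyConnected ∧
    (QuiverData.mk (Fin n) (Fin d) s t).MaxPrimDeg m ∧
    N = (QuiverData.mk (Fin n) (Fin d) s t).Dnum K}



namespace QInv
open MvPolynomial

variable {K : Type} [Field K] {σ τ L L' : Type}

/-- weight of a variable: the indicator of its letter. -/
noncomputable def wt (lt : σ → L) (v : σ) : L → ℕ := fun l => if lt v = l then 1 else 0

/-- multihomogeneity with respect to letters. -/
def MH (lt : σ → L) (f : MvPolynomial σ K) (r : L → ℕ) : Prop :=
  IsWeightedHomogeneous (wt lt) f r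

lemma weight_wt (lt : σ → L) (d : σ →₀ ℕ) (l : L) :
    Finsupp.weight (wt lt) d l = ∑ v ∈ d.support, if lt v = l then d v else 0 := by
  rw [Finsupp.weight_apply, Finsupp.sum, Finset.sum_apply]
  refine Finset.sum_congr rfl fun v _ => ?_
  simp [wt]

lemma le_weight_wt (lt : σ → L) (d : σ →₀ ℕ) (v : σ) :
    d v ≤ Finsupp.weight (wt lt) d (lt v) := by
  rw [weight_wt]
  by_cases h : v ∈ d.support
  · have := Finset.single_le_sum (f := fun w => if lt w = lt v then d w else 0)
      (fun i _ => Nat.zero_le _) h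
    simpa using this
  · simp at h; simp [h]

lemma aeval_sum {B : Type} [CommRing B] [Algebra K B] (x : σ → B) (f : MvPolynomial σ K) :
    aeval x f = ∑ d ∈ f.support, algebraMap K B (coeff d f) * ∏ v ∈ d.support, x v ^ d v := by
  rw [aeval_def, eval₂_eq]

lemma MH.scale [Fintype L] {lt : σ → L} {f : MvPolynomial σ K} {r : L → ℕ} (hf : MH lt f r)
    {B : Type} [CommRing B] [Algebra K B] (x : σ → B) (c : L → B) :
    aeval (fun v => c (lt v) * x v) f = (∏ l, c l ^ r l) * aeval x f := by
  rw [aeval_sum, aeval_sum, Finset.mul_sum]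
  refine Finset.sum_congr rfl fun d hd => ?_
  have h := hf (mem_support_iff.1 hd)
  simp_rw [mul_pow, Finset.prod_mul_distrib]
  have : ∏ v ∈ d.support, c (lt v) ^ d v = ∏ l, c l ^ r l := by
    rw [← h]
    simp_rw [weight_wt, ← Finset.prod_pow_eq_pow_sum]
    rw [Finset.prod_comm]
    refine Finset.prod_congr rfl fun v _ => ?_
    rw [Finset.prod_eq_single (lt v)]
    · simp
    · intro l _ hl; simp [Ne.symm hl]
    · simp
  rw [this]; ring

lemma MH.congr {lt : σ → L} {f : MvPolynomial σ K} {r : L → ℕ} (hf : MH lt f r)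
    {B : Type} [CommRing B] [Algebra K B] {x y : σ → B} (h : ∀ v, r (lt v) ≠ 0 → x v = y v) :
    aeval x f = aeval y f := by
  rw [aeval_sum, aeval_sum]
  refine Finset.sum_congr rfl fun d hd => ?_
  have hw := hf (mem_support_iff.1 hd)
  congr 1
  refine Finset.prod_congr rfl fun v hv => ?_
  rw [h v]
  have := le_weight_wt lt d v
  rw [hw] at this
  have h2 := Finsupp.mem_support_iff.1 hv
  omega

lemma MH.map [Fintype L] {lt : σ → L} {f : MvPolynomial σ K} {r : L → ℕ} (hf : MH lt f r)
    (lt' : τ → L') (φ : σ → MvPolynomial τ K) (ρ : L → L' → ℕ)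
    (h : ∀ v, r (lt v) ≠ 0 → MH lt' (φ v) (ρ (lt v))) :
    MH lt' (aeval φ f) (fun l' => ∑ l, r l * ρ l l') := by
  rw [aeval_sum]
  refine IsWeightedHomogeneous.sum _ _ _ fun d hd => ?_
  have hw := hf (mem_support_iff.1 hd)
  refine IsWeightedHomogeneous.C_mul ?_ _
  have h1 : MH lt' (∏ v ∈ d.support, φ v ^ d v) (∑ v ∈ d.support, d v • ρ (lt v)) := by
    refine IsWeightedHomogeneous.prod _ _ _ fun v hv => ?_
    refine IsWeightedHomogeneous.pow (h v ?_) _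
    have := le_weight_wt lt d v
    rw [hw] at this
    have h2 := Finsupp.mem_support_iff.1 hv
    omega
  suffices e : (fun l' => ∑ l, r l * ρ l l') = ∑ v ∈ d.support, d v • ρ (lt v) by
    rw [e]; exact h1
  funext l'
  rw [Finset.sum_apply, ← hw]
  simp_rw [weight_wt, Finset.sum_mul]
  rw [Finset.sum_comm]
  refine Finset.sum_congr rfl fun v _ => ?_
  rw [Finset.sum_eq_single (lt v)]
  · simp
  · intro l _ hl; simp [Ne.symm hl]
  · simp

lemma MH.map_same [Fintype L] {lt : σ → L} {f : MvPolynomial σ K} {r : L → ℕ} (hf : MH lt f r)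
    (lt' : τ → L) (φ : σ → MvPolynomial τ K)
    (h : ∀ v, r (lt v) ≠ 0 → MH lt' (φ v) (fun l => if lt v = l then 1 else 0)) :
    MH lt' (aeval φ f) r := by
  have := hf.map lt' φ (fun l l' => if l = l' then 1 else 0) h
  simpa using this

lemma MH.eq_C {lt : σ → L} {f : MvPolynomial σ K} (hf : MH lt f 0) : f = C (coeff 0 f) := by
  ext d
  rw [coeff_C]
  split_ifs with h
  · rw [h]
  · by_contra hd
    have hw := hf hd
    apply h
    ext v
    have := le_weight_wt lt d v
    rw [hw] at this
    simp at this ⊢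
    exact this.symm

lemma MH_X (lt : σ → L) (v : σ) :
    MH lt (X v : MvPolynomial σ K) (fun l => if lt v = l then 1 else 0) :=
  isWeightedHomogeneous_X K (wt lt) v

/-- multihomogeneous component -/
noncomputable def comp (lt : σ → L) (r : L → ℕ) : MvPolynomial σ K →ₗ[K] MvPolynomial σ K :=
  weightedHomogeneousComponent (wt lt) r

lemma comp_MH (lt : σ → L) (r : L → ℕ) (f : MvPolynomial σ K) : MH lt (comp lt r f) r :=
  weightedHomogeneousComponent_isWeightedHomogeneous _ _

lemma exists_sum_comp (lt : σ → L) (f : MvPolynomial σ K) :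
    ∃ s : Finset (L → ℕ), f = ∑ r ∈ s, comp lt r f := by
  refine ⟨(weightedHomogeneousComponent_finsupp (w := wt lt) f).toFinset, ?_⟩
  conv_lhs => rw [← finsum_weightedHomogeneousComponent (wt lt) f]
  rw [finsum_eq_sum _ (weightedHomogeneousComponent_finsupp f)]
  rfl

lemma comp_of_MH {lt : σ → L} {r s : L → ℕ} {f : MvPolynomial σ K} (hf : MH lt f s) :
    comp lt r f = if s = r then f else 0 := by
  split_ifs with h
  · subst h; exact hf.weightedHomogeneousComponent_same
  · exact hf.weightedHomogeneousComponent_ne _ (Ne.symm h)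

/-- a map preserving multidegree of variables commutes with components. -/
lemma comp_aeval [Fintype L] (lt : σ → L) (φ : σ → MvPolynomial σ K)
    (h : ∀ v, MH lt (φ v) (fun l => if lt v = l then 1 else 0)) (r : L → ℕ)
    (f : MvPolynomial σ K) : comp lt r (aeval φ f) = aeval φ (comp lt r f) := by
  obtain ⟨s, hs⟩ := exists_sum_comp lt f
  have h1 : aeval φ f = ∑ t ∈ s, aeval φ (comp lt t f) := by
    conv_lhs => rw [hs]
    rw [map_sum]
  have h2 : comp lt r f = ∑ t ∈ s, comp lt r (comp lt t f) := by
    conv_lhs => rw [hs]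
    rw [map_sum]
  rw [h1, h2, map_sum, map_sum]
  refine Finset.sum_congr rfl fun t _ => ?_
  have h3 : MH lt (aeval φ (comp lt t f)) t := (comp_MH lt t f).map_same lt φ (fun v _ => h v)
  rw [comp_of_MH h3, comp_of_MH (comp_MH lt t f)]
  split_ifs <;> simp

/-- homogeneous division -/
lemma MH.factor {lt : σ → L} {r s : L → ℕ} {F D h : MvPolynomial σ K} (hF : MH lt F r)
    (hD : MH lt D s) (e : F = D * h) :
    F = 0 ∨ ∃ r' h', MH lt h' r' ∧ s + r' = r ∧ F = D * h' := by
  obtain ⟨S, hS⟩ := exists_sum_comp lt h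
  have h1 : F = ∑ t ∈ S, (if s + t = r then D * comp lt t h else 0) := by
    have : F = comp lt r F := by rw [comp_of_MH hF]; simp
    rw [this, e]
    conv_lhs => rw [hS]
    rw [Finset.mul_sum, map_sum]
    refine Finset.sum_congr rfl fun t _ => ?_
    rw [comp_of_MH (IsWeightedHomogeneous.mul hD (comp_MH lt t h))]
  by_cases hle : ∃ t ∈ S, s + t = r
  · obtain ⟨t, ht, he⟩ := hle
    refine Or.inr ⟨t, comp lt t h, comp_MH _ _ _, he, ?_⟩
    rw [h1, Finset.sum_eq_single t]
    · simp [he]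
    · intro u _ hu
      rw [if_neg]
      intro h2
      exact hu (add_left_cancel (h2.trans he.symm))
    · exact fun h => absurd ht h
  · left
    rw [h1]
    refine Finset.sum_eq_zero fun t ht => ?_
    rw [if_neg]
    exact fun h2 => hle ⟨t, ht, h2⟩

/-- division by a prime variable -/
lemma dvd_of_dvd_X_pow_mul {D F : MvPolynomial σ K} {v : σ} {N : ℕ}
    (h : D ∣ X v ^ N * F) (hv : ¬ (X v ∣ D)) : D ∣ F := by
  obtain ⟨q, hq⟩ := h
  have hp : Prime (X v : MvPolynomial σ K) := X_prime
  have : (X v : MvPolynomial σ K) ^ N ∣ D * q := ⟨F, hq.symm⟩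
  obtain ⟨q', rfl⟩ := hp.pow_dvd_of_dvd_mul_left N hv this
  refine ⟨q', ?_⟩
  have h0 : (X v : MvPolynomial σ K) ^ N ≠ 0 := pow_ne_zero _ hp.ne_zero
  apply mul_left_cancel₀ h0
  rw [hq]; ring

lemma not_X_dvd {D : MvPolynomial σ K} {v : σ} (x : σ → K) (hx : x v = 0)
    (h : eval x D ≠ 0) : ¬ (X v ∣ D) := by
  rintro ⟨q, rfl⟩
  apply h
  simp [hx]

/-- existence of a non-root-of-unity-like element -/
lemma exists_pow_ne_one [Infinite K] {k : ℕ} (hk : k ≠ 0) : ∃ c : K, c ≠ 0 ∧ c ^ k ≠ 1 := by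
  by_contra! H
  have hp : (Polynomial.X ^ (k+1) - Polynomial.X : Polynomial K) = 0 := by
    apply Polynomial.funext
    intro c
    by_cases hc : c = 0
    · simp [hc]
    · simp [pow_succ, H c hc]
  have := congrArg (fun p => Polynomial.coeff p 1) hp
  simp [Polynomial.coeff_X_pow, hk] at this

end QInv


namespace QInv
open MvPolynomial

variable {K : Type} [Field K] {A I V : Type}

abbrev MVar (A I : Type) : Type := (A × Fin 2 × Fin 2) ⊕ (I × Fin 2)
abbrev Ltr (A I : Type) : Type := A ⊕ I

/-- the letter of a variable -/
def ltr : MVar A I → Ltr A I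
  | Sum.inl v => Sum.inl v.1
  | Sum.inr v => Sum.inr v.1

/-- action of base change on variables, all legs covariant -/
noncomputable def act (hd tl : A → V) (loc : I → V) (g : V → Matrix (Fin 2) (Fin 2) K) :
    MVar A I → MvPolynomial (MVar A I) K
  | Sum.inl v => ∑ k, ∑ l, C (g (hd v.1) v.2.1 k * g (tl v.1) v.2.2 l) * X (Sum.inl (v.1, k, l))
  | Sum.inr v => ∑ k, C (g (loc v.1) v.2 k) * X (Sum.inr (v.1, k))

def Inv (hd tl : A → V) (loc : I → V) (f : MvPolynomial (MVar A I) K) : Prop :=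
  ∀ g : V → Matrix (Fin 2) (Fin 2) K, (∀ v, (g v).det = 1) → aeval (act hd tl loc g) f = f

lemma aeval_aeval {σ τ B : Type} [CommRing B] [Algebra K B] (x : τ → B)
    (φ : σ → MvPolynomial τ K) (f : MvPolynomial σ K) :
    aeval x (aeval φ f) = aeval (fun v => aeval x (φ v)) f := by
  rw [← AlgHom.comp_apply, MvPolynomial.comp_aeval]

lemma Inv.sub {hd tl : A → V} {loc : I → V} {f h : MvPolynomial (MVar A I) K}
    (hf : Inv hd tl loc f) (hh : Inv hd tl loc h) : Inv hd tl loc (f - h) := by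
  intro g hg; rw [map_sub, hf g hg, hh g hg]

lemma Inv.of_mul {hd tl : A → V} {loc : I → V} {D h : MvPolynomial (MVar A I) K}
    (hf : Inv hd tl loc (D * h)) (hD : Inv hd tl loc D) (h0 : D ≠ 0) : Inv hd tl loc h := by
  intro g hg
  have := hf g hg
  rw [map_mul, hD g hg] at this
  exact mul_left_cancel₀ h0 this

/-- bracket -/
noncomputable def br (i j : I) : MvPolynomial (MVar A I) K :=
  X (Sum.inr (i, 0)) * X (Sum.inr (j, 1)) - X (Sum.inr (i, 1)) * X (Sum.inr (j, 0))

lemma br_inv (hd tl : A → V) (loc : I → V) {i j : I} (h : loc i = loc j) :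
    Inv hd tl loc (br i j : MvPolynomial (MVar A I) K) := by
  intro g hg
  have h1 := hg (loc j)
  rw [Matrix.det_fin_two] at h1
  have h2 := congrArg (C : K → MvPolynomial (MVar A I) K) h1
  simp only [map_sub, map_mul, map_one] at h2
  simp only [br, map_sub, map_mul, aeval_X, act, Fin.sum_univ_two, h]
  linear_combination (X (Sum.inr (i, 0)) * X (Sum.inr (j, 1)) -
    X (Sum.inr (i, 1)) * X (Sum.inr (j, 0))) * h2

lemma br_MH (i j : I) : MH ltr (br i j : MvPolynomial (MVar A I) K)
    (Sum.elim 0 fun k => (if i = k then 1 else 0) + (if j = k then 1 else 0)) := by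
  have h : ∀ c d : Fin 2, MH ltr (X (Sum.inr (i, c)) * X (Sum.inr (j, d)) :
      MvPolynomial (MVar A I) K)
      (Sum.elim 0 fun k => (if i = k then 1 else 0) + (if j = k then 1 else 0)) := by
    intro c d
    have := IsWeightedHomogeneous.mul (MH_X (K := K) (ltr (A := A)) (Sum.inr (i, c)))
      (MH_X (K := K) (ltr (A := A)) (Sum.inr (j, d)))
    unfold MH
    convert this using 1
    funext l
    rcases l with a | k <;> simp [ltr]
  exact IsWeightedHomogeneous.sub (h 0 1) (h 1 0)

lemma br_ne_zero {i j : I} (h : i ≠ j) : (br i j : MvPolynomial (MVar A I) K) ≠ 0 := by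
  intro h0
  have := congrArg (eval (fun v : MVar A I => match v with
    | Sum.inl _ => (0 : K)
    | Sum.inr (k, c) => if k = i then (if c = 0 then 1 else 0) else 1)) h0
  simp [br, h.symm] at this

lemma X_not_dvd_br {i j : I} (h : i ≠ j) :
    ¬ ((X (Sum.inr (j, 0)) : MvPolynomial (MVar A I) K) ∣ br i j) := by
  apply not_X_dvd (fun v : MVar A I => match v with
    | Sum.inl _ => (0 : K)
    | Sum.inr (k, c) => if k = i then 1 else (if c = 0 then 0 else 1))
  · simp [h.symm]
  · simp [br, h.symm]

/-- span of bracket monomials of degree r -/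
noncomputable def BSpan (K : Type) [Field K] (A : Type) {I V : Type} (loc : I → V) (r : I → ℕ) :
    Submodule K (MvPolynomial (MVar A I) K) :=
  Submodule.span K {x | ∃ (J : Type) (_ : Fintype J) (w : J × Bool → I),
    (∀ j, loc (w (j, false)) = loc (w (j, true))) ∧ (∀ i, Nat.card {x // w x = i} = r i) ∧
    x = ∏ j, br (w (j, false)) (w (j, true))}

lemma natcard_fiber {X : Type} [Fintype X] (w : X → I) (i : I) :
    Nat.card {x // w x = i} = ∑ x, if w x = i then 1 else 0 := by
  rw [Nat.card_eq_fintype_card, Fintype.card_subtype, Finset.card_filter]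

lemma BSpan_MH {loc : I → V} {r : I → ℕ} {f : MvPolynomial (MVar A I) K}
    (hf : f ∈ BSpan K A loc r) : MH ltr f (Sum.elim 0 r) := by
  suffices BSpan K A loc r ≤ weightedHomogeneousSubmodule K (wt ltr) (Sum.elim 0 r) from this hf
  refine Submodule.span_le.2 ?_
  rintro _ ⟨J, _, w, _, hw, rfl⟩
  have h := IsWeightedHomogeneous.prod Finset.univ
    (fun j : J => (br (w (j, false)) (w (j, true)) : MvPolynomial (MVar A I) K)) _
    (fun j _ => br_MH (A := A) (K := K) (w (j, false)) (w (j, true)))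
  change IsWeightedHomogeneous _ _ _
  convert h using 1
  funext l
  rw [Finset.sum_apply]
  rcases l with a | i
  · simp
  · simp only [Sum.elim_inr]
    rw [← hw, natcard_fiber, Fintype.sum_prod_type]
    refine Finset.sum_congr rfl fun j _ => ?_
    rw [Fintype.sum_bool, add_comm]

lemma BSpan_inv (hd tl : A → V) {loc : I → V} {r : I → ℕ} {f : MvPolynomial (MVar A I) K}
    (hf : f ∈ BSpan K A loc r) : Inv hd tl loc f := by
  intro g hg
  induction hf using Submodule.span_induction with
  | mem x hx =>
    obtain ⟨J, _, w, hw, _, rfl⟩ := hx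
    rw [map_prod]
    exact Finset.prod_congr rfl fun j _ => br_inv hd tl loc (hw j) g hg
  | zero => simp
  | add x y _ _ hx hy => rw [map_add, hx, hy]
  | smul c x _ hx => rw [map_smul, hx]

/-- substitution `u_i := u_j`. -/
noncomputable def merge (i j : I) : MVar A I → MvPolynomial (MVar A I) K
  | Sum.inl v => X (Sum.inl v)
  | Sum.inr v => X (Sum.inr (if v.1 = i then j else v.1, v.2))

lemma merge_inv {hd tl : A → V} {loc : I → V} {f : MvPolynomial (MVar A I) K}
    (hf : Inv hd tl loc f) {i j : I} (h : loc i = loc j) :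
    Inv hd tl loc (aeval (merge (K := K) i j) f) := by
  intro g hg
  conv_rhs => rw [← hf g hg]
  rw [aeval_aeval, aeval_aeval]
  congr 2
  funext v
  rcases v with ⟨a, k, l⟩ | ⟨k, c⟩
  · simp [act, merge, MvPolynomial.algebraMap_eq]
  · by_cases hk : k = i
    · subst hk; simp [act, merge, h, MvPolynomial.algebraMap_eq]
    · simp [act, merge, hk, MvPolynomial.algebraMap_eq]

lemma merge_MH [Fintype A] [Fintype I] {r : I → ℕ} {f : MvPolynomial (MVar A I) K}
    (hf : MH ltr f (Sum.elim 0 r)) {i j : I} (hij : i ≠ j) :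
    MH ltr (aeval (merge (K := K) i j) f)
      (Sum.elim 0 fun k => if k = i then 0 else if k = j then r j + r i else r k) := by
  have := hf.map ltr (merge (K := K) i j)
    (fun l l' => if (Sum.elim Sum.inl (fun k => Sum.inr (if k = i then j else k)) l : Ltr A I) = l'
      then 1 else 0) ?_
  · unfold MH at this ⊢
    convert this using 1
    funext l
    rcases l with a | k'
    · simp
    · simp only [Sum.elim_inr, Fintype.sum_sum_type, Sum.elim_inl, Pi.zero_apply, zero_mul,
        Finset.sum_const_zero, zero_add, Sum.inr.injEq]
      have : ∀ k, r k * (if (if k = i then j else k) = k' then 1 else 0) =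
          (if k = i then (if j = k' then r i else 0) else 0) +
          (if k = k' then (if k = i then 0 else r k) else 0) := by
        intro k
        by_cases h1 : k = i
        · subst h1; simp
        · simp [h1]
      rw [Finset.sum_congr rfl fun k _ => this k, Finset.sum_add_distrib]
      simp only [Finset.sum_ite_eq', Finset.mem_univ, if_true]
      by_cases h1 : k' = i
      · subst h1; simp [hij.symm]
      · by_cases h2 : k' = j
        · subst h2; simp [h1, add_comm]
        · simp [h1, h2, Ne.symm h2]
  · rintro (v | v) _
    · have := MH_X (K := K) ltr (Sum.inl v : MVar A I)
      unfold MH at this ⊢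
      convert this <;> rfl
    · have := MH_X (K := K) ltr (Sum.inr (if v.1 = i then j else v.1, v.2) : MVar A I)
      unfold MH at this ⊢
      convert this <;> rfl

lemma merge_lift [Fintype I] {loc : I → V} {r : I → ℕ} {i j : I} (hij : i ≠ j)
    (h : loc i = loc j) {f : MvPolynomial (MVar A I) K}
    (hf : f ∈ BSpan K A loc (fun k => if k = i then 0 else if k = j then r j + r i else r k)) :
    ∃ P ∈ BSpan K A loc r, aeval (merge (K := K) i j) P = f := by
  suffices BSpan K A loc (fun k => if k = i then 0 else if k = j then r j + r i else r k) ≤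
      (BSpan K A loc r).map (aeval (merge (K := K) i j) :
        MvPolynomial (MVar A I) K →ₐ[K] _).toLinearMap by
    obtain ⟨P, hP, e⟩ := this hf
    exact ⟨P, hP, e⟩
  refine Submodule.span_le.2 ?_
  rintro _ ⟨J, _, w, hl, hw, rfl⟩
  beta_reduce at hw
  have hwj := hw j
  rw [if_neg hij.symm, if_pos rfl, Nat.card_eq_fintype_card, Fintype.card_subtype] at hwj
  obtain ⟨T, hT, hTc⟩ := Finset.exists_subset_card_eq (s := Finset.univ.filter (fun x => w x = j))
    (n := r i) (by omega)
  have hTj : ∀ x ∈ T, w x = j := fun x hx => (Finset.mem_filter.1 (hT hx)).2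
  have hwi : ∀ x, w x ≠ i := by
    intro x hx
    have := hw i
    rw [if_pos rfl, Nat.card_eq_fintype_card, Fintype.card_eq_zero_iff] at this
    exact this.false ⟨x, hx⟩
  let w' : J × Bool → I := fun x => if x ∈ T then i else w x
  have hlw : ∀ x, loc (w' x) = loc (w x) := by
    intro x
    by_cases hx : x ∈ T
    · simp [w', hx, hTj x hx, h]
    · simp [w', hx]
  have hmw : ∀ x, (if w' x = i then j else w' x) = w x := by
    intro x
    by_cases hx : x ∈ T
    · simp [w', hx, hTj x hx]
    · simp [w', hx, hwi x]
  refine ⟨∏ j, br (w' (j, false)) (w' (j, true)), Submodule.subset_span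
    ⟨J, _, w', fun j => by rw [hlw, hlw, hl], ?_, rfl⟩, ?_⟩
  · intro k
    rw [Nat.card_eq_fintype_card, Fintype.card_subtype]
    by_cases hk : k = i
    · subst hk
      rw [← hTc]
      congr 1
      ext x
      by_cases hx : x ∈ T
      · simp [w', hx]
      · simp [w', hx, hwi x]
    · by_cases hk' : k = j
      · subst hk'
        have : Finset.univ.filter (fun x => w' x = k) =
            (Finset.univ.filter (fun x => w x = k)) \ T := by
          ext x
          by_cases hx : x ∈ T
          · simp [w', hx, hij]
          · simp [w', hx]
        rw [this, Finset.card_sdiff_of_subset hT, hwj, hTc]; omega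
      · have := hw k
        rw [if_neg hk, if_neg hk', Nat.card_eq_fintype_card, Fintype.card_subtype] at this
        rw [← this]
        congr 1
        ext x
        by_cases hx : x ∈ T
        · simp [w', hx, Ne.symm hk, hTj x hx, Ne.symm hk']
        · simp [w', hx]
  · simp only [AlgHom.toLinearMap_apply, map_prod]
    refine Finset.prod_congr rfl fun j => ?_
    simp [br, merge, hmw]

lemma br_dvd [Fintype A] [Fintype I] {r : I → ℕ} {F : MvPolynomial (MVar A I) K}
    (hF : MH ltr F (Sum.elim 0 r)) {i j : I} (hij : i ≠ j) (h0 : aeval (merge (K := K) i j) F = 0) :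
    br i j ∣ F := by
  refine dvd_of_dvd_X_pow_mul (v := Sum.inr (j, 0)) (N := r i) ?_ (X_not_dvd_br hij)
  rw [← Ideal.mem_span_singleton, ← Ideal.Quotient.eq_zero_iff_mem]
  set B := MvPolynomial (MVar A I) K ⧸ Ideal.span {(br i j : MvPolynomial (MVar A I) K)}
  let q : MvPolynomial (MVar A I) K →ₐ[K] B := Ideal.Quotient.mkₐ K _
  change q _ = 0
  have hbr : q (br i j) = 0 := by
    change Ideal.Quotient.mk _ _ = 0
    rw [Ideal.Quotient.eq_zero_iff_mem]; exact Ideal.mem_span_singleton_self _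
  have e1 := hF.scale (fun v => q (X v)) (fun l => if l = Sum.inr i then q (X (Sum.inr (j, 0))) else 1)
  have e2 := hF.scale (fun v => q (merge (K := K) i j v))
    (fun l => if l = Sum.inr i then q (X (Sum.inr (i, 0))) else 1)
  have e3 : aeval (fun v => q (merge (K := K) i j v)) F = 0 := by
    have : aeval (fun v => q (merge (K := K) i j v)) F = q (aeval (merge (K := K) i j) F) := by
      rw [← AlgHom.comp_apply, MvPolynomial.comp_aeval]
    rw [this, h0, map_zero]
  have e4 : aeval (fun v => q (X v)) F = q F := by
    have : q = aeval (fun v => q (X v)) := by ext; simp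
    conv_rhs => rw [this]
  rw [e3, mul_zero] at e2
  have e5 : (∏ l : Ltr A I, (if l = Sum.inr i then q (X (Sum.inr (j, 0))) else 1) ^
      (Sum.elim 0 r : Ltr A I → ℕ) l) = q (X (Sum.inr (j, 0))) ^ r i := by
    rw [Finset.prod_eq_single (Sum.inr i)]
    · simp
    · intro l _ hl; simp [hl]
    · simp
  rw [e5, e4] at e1
  rw [map_mul, map_pow, ← e1, ← e2]
  congr 2
  funext v
  rcases v with v | ⟨k, c⟩
  · simp [ltr, merge]
  · by_cases hk : k = i
    · subst hk
      simp only [ltr, merge, if_true, ← map_mul]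
      fin_cases c
      · simp [mul_comm]
      · rw [← sub_eq_zero, ← map_sub, ← neg_eq_zero, ← map_neg]
        rw [← hbr]
        congr 1
        simp [br]; ring
    · simp [ltr, merge, hk]

lemma isolated_zero [Infinite K] [Fintype A] [Fintype I] {hd tl : A → V} {loc : I → V} {r : I → ℕ}
    {f : MvPolynomial (MVar A I) K} (hf : Inv hd tl loc f) (hh : MH ltr f (Sum.elim 0 r))
    {i : I} (hi : r i ≠ 0) (hiso : ∀ j, j ≠ i → r j ≠ 0 → loc j ≠ loc i) : f = 0 := by
  obtain ⟨c, hc0, hc⟩ := exists_pow_ne_one (K := K) hi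
  -- values
  have key : ∀ x : MVar A I → K, x (Sum.inr (i, 0)) ≠ 0 → aeval x f = 0 := by
    intro x hx
    -- invariance for matrices at `loc i`
    have hinv : ∀ (M : Matrix (Fin 2) (Fin 2) K), M.det = 1 → ∀ y : MVar A I → K,
        aeval (fun v => match v with
          | Sum.inl v => y (Sum.inl v)
          | Sum.inr v => if v.1 = i then M v.2 0 * y (Sum.inr (i, 0)) + M v.2 1 * y (Sum.inr (i, 1))
            else y (Sum.inr v)) f = aeval y f := by
      intro M hM y
      have h1 := hf (fun v => if v = loc i then M else 1) (by intro v; split_ifs <;> simp [hM])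
      conv_rhs => rw [← h1]
      rw [aeval_aeval]
      refine hh.congr ?_
      rintro (v | ⟨k, d⟩) hv
      · simp [ltr] at hv
      · simp only [ltr, Sum.elim_inr] at hv
        by_cases hk : k = i
        · subst hk
          simp [act, Fin.sum_univ_two]
        · have := hiso k hk hv
          simp only [hk, if_false, act, this, map_sum, map_mul, aeval_X, aeval_C, Matrix.one_apply]
          simp
    have e1 := hinv !![1, 0; - x (Sum.inr (i, 1)) / x (Sum.inr (i, 0)), 1] (by simp) x
    set y : MVar A I → K := (fun v => match v with
          | Sum.inl v => x (Sum.inl v)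
          | Sum.inr v => if v.1 = i then (if v.2 = 0 then x (Sum.inr (i, 0)) else 0)
            else x (Sum.inr v)) with hy
    have e1' : aeval y f = aeval x f := by
      rw [← e1]
      congr 2
      funext v
      rcases v with v | ⟨k, d⟩
      · rfl
      · by_cases hk : k = i
        · subst hk
          fin_cases d
          · simp [hy]
          · simp [hy]; field_simp; ring
        · simp [hy, hk]
    have e2 := hinv !![c, 0; 0, c⁻¹] (by simp [hc0]) y
    have e3 := hh.scale y (fun l => if l = Sum.inr i then c else 1)
    have e5 : (∏ l : Ltr A I, (if l = Sum.inr i then c else 1) ^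
        (Sum.elim 0 r : Ltr A I → ℕ) l) = c ^ r i := by
      rw [Finset.prod_eq_single (Sum.inr i)]
      · simp
      · intro l _ hl; simp [hl]
      · simp
    rw [e5] at e3
    have e6 : aeval y f = c ^ r i * aeval y f := by
      rw [← e3]
      conv_lhs => rw [← e2]
      congr 2
      funext v
      rcases v with v | ⟨k, d⟩
      · simp [hy, ltr]
      · by_cases hk : k = i
        · subst hk
          fin_cases d
          · simp [hy, ltr]
          · simp [hy, ltr]
        · simp [hy, hk, ltr]
    rw [← e1']
    have : (c ^ r i - 1) * aeval y f = 0 := by rw [sub_mul, ← e6]; ring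
    rcases mul_eq_zero.1 this with h | h
    · exact absurd (sub_eq_zero.1 h) hc
    · exact h
  have : X (Sum.inr (i, 0)) * f = 0 := by
    apply MvPolynomial.funext
    intro x
    by_cases hx : x (Sum.inr (i, 0)) = 0
    · simp [hx]
    · have := key x hx
      rw [MvPolynomial.aeval_eq_eval] at this
      simp [this]
  rcases mul_eq_zero.1 this with h | h
  · exact absurd h (X_ne_zero _)
  · exact h

theorem vector_fft [Infinite K] [Fintype A] [Fintype I] (hd tl : A → V) (loc : I → V) :
    ∀ (N : ℕ) (r : I → ℕ) (f : MvPolynomial (MVar A I) K),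
      (∑ i, r i) + (Finset.univ.filter (fun i => r i ≠ 0)).card ≤ N →
      Inv hd tl loc f → MH ltr f (Sum.elim 0 r) → f ∈ BSpan K A loc r := by
  intro N
  induction N using Nat.strong_induction_on with
  | _ N IH =>
  intro r f hN hf hh
  by_cases hr : ∃ i, r i ≠ 0
  swap
  · push Not at hr
    have hr0 : r = 0 := funext hr
    subst hr0
    have h0 : (Sum.elim 0 0 : Ltr A I → ℕ) = 0 := by funext l; rcases l <;> rfl
    rw [h0] at hh
    rw [hh.eq_C, C_eq_smul_one]
    refine Submodule.smul_mem _ _ (Submodule.subset_span ⟨Empty, inferInstance, fun x => x.1.elim,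
      fun j => j.elim, ?_, ?_⟩)
    · intro i
      have : IsEmpty {x : Empty × Bool // (fun x : Empty × Bool => (x.1.elim : I)) x = i} :=
        ⟨fun x => x.1.1.elim⟩
      simp
    · simp
  obtain ⟨i, hi⟩ := hr
  by_cases hiso : ∀ j, j ≠ i → r j ≠ 0 → loc j ≠ loc i
  · rw [isolated_zero hf hh hi hiso]; exact Submodule.zero_mem _
  push Not at hiso
  obtain ⟨j, hji, hj, hl⟩ := hiso
  have hij : i ≠ j := hji.symm
  -- merge
  set r' : I → ℕ := fun k => if k = i then 0 else if k = j then r j + r i else r k with hr'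
  have hsum : ∑ k, r' k = ∑ k, r k := by
    have h1 : ∀ k, r' k + (if k = i then r i else 0) = r k + (if k = j then r i else 0) := by
      intro k
      by_cases h1 : k = i
      · subst h1; simp [hr', hij]
      · by_cases h2 : k = j
        · subst h2; simp [hr', h1]
        · simp [hr', h1, h2]
    have h2 := Finset.sum_congr rfl fun k (_ : k ∈ Finset.univ) => h1 k
    rw [Finset.sum_add_distrib, Finset.sum_add_distrib] at h2
    simpa using h2
  have hsupp : (Finset.univ.filter (fun k => r' k ≠ 0)).card <
      (Finset.univ.filter (fun k => r k ≠ 0)).card := by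
    apply Finset.card_lt_card
    refine Finset.ssubset_iff_subset_ne.2 ⟨?_, ?_⟩
    · intro k hk
      simp only [Finset.mem_filter, Finset.mem_univ, true_and] at hk ⊢
      by_cases h1 : k = i
      · subst h1; exact hi
      · by_cases h2 : k = j
        · subst h2; exact hj
        · simpa [hr', h1, h2] using hk
    · intro h
      have : i ∈ Finset.univ.filter (fun k => r k ≠ 0) := by simp [hi]
      rw [← h] at this
      simp [hr'] at this
  have hg := IH _ (lt_of_lt_of_le (by omega) hN) r' _ le_rfl (merge_inv hf hl.symm)
    (merge_MH hh hij)
  obtain ⟨P, hP, hPe⟩ := merge_lift hij hl.symm hg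
  have hFi := hf.sub (BSpan_inv hd tl hP)
  have hFh : MH ltr (f - P) (Sum.elim 0 r) := IsWeightedHomogeneous.sub hh (BSpan_MH hP)
  obtain ⟨h, hfac⟩ := br_dvd hFh hij (by rw [map_sub, hPe, sub_self])
  have hfP : f = (f - P) + P := by ring
  rw [hfP]
  refine Submodule.add_mem _ ?_ hP
  rcases hFh.factor (br_MH i j) hfac with h0 | ⟨s, h', hs, hsr, he⟩
  · rw [h0]; exact Submodule.zero_mem _
  rw [he]
  rw [he] at hFi
  have hh'i := hFi.of_mul (br_inv hd tl loc hl.symm) (br_ne_zero hij)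
  set s' : I → ℕ := fun k => s (Sum.inr k) with hs'
  have hss : s = (Sum.elim 0 s' : Ltr A I → ℕ) := by
    funext l
    rcases l with a | k
    · have := congrFun hsr (Sum.inl a); simpa using this
    · rfl
  have hrs : ∀ k, r k = (if i = k then 1 else 0) + (if j = k then 1 else 0) + s' k := by
    intro k
    have := congrFun hsr (Sum.inr k)
    simp only [Pi.add_apply, Sum.elim_inr] at this
    rw [← this]
  have hsumr : ∑ k, r k = 2 + ∑ k, s' k := by
    rw [Finset.sum_congr rfl fun k _ => hrs k]
    simp [Finset.sum_add_distrib]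
  have hsuppr : (Finset.univ.filter (fun k => s' k ≠ 0)).card ≤
      (Finset.univ.filter (fun k => r k ≠ 0)).card := by
    apply Finset.card_le_card
    intro k hk
    simp only [Finset.mem_filter, Finset.mem_univ, true_and] at hk ⊢
    rw [hrs]; omega
  rw [hss] at hs
  have hmem := IH _ (lt_of_lt_of_le (by omega) hN) s' h' le_rfl hh'i hs
  -- multiply by the bracket
  suffices H : BSpan K A loc s' ≤ (BSpan K A loc r).comap (LinearMap.mulLeft K (br i j)) from H hmem
  refine Submodule.span_le.2 ?_
  rintro _ ⟨J, _, w, hlw, hw, rfl⟩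
  refine Submodule.subset_span ⟨Option J, inferInstance,
    fun x => match x with
      | (none, b) => if b then j else i
      | (some t, b) => w (t, b), ?_, ?_, ?_⟩
  · rintro (_ | t)
    · simp [hl]
    · simpa using hlw t
  · intro k
    rw [natcard_fiber, Fintype.sum_prod_type, Fintype.sum_option, hrs k, ← hw k, natcard_fiber,
      Fintype.sum_prod_type, Fintype.sum_bool]
    simp only [if_true, Bool.false_eq_true, if_false]
    ring
  · rw [Fintype.prod_option]
    simp

end QInv


namespace QInv
open MvPolynomial

section val
variable {B : Type} [CommRing B]

/-- the standard alternating form -/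
def eps (i j : Fin 2) : ℤ := if i = j then 0 else if i = 0 then 1 else -1

lemma sum_prod_bool {J : Type} [Fintype J] (F : J → Fin 2 → Fin 2 → B) :
    ∑ φ : J × Bool → Fin 2, ∏ j, F j (φ (j, false)) (φ (j, true)) = ∏ j, ∑ a, ∑ b, F j a b := by
  have h1 : ∀ j, ∑ a, ∑ b, F j a b = ∑ h : Bool → Fin 2, F j (h false) (h true) := by
    intro j
    rw [← Fintype.sum_prod_type']
    exact (Fintype.sum_equiv (Equiv.boolArrowEquivProd (Fin 2)) _ _ (fun h => rfl)).symm
  simp_rw [h1]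
  rw [Finset.prod_univ_sum, Fintype.piFinset_univ]
  exact Fintype.sum_equiv (Equiv.curry J Bool (Fin 2)) _ _ (fun φ => rfl)

/-- the value of a matching on a family of 2-tensors -/
noncomputable def val {P J : Type} [Fintype P] [Fintype J] (Y : P → Fin 2 → Fin 2 → B)
    (E : P × Bool ≃ J × Bool) : B :=
  ∑ φ : J × Bool → Fin 2, (∏ j, (eps (φ (j, false)) (φ (j, true)) : B)) *
    ∏ p, Y p (φ (E (p, true))) (φ (E (p, false)))

variable {P J : Type} [Fintype P] [Fintype J]

lemma val_def [inst : Fintype (J × Bool → Fin 2)] (Y : P → Fin 2 → Fin 2 → B)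
    (E : P × Bool ≃ J × Bool) : val Y E = ∑ φ : J × Bool → Fin 2,
    (∏ j, (eps (φ (j, false)) (φ (j, true)) : B)) *
    ∏ p, Y p (φ (E (p, true))) (φ (E (p, false))) := by
  unfold val
  congr!

lemma val_map {B' : Type} [CommRing B'] (F : B →+* B') (Y : P → Fin 2 → Fin 2 → B)
    (E : P × Bool ≃ J × Bool) : F (val Y E) = val (fun p i j => F (Y p i j)) E := by
  simp [val, map_sum, map_prod]

lemma prod_bool_equiv (E : P × Bool ≃ J × Bool) (u : P × Bool → Fin 2 → B) (φ : J × Bool → Fin 2) :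
    ∏ p, u (p, true) (φ (E (p, true))) * u (p, false) (φ (E (p, false))) =
      ∏ j, u (E.symm (j, false)) (φ (j, false)) * u (E.symm (j, true)) (φ (j, true)) := by
  have h1 : ∏ x : P × Bool, u x (φ (E x)) = ∏ z : J × Bool, u (E.symm z) (φ z) :=
    Fintype.prod_equiv E _ _ (fun x => by simp)
  rw [Fintype.prod_prod_type, Fintype.prod_prod_type] at h1
  simp only [Fintype.prod_bool] at h1
  rw [h1]
  exact Finset.prod_congr rfl fun j _ => mul_comm _ _

lemma val_split (u : P × Bool → Fin 2 → B) (E : P × Bool ≃ J × Bool) :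
    val (fun p i j => u (p, true) i * u (p, false) j) E =
      ∏ j, (u (E.symm (j, false)) 0 * u (E.symm (j, true)) 1 -
        u (E.symm (j, false)) 1 * u (E.symm (j, true)) 0) := by
  unfold val
  simp_rw [prod_bool_equiv, ← Finset.prod_mul_distrib]
  rw [sum_prod_bool (fun j a b => (eps a b : B) * (u (E.symm (j, false)) a *
    u (E.symm (j, true)) b))]
  refine Finset.prod_congr rfl fun j _ => ?_
  simp [Fin.sum_univ_two, eps]
  ring

lemma val_inv (G : P × Bool → Matrix (Fin 2) (Fin 2) B) (Y : P → Fin 2 → Fin 2 → B)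
    (E : P × Bool ≃ J × Bool) (hG : ∀ j, G (E.symm (j, false)) = G (E.symm (j, true)))
    (hd : ∀ x, (G x).det = 1) :
    val (fun p i j => ∑ k, ∑ l, G (p, true) i k * G (p, false) j l * Y p k l) E = val Y E := by
  have h1 : ∀ φ : J × Bool → Fin 2, ∏ p, (∑ k, ∑ l, G (p, true) (φ (E (p, true))) k *
      G (p, false) (φ (E (p, false))) l * Y p k l) =
      ∑ χ : J × Bool → Fin 2, (∏ j, G (E.symm (j, false)) (φ (j, false)) (χ (j, false)) *
        G (E.symm (j, true)) (φ (j, true)) (χ (j, true))) *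
        ∏ p, Y p (χ (E (p, true))) (χ (E (p, false))) := by
    intro φ
    have h2 := sum_prod_bool (fun p l k => G (p, true) (φ (E (p, true))) k *
      G (p, false) (φ (E (p, false))) l * Y p k l)
    have h3 : ∀ p, ∑ k, ∑ l, G (p, true) (φ (E (p, true))) k *
      G (p, false) (φ (E (p, false))) l * Y p k l = ∑ l, ∑ k, G (p, true) (φ (E (p, true))) k *
      G (p, false) (φ (E (p, false))) l * Y p k l := fun p => Finset.sum_comm
    simp_rw [h3]
    rw [← h2]
    refine Fintype.sum_equiv (Equiv.arrowCongr E (Equiv.refl _)) _ _ (fun χ => ?_)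
    rw [Finset.prod_mul_distrib]
    simp only [Equiv.arrowCongr_apply, Function.comp, Equiv.symm_apply_apply, Equiv.refl_apply]
    congr 1
    have := prod_bool_equiv E (fun x i => G x i (χ x)) φ
    exact this
  unfold val
  simp_rw [h1, Finset.mul_sum]
  rw [Finset.sum_comm]
  refine Finset.sum_congr rfl fun χ _ => ?_
  simp_rw [← mul_assoc, ← Finset.sum_mul, ← Finset.prod_mul_distrib]
  congr 1
  rw [sum_prod_bool (fun j a b => (eps a b : B) * (G (E.symm (j, false)) a (χ (j, false)) *
        G (E.symm (j, true)) b (χ (j, true))))]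
  refine Finset.prod_congr rfl fun j _ => ?_
  have hdet := hd (E.symm (j, true))
  rw [Matrix.det_fin_two] at hdet
  rw [hG j]
  generalize G (E.symm (j, true)) = M at hdet
  generalize χ (j, false) = a
  generalize χ (j, true) = b
  fin_cases a <;> fin_cases b <;> simp [Fin.sum_univ_two, eps]
  · ring
  · linear_combination hdet
  · linear_combination -hdet
  · ring

variable {P' J' : Type} [Fintype P'] [Fintype J']

/-- disjoint union of matchings -/
def sumE (E : P × Bool ≃ J × Bool) (E' : P' × Bool ≃ J' × Bool) :
    (P ⊕ P') × Bool ≃ (J ⊕ J') × Bool :=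
  (Equiv.sumProdDistrib P P' Bool).trans
    ((Equiv.sumCongr E E').trans (Equiv.sumProdDistrib J J' Bool).symm)

lemma val_sum (Y : P → Fin 2 → Fin 2 → B) (Y' : P' → Fin 2 → Fin 2 → B)
    (E : P × Bool ≃ J × Bool) (E' : P' × Bool ≃ J' × Bool) :
    val (Sum.elim Y Y') (sumE E E') = val Y E * val Y' E' := by
  rw [val_def, val_def, val_def]
  rw [Finset.sum_mul_sum, ← Fintype.sum_prod_type']
  refine Fintype.sum_equiv ((Equiv.arrowCongr (Equiv.sumProdDistrib J J' Bool)
    (Equiv.refl _)).trans (Equiv.sumArrowEquivProdArrow _ _ _)) _ _ (fun φ => ?_)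
  rw [Fintype.prod_sum_type, Fintype.prod_sum_type]
  simp [sumE, Equiv.arrowCongr, Equiv.sumArrowEquivProdArrow]
  ring

lemma sum_four (T : Fin 2 → Fin 2 → Fin 2 → Fin 2 → B) :
    ∑ φ : Bool × Bool → Fin 2, T (φ (true, false)) (φ (true, true)) (φ (false, false))
      (φ (false, true)) = ∑ a, ∑ b, ∑ c, ∑ d, T a b c d := by
  refine (Fintype.sum_equiv (Equiv.curry Bool Bool (Fin 2)) _
    (fun φ => T (φ true false) (φ true true) (φ false false) (φ false true)) (fun φ => rfl)).trans ?_
  refine (Fintype.sum_equiv (Equiv.boolArrowEquivProd (Bool → Fin 2)) _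
    (fun φ => T (φ.2 false) (φ.2 true) (φ.1 false) (φ.1 true)) (fun φ => rfl)).trans ?_
  rw [Fintype.sum_prod_type]
  rw [Finset.sum_comm]
  refine (Fintype.sum_equiv (Equiv.boolArrowEquivProd (Fin 2)) _
    (fun φ => ∑ y : Bool → Fin 2, T φ.1 φ.2 (y false) (y true)) (fun φ => rfl)).trans ?_
  rw [Fintype.sum_prod_type]
  refine Finset.sum_congr rfl fun a _ => Finset.sum_congr rfl fun b _ => ?_
  refine (Fintype.sum_equiv (Equiv.boolArrowEquivProd (Fin 2)) _
    (fun y => T a b y.1 y.2) (fun φ => rfl)).trans ?_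
  rw [Fintype.sum_prod_type]

lemma val_det (Y : Fin 2 → Fin 2 → B) :
    val (fun _ : Bool => Y) (Equiv.prodComm Bool Bool) = 2 * (Y 0 0 * Y 1 1 - Y 0 1 * Y 1 0) := by
  rw [val_def]
  rw [← Fintype.sum_congr _ _ (f := fun φ : Bool × Bool → Fin 2 =>
    (fun a b c d : Fin 2 => ((eps a b : B) * eps c d) * (Y a c * Y b d))
        (φ (true, false)) (φ (true, true)) (φ (false, false)) (φ (false, true)))]
  · rw [sum_four (fun a b c d : Fin 2 => ((eps a b : B) * eps c d) * (Y a c * Y b d))]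
    simp [Fin.sum_univ_two, eps]
    ring
  · intro φ
    simp [mul_comm]

end val
end QInv


namespace QInv
open MvPolynomial

variable {K : Type} [Field K] {A V : Type}

/-- legs of arrows and their vertices -/
def legLoc (hd tl : A → V) (x : A × Bool) : V := if x.2 then hd x.1 else tl x.1

/-- generic 2-tensors -/
noncomputable def gen (K : Type) [Field K] (A : Type) (a : A) (i j : Fin 2) :
    MvPolynomial (A × Fin 2 × Fin 2) K := X (a, i, j)

/-- span of values of compatible matchings of multidegree `r` -/
noncomputable def VSpan (K : Type) [Field K] (hd tl : A → V) (r : A → ℕ) :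
    Submodule K (MvPolynomial (A × Fin 2 × Fin 2) K) :=
  Submodule.span K {x | ∃ (P J : Type) (_ : Fintype P) (_ : Fintype J) (c : P → A)
    (E : P × Bool ≃ J × Bool),
    (∀ a, Nat.card {p // c p = a} = r a) ∧
    (∀ j, legLoc hd tl (c (E.symm (j, false)).1, (E.symm (j, false)).2) =
      legLoc hd tl (c (E.symm (j, true)).1, (E.symm (j, true)).2)) ∧
    x = val (fun p => gen K A (c p)) E}

abbrev MV (A : Type) := MVar A (A × Bool)

/-- splitting of the arrows in `M` -/
noncomputable def thetaV (K : Type) [Field K] (M : Finset A) (v : A × Fin 2 × Fin 2) :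
    MvPolynomial (MV A) K :=
  if v.1 ∈ M then X (Sum.inr ((v.1, true), v.2.1)) * X (Sum.inr ((v.1, false), v.2.2))
  else X (Sum.inl v)

noncomputable def theta (K : Type) [Field K] (M : Finset A) :
    MvPolynomial (A × Fin 2 × Fin 2) K →ₐ[K] MvPolynomial (MV A) K := aeval (thetaV K M)

/-- splitting of one arrow -/
noncomputable def splitV (K : Type) [Field K] (a : A) : MV A → MvPolynomial (MV A) K
  | Sum.inl v => if v.1 = a then X (Sum.inr ((a, true), v.2.1)) * X (Sum.inr ((a, false), v.2.2))
      else X (Sum.inl v)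
  | Sum.inr v => X (Sum.inr v)

noncomputable def degM (M : Finset A) (r : A → ℕ) : Ltr A (A × Bool) → ℕ :=
  Sum.elim (fun a => if a ∈ M then 0 else r a) (fun i => if i.1 ∈ M then r i.1 else 0)

lemma split_theta {a : A} {M : Finset A} (ha : a ∉ M) (P : MvPolynomial (A × Fin 2 × Fin 2) K) :
    aeval (splitV K a) (theta K M P) = theta K (insert a M) P := by
  unfold theta
  rw [aeval_aeval]
  congr 2
  funext v
  obtain ⟨b, i, j⟩ := v
  by_cases hb : b = a
  · subst hb; simp [thetaV, ha, splitV]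
  · by_cases hbM : b ∈ M
    · simp [thetaV, hbM, splitV]
    · simp [thetaV, hbM, splitV, hb]

lemma theta_val {P J : Type} [Fintype P] [Fintype J] (M : Finset A) (c : P → A)
    (E : P × Bool ≃ J × Bool) :
    theta K M (val (fun p => gen K A (c p)) E) = val (fun p i j => thetaV K M (c p, i, j)) E := by
  have := val_map (theta K M).toRingHom (fun p => gen K A (c p)) E
  refine this.trans ?_
  congr
  funext p i j
  simp [theta, gen]

lemma act_thetaV (hd tl : A → V) (M : Finset A) (g : V → Matrix (Fin 2) (Fin 2) K) (a : A)
    (i j : Fin 2) :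
    aeval (act hd tl (legLoc hd tl) g) (thetaV K M (a, i, j)) =
      ∑ k, ∑ l, (C (g (hd a) i k) * C (g (tl a) j l)) * thetaV K M (a, k, l) := by
  by_cases h : a ∈ M
  · simp [thetaV, h, act, legLoc, Fin.sum_univ_two]
    ring
  · simp [thetaV, h, act]

lemma theta_inv (hd tl : A → V) (r : A → ℕ) (M : Finset A)
    {P : MvPolynomial (A × Fin 2 × Fin 2) K} (hP : P ∈ VSpan K hd tl r) :
    Inv hd tl (legLoc hd tl) (theta K M P) := by
  intro g hg
  induction hP using Submodule.span_induction with
  | mem x hx =>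
    obtain ⟨P, J, _, _, c, E, hc, hE, rfl⟩ := hx
    rw [theta_val]
    refine (val_map (aeval (act hd tl (legLoc hd tl) g) : MvPolynomial (MV A) K →ₐ[K]
      MvPolynomial (MV A) K).toRingHom _ E).trans ?_
    have := val_inv (fun x : P × Bool => (g (legLoc hd tl (c x.1, x.2))).map
      (C : K →+* MvPolynomial (MV A) K))
      (fun p i j => thetaV K M (c p, i, j)) E (fun j => by simp only [hE j])
      (fun x => by rw [← RingHom.mapMatrix_apply, ← RingHom.map_det, hg, map_one])
    rw [← this]
    congr 1
    funext p i j
    refine (act_thetaV hd tl M g (c p) i j).trans ?_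
    simp [legLoc]
  | zero => simp
  | add x y _ _ hx hy => rw [map_add, map_add, hx, hy]
  | smul c x _ hx => rw [map_smul, map_smul, hx]

lemma thetaV_MH (M : Finset A) (v : A × Fin 2 × Fin 2) :
    MH ltr (thetaV K M v) (degM M (fun b => if v.1 = b then 1 else 0)) := by
  by_cases h : v.1 ∈ M
  · have := IsWeightedHomogeneous.mul
      (MH_X (K := K) (ltr (A := A)) (Sum.inr ((v.1, true), v.2.1)))
      (MH_X (K := K) (ltr (A := A)) (Sum.inr ((v.1, false), v.2.2)))
    unfold MH
    simp only [thetaV, h, if_true]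
    convert this using 1
    funext l
    rcases l with b | ⟨b, e⟩
    · by_cases hb : v.1 = b
      · subst hb; simp [degM, h, ltr]
      · simp [degM, hb, ltr]
    · by_cases hb : v.1 = b
      · subst hb; cases e <;> simp [degM, h, ltr]
      · simp [degM, hb, ltr]
  · have := MH_X (K := K) (ltr (A := A) (I := A × Bool)) (Sum.inl v)
    unfold MH at this ⊢
    simp only [thetaV, h, if_false]
    convert this using 1
    funext l
    rcases l with b | ⟨b, e⟩
    · by_cases hb : v.1 = b
      · subst hb; simp [degM, h, ltr]
      · simp [degM, hb, ltr]
    · by_cases hb : v.1 = b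
      · subst hb; cases e <;> simp [degM, h, ltr]
      · simp [degM, hb, ltr]

lemma degM_sum {P : Type} [Fintype P] (M : Finset A) (c : P → A) :
    ∑ p, degM M (fun b => if c p = b then 1 else 0) =
      degM M (fun a => Nat.card {p // c p = a}) := by
  funext l
  rw [Finset.sum_apply]
  rcases l with b | ⟨b, e⟩
  · by_cases hb : b ∈ M
    · simp [degM, hb]
    · simp only [degM, Sum.elim_inl, hb, if_false, natcard_fiber]
  · by_cases hb : b ∈ M
    · simp only [degM, Sum.elim_inr, hb, if_true, natcard_fiber]
    · simp [degM, hb]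

lemma theta_MH (hd tl : A → V) (r : A → ℕ) (M : Finset A)
    {P : MvPolynomial (A × Fin 2 × Fin 2) K} (hP : P ∈ VSpan K hd tl r) :
    MH ltr (theta K M P) (degM M r) := by
  induction hP using Submodule.span_induction with
  | mem x hx =>
    obtain ⟨P, J, _, _, c, E, hc, hE, rfl⟩ := hx
    rw [theta_val]
    have hr : r = fun a => Nat.card {p // c p = a} := by funext a; rw [hc]
    rw [hr, ← degM_sum]
    refine IsWeightedHomogeneous.sum _ _ _ fun φ _ => ?_
    have h1 : (∏ j, ((eps (φ (j, false)) (φ (j, true)) : ℤ) : MvPolynomial (MV A) K)) =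
        C (∏ j, ((eps (φ (j, false)) (φ (j, true)) : ℤ) : K)) := by
      simp [map_prod]
    rw [h1]
    refine IsWeightedHomogeneous.C_mul ?_ _
    exact IsWeightedHomogeneous.prod _ _ _ fun p _ => thetaV_MH M _
  | zero => rw [map_zero]; exact isWeightedHomogeneous_zero _ _ _
  | add x y _ _ hx hy => rw [map_add]; exact IsWeightedHomogeneous.add hx hy
  | smul c x _ hx =>
    rw [map_smul]; exact Submodule.smul_mem (weightedHomogeneousSubmodule K _ _) c hx

/-- determinant -/
noncomputable def dt (K : Type) [Field K] (a : A) : MvPolynomial (A × Fin 2 × Fin 2) K :=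
  X (a, 0, 0) * X (a, 1, 1) - X (a, 0, 1) * X (a, 1, 0)

noncomputable def dtM (K : Type) [Field K] (a : A) : MvPolynomial (MV A) K :=
  X (Sum.inl (a, 0, 0)) * X (Sum.inl (a, 1, 1)) - X (Sum.inl (a, 0, 1)) * X (Sum.inl (a, 1, 0))

lemma theta_dt {a : A} {M : Finset A} (ha : a ∉ M) : theta K M (dt K a) = dtM K a := by
  simp [theta, dt, dtM, thetaV, ha]

lemma dtM_inv (hd tl : A → V) (a : A) : Inv hd tl (legLoc hd tl) (dtM K a) := by
  intro g hg
  have h1 := hg (hd a)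
  have h2 := hg (tl a)
  rw [Matrix.det_fin_two] at h1 h2
  have h1' := congrArg (C : K → MvPolynomial (MV A) K) h1
  have h2' := congrArg (C : K → MvPolynomial (MV A) K) h2
  simp only [map_sub, map_mul, map_one] at h1' h2'
  simp only [dtM, map_sub, map_mul, aeval_X, act, Fin.sum_univ_two]
  generalize (C (g (hd a) 0 0) : MvPolynomial (MV A) K) = p00 at *
  generalize (C (g (hd a) 0 1) : MvPolynomial (MV A) K) = p01 at *
  generalize (C (g (hd a) 1 0) : MvPolynomial (MV A) K) = p10 at *
  generalize (C (g (hd a) 1 1) : MvPolynomial (MV A) K) = p11 at *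
  generalize (C (g (tl a) 0 0) : MvPolynomial (MV A) K) = q00 at *
  generalize (C (g (tl a) 0 1) : MvPolynomial (MV A) K) = q01 at *
  generalize (C (g (tl a) 1 0) : MvPolynomial (MV A) K) = q10 at *
  generalize (C (g (tl a) 1 1) : MvPolynomial (MV A) K) = q11 at *
  generalize (X (Sum.inl (a, 0, 0)) : MvPolynomial (MV A) K) = x00 at *
  generalize (X (Sum.inl (a, 0, 1)) : MvPolynomial (MV A) K) = x01 at *
  generalize (X (Sum.inl (a, 1, 0)) : MvPolynomial (MV A) K) = x10 at *
  generalize (X (Sum.inl (a, 1, 1)) : MvPolynomial (MV A) K) = x11 at *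
  linear_combination (x00 * x11 - x01 * x10) * (q00 * q11 - q01 * q10) * h1' +
    (x00 * x11 - x01 * x10) * h2'

lemma dtM_MH (a : A) : MH ltr (dtM K a) (Sum.elim (fun b => if a = b then 2 else 0) 0) := by
  have h : ∀ c d : Fin 2 × Fin 2, MH ltr (X (Sum.inl (a, c)) * X (Sum.inl (a, d)) :
      MvPolynomial (MV A) K) (Sum.elim (fun b => if a = b then 2 else 0) 0) := by
    intro c d
    have := IsWeightedHomogeneous.mul (MH_X (K := K) (ltr (A := A) (I := A × Bool)) (Sum.inl (a, c)))
      (MH_X (K := K) (ltr (A := A)) (Sum.inl (a, d)))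
    unfold MH
    convert this using 1
    funext l
    rcases l with b | k
    · by_cases hb : a = b
      · subst hb; simp [ltr]
      · simp [ltr, hb]
    · simp [ltr]
  exact IsWeightedHomogeneous.sub (h _ _) (h _ _)

lemma dtM_ne_zero (a : A) : dtM K a ≠ 0 := by
  intro h0
  have := congrArg (eval (fun v : MV A => match v with
    | Sum.inl (_, i, j) => (if i = j then 1 else 0 : K)
    | Sum.inr _ => 0)) h0
  simp [dtM] at this

lemma X_not_dvd_dtM (a : A) : ¬ ((X (Sum.inl (a, 0, 0)) : MvPolynomial (MV A) K) ∣ dtM K a) := by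
  apply not_X_dvd (fun v : MV A => match v with
    | Sum.inl (_, i, j) => (if i = j then 0 else 1 : K)
    | Sum.inr _ => 0)
  · simp
  · simp [dtM]

/-- evaluation of split legs -/
noncomputable def evV (K : Type) [Field K] (a : A) : MV A → MvPolynomial (MV A) K
  | Sum.inl v => X (Sum.inl v)
  | Sum.inr ((b, true), i) => if b = a then X (Sum.inl (a, i, 0)) else X (Sum.inr ((b, true), i))
  | Sum.inr ((b, false), i) => if b = a then X (Sum.inl (a, 0, i)) else X (Sum.inr ((b, false), i))

lemma dtM_dvd [Fintype A] {R : Ltr A (A × Bool) → ℕ} {F : MvPolynomial (MV A) K}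
    (hF : MH ltr F R) {a : A} (hR : ∀ b, R (Sum.inr (a, b)) = 0)
    (h0 : aeval (splitV K a) F = 0) : dtM K a ∣ F := by
  refine dvd_of_dvd_X_pow_mul (v := Sum.inl (a, 0, 0)) (N := R (Sum.inl a)) ?_ (X_not_dvd_dtM a)
  rw [← Ideal.mem_span_singleton, ← Ideal.Quotient.eq_zero_iff_mem]
  set B := MvPolynomial (MV A) K ⧸ Ideal.span {dtM K a}
  let q : MvPolynomial (MV A) K →ₐ[K] B := Ideal.Quotient.mkₐ K _
  change q _ = 0
  have hbr : q (dtM K a) = 0 := by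
    change Ideal.Quotient.mk _ _ = 0
    rw [Ideal.Quotient.eq_zero_iff_mem]; exact Ideal.mem_span_singleton_self _
  have e1 := hF.scale (fun v => q (X v))
    (fun l => if l = Sum.inl a then q (X (Sum.inl (a, 0, 0))) else 1)
  have e2 : aeval (fun v => q (aeval (evV K a) (splitV K a v))) F = 0 := by
    have : aeval (fun v => q (aeval (evV K a) (splitV K a v))) F =
        q (aeval (evV K a) (aeval (splitV K a) F)) := by
      rw [aeval_aeval, ← AlgHom.comp_apply q, MvPolynomial.comp_aeval]
    rw [this, h0, map_zero, map_zero]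
  have e4 : aeval (fun v => q (X v)) F = q F := by
    have : q = aeval (fun v => q (X v)) := by ext; simp
    conv_rhs => rw [this]
  have e5 : (∏ l : Ltr A (A × Bool), (if l = Sum.inl a then q (X (Sum.inl (a, 0, 0))) else 1) ^
      R l) = q (X (Sum.inl (a, 0, 0))) ^ R (Sum.inl a) := by
    rw [Finset.prod_eq_single (Sum.inl a)]
    · simp
    · intro l _ hl; simp [hl]
    · simp
  rw [e5, e4] at e1
  rw [map_mul, map_pow, ← e1, ← e2]
  refine hF.congr ?_
  rintro (⟨b, i, j⟩ | ⟨⟨b, e⟩, i⟩) hv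
  · by_cases hb : b = a
    · subst hb
      simp only [ltr, splitV, if_true, map_mul, aeval_X, evV]
      rw [← map_mul, ← map_mul]
      fin_cases i
      · rfl
      · fin_cases j
        · simp [mul_comm]
        · rw [← sub_eq_zero, ← map_sub, ← hbr]
          congr 1
          simp [dtM]; ring
    · simp [ltr, splitV, hb, evV]
  · by_cases hb : b = a
    · subst hb; exact absurd (hR e) hv
    · cases e <;> simp [ltr, splitV, hb, evV]

lemma split_act (hd tl : A → V) (a : A) (g : V → Matrix (Fin 2) (Fin 2) K) (v : MV A) :
    aeval (act hd tl (legLoc hd tl) g) (splitV K a v) =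
      aeval (splitV K a) (act hd tl (legLoc hd tl) g v) := by
  rcases v with ⟨b, k, l⟩ | ⟨k, c⟩
  · by_cases hb : b = a
    · subst hb
      have h1 : splitV K b (Sum.inl (b, k, l)) =
        X (Sum.inr ((b, true), k)) * X (Sum.inr ((b, false), l)) := by simp [splitV]
      have h2 : ∀ k' l', aeval (splitV K b) (X (Sum.inl (b, k', l')) : MvPolynomial (MV A) K) =
        X (Sum.inr ((b, true), k')) * X (Sum.inr ((b, false), l')) := by simp [splitV]
      rw [h1]
      simp only [map_mul, aeval_X, act, map_sum, h2, legLoc]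
      rw [Finset.sum_mul_sum]
      refine Finset.sum_congr rfl fun i _ => Finset.sum_congr rfl fun j _ => ?_
      simp only [aeval_C, MvPolynomial.algebraMap_eq, if_true, Bool.false_eq_true, if_false]
      ring
    · simp [act, splitV, hb, MvPolynomial.algebraMap_eq]
  · simp [act, splitV, MvPolynomial.algebraMap_eq]

lemma split_inv {hd tl : A → V} {f : MvPolynomial (MV A) K}
    (hf : Inv hd tl (legLoc hd tl) f) (a : A) :
    Inv hd tl (legLoc hd tl) (aeval (splitV K a) f) := by
  intro g hg
  calc aeval (act hd tl (legLoc hd tl) g) (aeval (splitV K a) f)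
      = aeval (fun v => aeval (act hd tl (legLoc hd tl) g) (splitV K a v)) f := aeval_aeval _ _ _
    _ = aeval (fun v => aeval (splitV K a) (act hd tl (legLoc hd tl) g v)) f := by
        rw [funext (split_act hd tl a g)]
    _ = aeval (splitV K a) (aeval (act hd tl (legLoc hd tl) g) f) := (aeval_aeval _ _ _).symm
    _ = aeval (splitV K a) f := congrArg _ (hf g hg)

lemma split_MH [Fintype A] {M : Finset A} {r : A → ℕ} {f : MvPolynomial (MV A) K}
    (hf : MH ltr f (degM M r)) {a : A} (ha : a ∉ M) :
    MH ltr (aeval (splitV K a) f) (degM (insert a M) r) := by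
  have := hf.map ltr (splitV K a)
    (fun l => Sum.elim (fun b => if b = a then
        (fun l' => if l' = Sum.inr (a, true) ∨ l' = Sum.inr (a, false) then 1 else 0)
        else (fun l' => if l = l' then 1 else 0)) (fun _ l' => if l = l' then 1 else 0) l) ?_
  · unfold MH at this ⊢
    convert this using 1
    funext l
    rw [Fintype.sum_sum_type]
    simp only [degM, Sum.elim_inl, Sum.elim_inr]
    rcases l with b | ⟨b, e⟩
    · rw [Finset.sum_eq_single b]
      · by_cases hb : b = a
        · subst hb; simp [ha]
        · by_cases hbM : b ∈ M
          · simp [hb, hbM]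
          · simp [hb, hbM]
      · intro b' _ hb'
        by_cases hb : b' = a
        · simp [hb]
        · simp [hb, hb']
      · simp
    · rw [Finset.sum_eq_single a, Finset.sum_eq_single (b, e)]
      · by_cases hb : b = a
        · subst hb; cases e <;> simp [ha]
        · by_cases hbM : b ∈ M
          · simp [hb, hbM]
          · simp [hb, hbM]
      · intro x _ hx; simp [hx]
      · simp
      · intro b' _ hb'
        simp [hb']
      · simp
  · rintro (v | v) _
    · by_cases hv : v.1 = a
      · have := IsWeightedHomogeneous.mul
          (MH_X (K := K) (ltr (A := A)) (Sum.inr ((a, true), v.2.1)))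
          (MH_X (K := K) (ltr (A := A)) (Sum.inr ((a, false), v.2.2)))
        unfold MH
        simp only [splitV, hv, if_true, ltr, Sum.elim_inl]
        convert this using 1
        funext l
        rcases l with b | ⟨b, e⟩
        · simp [ltr]
        · by_cases hb : a = b
          · subst hb; cases e <;> simp [ltr]
          · simp [ltr, hb, Ne.symm hb]
      · have := MH_X (K := K) ltr (Sum.inl v : MV A)
        unfold MH at this ⊢
        simp only [splitV, hv, if_false, ltr, Sum.elim_inl]
        convert this using 1
        funext l; simp only [ltr]
        by_cases h : (Sum.inl v.1 : Ltr A (A × Bool)) = l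
        · exact (if_pos h).trans (if_pos h).symm
        · exact (if_neg h).trans (if_neg h).symm
    · have := MH_X (K := K) ltr (Sum.inr v : MV A)
      unfold MH at this ⊢
      simp only [splitV, ltr, Sum.elim_inr]
      convert this using 1
      funext l; simp only [ltr]
      by_cases h : (Sum.inr v.1 : Ltr A (A × Bool)) = l
      · exact (if_pos h).trans (if_pos h).symm
      · exact (if_neg h).trans (if_neg h).symm

end QInv


namespace QInv
open MvPolynomial

variable {K : Type} [Field K] {A V : Type}

lemma dt_mul_mem (h2 : (2 : K) ≠ 0) (hd tl : A → V) {r r2 : A → ℕ} {a : A}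
    (hr : ∀ b, r b = r2 b + if a = b then 2 else 0) {P : MvPolynomial (A × Fin 2 × Fin 2) K}
    (hP : P ∈ VSpan K hd tl r2) : dt K a * P ∈ VSpan K hd tl r := by
  suffices H : VSpan K hd tl r2 ≤ (VSpan K hd tl r).comap (LinearMap.mulLeft K (dt K a)) from H hP
  refine Submodule.span_le.2 ?_
  rintro _ ⟨P, J, _, _, c, E, hc, hE, rfl⟩
  have e : dt K a * val (fun p => gen K A (c p)) E =
      (2⁻¹ : K) • val (fun p => gen K A ((Sum.elim c (fun _ : Bool => a)) p))
        (sumE E (Equiv.prodComm Bool Bool)) := by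
    have h1 := val_sum (fun p => gen K A (c p)) (fun _ : Bool => gen K A a) E
      (Equiv.prodComm Bool Bool)
    have h3 : (fun p => gen K A ((Sum.elim c (fun _ : Bool => a)) p)) =
        Sum.elim (fun p => gen K A (c p)) (fun _ : Bool => gen K A a) := by
      funext p; rcases p with p | p <;> rfl
    rw [h3, h1, val_det]
    have h4 : gen K A a 0 0 * gen K A a 1 1 - gen K A a 0 1 * gen K A a 1 0 = dt K a := rfl
    rw [h4, smul_eq_C_mul]
    have h5 : (C (2⁻¹ : K) * 2 : MvPolynomial (A × Fin 2 × Fin 2) K) = 1 := by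
      have : (2 : MvPolynomial (A × Fin 2 × Fin 2) K) = C 2 := (map_ofNat C 2).symm
      rw [this, ← map_mul, inv_mul_cancel₀ h2, map_one]
    linear_combination (-(dt K a * val (fun p => gen K A (c p)) E)) * h5
  change dt K a * val (fun p => gen K A (c p)) E ∈ VSpan K hd tl r
  rw [e]
  refine Submodule.smul_mem _ _ (Submodule.subset_span ⟨P ⊕ Bool, J ⊕ Bool, inferInstance,
    inferInstance, _, _, ?_, ?_, rfl⟩)
  · intro b
    rw [natcard_fiber, Fintype.sum_sum_type, hr, ← hc b, natcard_fiber]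
    congr 1
    rw [Fintype.sum_bool]
    by_cases hb : a = b
    · subst hb; simp
    · simp [hb]
  · rintro (j | j)
    · simpa [sumE] using hE j
    · simp [sumE]

lemma exists_equiv {J : Type} [Fintype J] {r : A → ℕ} (w : J × Bool → A × Bool)
    (hw : ∀ i, Nat.card {x // w x = i} = r i.1) :
    ∃ E : (Σ a, Fin (r a)) × Bool ≃ J × Bool, ∀ x, w (E x) = (x.1.1, x.2) := by
  have e1 : ∀ i : A × Bool, Nonempty ({x // w x = i} ≃ Fin (r i.1)) := by
    intro i
    rw [← hw i]
    exact ⟨Finite.equivFin _⟩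
  let E : (Σ a, Fin (r a)) × Bool ≃ J × Bool :=
    ((Equiv.sigmaProdDistrib (fun a => Fin (r a)) Bool).trans
      ((Equiv.sigmaCongrRight (fun a => (Equiv.prodComm (Fin (r a)) Bool).trans
        (Equiv.sigmaEquivProd Bool (Fin (r a))).symm)).trans
      ((Equiv.sigmaAssocProd (α := A) (β := Bool) (γ := fun a _ => Fin (r a))).symm.trans
      (Equiv.sigmaCongrRight (fun i : A × Bool => (e1 i).some.symm))))).trans
      (Equiv.sigmaFiberEquiv w)
  have hE : ∀ x, w (E x) = (x.1.1, x.2) := by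
    rintro ⟨⟨a, k⟩, b⟩
    exact ((e1 (a, b)).some.symm k).2
  exact ⟨E, hE⟩

lemma base_lift {hd tl : A → V} {r : A → ℕ} [Fintype A] {f : MvPolynomial (MV A) K}
    (hf : f ∈ BSpan K A (legLoc hd tl) (fun i => r i.1)) :
    ∃ P ∈ VSpan K hd tl r, theta K Finset.univ P = f := by
  suffices BSpan K A (legLoc hd tl) (fun i => r i.1) ≤
      (VSpan K hd tl r).map (theta K (Finset.univ : Finset A)).toLinearMap by
    obtain ⟨P, hP, e⟩ := this hf
    exact ⟨P, hP, e⟩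
  refine Submodule.span_le.2 ?_
  rintro _ ⟨J, _, w, hl, hw, rfl⟩
  beta_reduce at hw
  obtain ⟨E, hE⟩ := exists_equiv w hw
  have hE' : ∀ z, ((E.symm z).1.1, (E.symm z).2) = w z := by
    intro z
    rw [← hE, Equiv.apply_symm_apply]
  have hmem : val (fun p : (Σ a, Fin (r a)) => gen K A p.1) E ∈ VSpan K hd tl r := by
    refine Submodule.subset_span ⟨(Σ a, Fin (r a)), J, inferInstance, inferInstance,
      fun p => p.1, E, ?_, ?_, rfl⟩
    · intro a
      rw [Nat.card_congr (Equiv.sigmaSubtype (β := fun a => Fin (r a)) a)]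
      simp
    · intro j
      rw [hE', hE', hl]
  refine Submodule.mem_map.2 ⟨_, hmem, ?_⟩
  refine (theta_val Finset.univ (fun p : (Σ a, Fin (r a)) => p.1) E).trans ?_
  have h3 := val_split (fun (x : (Σ a, Fin (r a)) × Bool) i =>
      (X (Sum.inr ((x.1.1, x.2), i)) : MvPolynomial (MV A) K)) E
  have h4 : (fun (p : (Σ a, Fin (r a))) i j => thetaV K Finset.univ (p.1, i, j)) =
    (fun p i j => X (Sum.inr ((p.1, true), i)) * X (Sum.inr ((p.1, false), j))) := by
    funext p i j
    simp [thetaV]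
  rw [h4]
  refine h3.trans ?_
  refine Finset.prod_congr rfl fun j _ => ?_
  rw [hE', hE']
  rfl

lemma claim_step [Infinite K] [Fintype A] (h2 : (2 : K) ≠ 0) (hd tl : A → V) {M : Finset A} {a : A}
    (ha : a ∉ M)
    (H : ∀ (r : A → ℕ) (g : MvPolynomial (MV A) K), Inv hd tl (legLoc hd tl) g →
      MH ltr g (degM (insert a M) r) → ∃ P ∈ VSpan K hd tl r, theta K (insert a M) P = g) :
    ∀ (N : ℕ) (r : A → ℕ) (g : MvPolynomial (MV A) K), r a ≤ N → Inv hd tl (legLoc hd tl) g →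
      MH ltr g (degM M r) → ∃ P ∈ VSpan K hd tl r, theta K M P = g := by
  intro N
  induction N using Nat.strong_induction_on with
  | _ N IH =>
  intro r g hN hg hh
  obtain ⟨P, hP, hPe⟩ := H r _ (split_inv hg a) (split_MH hh ha)
  have hFi := hg.sub (theta_inv hd tl r M hP)
  have hFh : MH ltr (g - theta K M P) (degM M r) :=
    IsWeightedHomogeneous.sub hh (theta_MH hd tl r M hP)
  obtain ⟨h, hfac⟩ := dtM_dvd (a := a) hFh (by intro b; simp [degM, ha])
    (by rw [map_sub, split_theta ha, hPe, sub_self])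
  rcases hFh.factor (dtM_MH a) hfac with h0 | ⟨s, h', hs, hsr, he⟩
  · exact ⟨P, hP, (sub_eq_zero.1 h0).symm⟩
  rw [he] at hFi
  have hh'i := hFi.of_mul (dtM_inv hd tl a) (dtM_ne_zero a)
  set r2 : A → ℕ := fun b => if b = a then s (Sum.inl a) else r b with hr2
  have hra : r a = 2 + s (Sum.inl a) := by
    have := congrFun hsr (Sum.inl a)
    simp [degM, ha] at this
    omega
  have hs2 : s = degM M r2 := by
    funext l
    have := congrFun hsr l
    rcases l with b | ⟨b, e⟩
    · by_cases hb : b = a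
      · subst hb; simp [degM, ha, hr2]
      · simp [degM, Ne.symm hb, hr2, hb] at this ⊢
        exact this
    · by_cases hb : b = a
      · subst hb; simp [degM, ha] at this ⊢; exact this
      · simp [degM, hr2, hb] at this ⊢
        exact this
  rw [hs2] at hs
  obtain ⟨P2, hP2, hP2e⟩ := IH (r2 a) (by simp [hr2]; omega) r2 h' le_rfl hh'i hs
  refine ⟨P + dt K a * P2, Submodule.add_mem _ hP (dt_mul_mem h2 hd tl ?_ hP2), ?_⟩
  · intro b
    by_cases hb : b = a
    · subst hb; simp [hr2, hra, add_comm]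
    · simp [hr2, hb, Ne.symm hb]
  · rw [map_add, map_mul, theta_dt ha, hP2e, ← he]; ring

lemma claim_all [Infinite K] [Fintype A] (h2 : (2 : K) ≠ 0) (hd tl : A → V) (N : Finset A) :
    ∀ (r : A → ℕ) (g : MvPolynomial (MV A) K), Inv hd tl (legLoc hd tl) g →
      MH ltr g (degM Nᶜ r) → ∃ P ∈ VSpan K hd tl r, theta K Nᶜ P = g := by
  induction N using Finset.induction_on with
  | empty =>
    intro r g hg hh
    rw [Finset.compl_empty] at hh ⊢
    have e : degM Finset.univ r = (Sum.elim 0 (fun i => r i.1) : Ltr A (A × Bool) → ℕ) := by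
      funext l; rcases l with b | b <;> simp [degM]
    rw [e] at hh
    exact base_lift (vector_fft hd tl _ _ _ g le_rfl hg hh)
  | insert a N ha IH =>
    intro r g hg hh
    have h1 : insert a (insert a N)ᶜ = Nᶜ := by
      ext b
      simp only [Finset.mem_insert, Finset.mem_compl]
      by_cases hb : b = a
      · subst hb; simp [ha]
      · simp [hb]
    refine claim_step h2 hd tl (M := (insert a N)ᶜ) (a := a) (by simp) ?_ (r a) r g le_rfl hg hh
    rw [h1]; exact IH

/-- First fundamental theorem for `SL₂` -/
theorem arrow_fft [Infinite K] [Fintype A] (h2 : (2 : K) ≠ 0) (hd tl : A → V) (r : A → ℕ)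
    (f : MvPolynomial (A × Fin 2 × Fin 2) K)
    (hf : ∀ g : V → Matrix (Fin 2) (Fin 2) K, (∀ v, (g v).det = 1) →
      aeval (fun v : A × Fin 2 × Fin 2 => ∑ k, ∑ l,
        C (g (hd v.1) v.2.1 k * g (tl v.1) v.2.2 l) * X (v.1, k, l)) f = f)
    (hh : MH Prod.fst f r) : f ∈ VSpan K hd tl r := by
  have ht : ∀ P : MvPolynomial (A × Fin 2 × Fin 2) K, theta K ∅ P = rename Sum.inl P := by
    intro P
    unfold theta
    have : (aeval (thetaV K ∅) : MvPolynomial (A × Fin 2 × Fin 2) K →ₐ[K] _) =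
        rename (Sum.inl : _ → MV A) := by
      ext1 v
      simp [thetaV]
    rw [this]
  have := claim_all h2 hd tl Finset.univ r (theta K ∅ f) ?_ ?_
  · rw [Finset.compl_univ] at this
    obtain ⟨P, hP, e⟩ := this
    rw [ht, ht] at e
    rw [← rename_injective _ Sum.inl_injective e]; exact hP
  · intro g hg
    conv_rhs => rw [← hf g hg]
    unfold theta
    rw [aeval_aeval, aeval_aeval]
    congr 2
    funext v
    simp [thetaV, act, MvPolynomial.algebraMap_eq]
  · rw [Finset.compl_univ]
    have := hh.map ltr (thetaV K ∅) (fun a => degM ∅ (fun b => if a = b then 1 else 0))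
      (fun v _ => thetaV_MH ∅ v)
    unfold MH at this ⊢
    unfold theta
    convert this using 1
    funext l
    rcases l with b | b <;> simp [degM]

end QInv


namespace QInv

section matching
variable {B : Type} [CommRing B] {P J V : Type} [Fintype P] [Fintype J]

lemma val_trans (Y : P → Fin 2 → Fin 2 → B) (E : P × Bool ≃ J × Bool)
    (σ : Equiv.Perm (J × Bool)) :
    val Y (E.trans σ) = ∑ φ : J × Bool → Fin 2,
      (∏ j, (eps (φ (σ.symm (j, false))) (φ (σ.symm (j, true))) : B)) *
      ∏ p, Y p (φ (E (p, true))) (φ (E (p, false))) := by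
  unfold val
  refine Fintype.sum_equiv (Equiv.arrowCongr σ.symm (Equiv.refl _)) _ _ (fun φ => ?_)
  simp

lemma prod_two {J : Type} [Fintype J] {j₁ j₂ : J} (h : j₁ ≠ j₂) (F : J → B) :
    ∏ j, F j = F j₁ * F j₂ * ∏ j ∈ (Finset.univ.erase j₁).erase j₂, F j := by
  rw [← Finset.mul_prod_erase _ F (Finset.mem_univ j₁),
    ← Finset.mul_prod_erase _ F (Finset.mem_erase.2 ⟨h.symm, Finset.mem_univ j₂⟩), mul_assoc]

lemma eps_plucker (a b c d : Fin 2) :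
    eps a b * eps c d = eps a c * eps b d + eps a d * eps c b := by
  revert a b c d; unfold eps
  intro a b c d
  fin_cases a <;> fin_cases b <;> fin_cases c <;> fin_cases d <;> simp

lemma plucker (Y : P → Fin 2 → Fin 2 → B) (E : P × Bool ≃ J × Bool) {j₁ j₂ : J} (h : j₁ ≠ j₂) :
    val Y E = val Y (E.trans (Equiv.swap (j₁, true) (j₂, false))) +
      val Y (E.trans (Equiv.swap (j₁, true) (j₂, true))) := by
  rw [val_trans, val_trans]
  unfold val
  rw [← Finset.sum_add_distrib]
  refine Finset.sum_congr rfl fun φ _ => ?_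
  rw [← add_mul]
  congr 1
  rw [prod_two h, prod_two h, prod_two h]
  have hr : ∀ b : Bool, ∀ j ∈ (Finset.univ.erase j₁).erase j₂, ∀ x : Bool,
      Equiv.swap (j₁, true) (j₂, b) (j, x) = (j, x) := by
    intro b j hj x
    simp only [Finset.mem_erase, Finset.mem_univ, and_true] at hj
    apply Equiv.swap_apply_of_ne_of_ne
    · simp [hj.2]
    · simp [hj.1]
  have h1 : ∀ b : Bool, ∏ j ∈ (Finset.univ.erase j₁).erase j₂,
      (eps (φ ((Equiv.swap (j₁, true) (j₂, b)).symm (j, false)))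
        (φ ((Equiv.swap (j₁, true) (j₂, b)).symm (j, true))) : B) =
      ∏ j ∈ (Finset.univ.erase j₁).erase j₂, (eps (φ (j, false)) (φ (j, true)) : B) := by
    intro b
    refine Finset.prod_congr rfl fun j hj => ?_
    rw [Equiv.symm_swap, hr b j hj, hr b j hj]
  rw [h1, h1, ← add_mul]
  congr 1
  have s1 : ∀ b, Equiv.swap (j₁, true) (j₂, b) (j₁, false) = (j₁, false) := fun b =>
    Equiv.swap_apply_of_ne_of_ne (by simp) (by simp [h])
  have s2 : Equiv.swap (j₁, true) (j₂, false) (j₂, true) = (j₂, true) :=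
    Equiv.swap_apply_of_ne_of_ne (by simp [h.symm]) (by simp)
  have s3 : Equiv.swap (j₁, true) (j₂, true) (j₂, false) = (j₂, false) :=
    Equiv.swap_apply_of_ne_of_ne (by simp) (by simp)
  simp only [Equiv.symm_swap, s1, s2, s3, Equiv.swap_apply_left, Equiv.swap_apply_right]
  have := eps_plucker (φ (j₁, false)) (φ (j₁, true)) (φ (j₂, false)) (φ (j₂, true))
  exact_mod_cast congrArg (Int.cast : ℤ → B) this

variable (hv tv : P → V)

/-- compatibility of a matching with vertex labels -/
def Compat (E : P × Bool ≃ J × Bool) : Prop :=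
  ∀ j, legLoc hv tv (E.symm (j, false)) = legLoc hv tv (E.symm (j, true))

/-- number of head-head pairs -/
def HH (E : P × Bool ≃ J × Bool) : ℕ :=
  (Finset.univ.filter fun j : J => (E.symm (j, false)).2 = true ∧ (E.symm (j, true)).2 = true).card

/-- sign of a leg -/
def sg (b : Bool) : ℤ := if b then 1 else -1

lemma balance_slots {hv tv : P → V}
    (hb : ∀ v, ∑ p, (if hv p = v then (1 : ℤ) else 0) = ∑ p, if tv p = v then (1 : ℤ) else 0)
    {E : P × Bool ≃ J × Bool} (hE : Compat hv tv E) (v : V) :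
    ∑ j, (if legLoc hv tv (E.symm (j, false)) = v then
      sg (E.symm (j, false)).2 + sg (E.symm (j, true)).2 else 0) = 0 := by
  have h1 : ∑ x : P × Bool, (if legLoc hv tv x = v then sg x.2 else 0) = 0 := by
    rw [Fintype.sum_prod_type]
    simp only [Fintype.sum_bool, legLoc, sg, if_true, Bool.false_eq_true, if_false]
    rw [Finset.sum_add_distrib, hb v, ← Finset.sum_add_distrib]
    refine Finset.sum_eq_zero fun p _ => ?_
    split_ifs <;> simp
  rw [← Fintype.sum_equiv E.symm (fun z => if legLoc hv tv (E.symm z) = v then sg (E.symm z).2 else 0)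
    _ (fun z => rfl), Fintype.sum_prod_type] at h1
  refine Eq.trans ?_ h1
  refine Finset.sum_congr rfl fun j _ => ?_
  rw [Fintype.sum_bool, ← hE j]
  split_ifs <;> ring

/-- reduction to matchings in which every pair has one head and one tail -/
lemma reduce {hv tv : P → V}
    (hb : ∀ v, ∑ p, (if hv p = v then (1 : ℤ) else 0) = ∑ p, if tv p = v then (1 : ℤ) else 0)
    (Y : P → Fin 2 → Fin 2 → B) (S : AddSubgroup B)
    (hS : ∀ E : P × Bool ≃ J × Bool, Compat hv tv E →
      (∀ j, (E.symm (j, false)).2 ≠ (E.symm (j, true)).2) → val Y E ∈ S) :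
    ∀ (N : ℕ) (E : P × Bool ≃ J × Bool), HH E ≤ N → Compat hv tv E → val Y E ∈ S := by
  intro N
  induction N using Nat.strong_induction_on with
  | _ N IH =>
  intro E hN hE
  by_cases hex : ∃ j, (E.symm (j, false)).2 = true ∧ (E.symm (j, true)).2 = true
  swap
  · refine hS E hE fun j hj => ?_
    -- tail tail pair
    have hsum := balance_slots hb hE (legLoc hv tv (E.symm (j, false)))
    have hneg : ∀ i ∈ Finset.univ, (if legLoc hv tv (E.symm (i, false)) =
        legLoc hv tv (E.symm (j, false)) then
        sg (E.symm (i, false)).2 + sg (E.symm (i, true)).2 else 0) ≤ 0 := by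
      intro i _
      have := not_exists.1 hex i
      cases h1 : (E.symm (i, false)).2 <;> cases h2 : (E.symm (i, true)).2 <;>
        simp [h1, h2, sg] at this ⊢
      split_ifs <;> simp
    have := (Finset.sum_eq_zero_iff_of_nonpos hneg).1 hsum j (Finset.mem_univ j)
    have h3 := not_exists.1 hex j
    rw [if_pos rfl, ← hj] at this
    cases h1 : (E.symm (j, false)).2
    · simp [h1, sg] at this
    · exact h3 ⟨h1, hj ▸ h1⟩
  obtain ⟨j₁, ha, hb1⟩ := hex
  have hTT : ∃ j₂, legLoc hv tv (E.symm (j₂, false)) = legLoc hv tv (E.symm (j₁, false)) ∧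
      (E.symm (j₂, false)).2 = false ∧ (E.symm (j₂, true)).2 = false := by
    by_contra hno
    push Not at hno
    have hsum := balance_slots hb hE (legLoc hv tv (E.symm (j₁, false)))
    have hpos : ∀ i ∈ Finset.univ, 0 ≤ (if legLoc hv tv (E.symm (i, false)) =
        legLoc hv tv (E.symm (j₁, false)) then
        sg (E.symm (i, false)).2 + sg (E.symm (i, true)).2 else 0) := by
      intro i _
      split_ifs with h
      · have := hno i h
        cases h1 : (E.symm (i, false)).2 <;> cases h2 : (E.symm (i, true)).2 <;>
          simp [h1, h2, sg] at this ⊢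
      · exact le_rfl
    have := (Finset.sum_eq_zero_iff_of_nonneg hpos).1 hsum j₁ (Finset.mem_univ j₁)
    rw [if_pos rfl, ha, hb1] at this
    simp [sg] at this
  obtain ⟨j₂, hl, hc, hd⟩ := hTT
  have hne : j₁ ≠ j₂ := by
    rintro rfl
    rw [ha] at hc
    exact absurd hc (by simp)
  have hl2 : legLoc hv tv (E.symm (j₂, true)) = legLoc hv tv (E.symm (j₁, true)) := by
    rw [← hE, ← hE, hl]
  rw [plucker Y E hne]
  have key : ∀ b : Bool, val Y (E.trans (Equiv.swap (j₁, true) (j₂, b))) ∈ S := by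
    intro b
    have hcb : ∀ b, (E.symm (j₂, b)).2 = false := by intro b; cases b; exacts [hc, hd]
    have hlb : legLoc hv tv (E.symm (j₂, b)) = legLoc hv tv (E.symm (j₁, true)) := by
      cases b
      · rw [hE j₂, hl2]
      · exact hl2
    have s0 : Equiv.swap (j₁, true) (j₂, b) (j₁, false) = (j₁, false) :=
      Equiv.swap_apply_of_ne_of_ne (by simp) (by simp [hne])
    have s1 : ∀ x, x ≠ b → Equiv.swap (j₁, true) (j₂, b) (j₂, x) = (j₂, x) := fun x hx =>
      Equiv.swap_apply_of_ne_of_ne (by simp [hne.symm]) (by simp [hx])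
    have hloc : ∀ z, legLoc hv tv (E.symm (Equiv.swap (j₁, true) (j₂, b) z)) =
        legLoc hv tv (E.symm z) := by
      intro z
      by_cases h1 : z = (j₁, true)
      · rw [h1, Equiv.swap_apply_left, hlb]
      · by_cases h2 : z = (j₂, b)
        · rw [h2, Equiv.swap_apply_right, hlb]
        · rw [Equiv.swap_apply_of_ne_of_ne h1 h2]
    refine IH (HH (E.trans (Equiv.swap (j₁, true) (j₂, b)))) (lt_of_lt_of_le ?_ hN) _ le_rfl ?_
    · refine Finset.card_lt_card (Finset.ssubset_iff_subset_ne.2 ⟨?_, ?_⟩)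
      · intro j hj
        have hj := (Finset.mem_filter.1 hj).2
        simp only [Equiv.symm_trans_apply, Equiv.symm_swap] at hj
        refine Finset.mem_filter.2 ⟨Finset.mem_univ _, ?_⟩
        by_cases h1 : j = j₁
        · subst h1; exact ⟨ha, hb1⟩
        · by_cases h2 : j = j₂
          · subst h2
            exfalso
            cases b
            · rw [s1 true (by simp), hcb] at hj; simp at hj
            · rw [s1 false (by simp), hcb] at hj; simp at hj
          · rw [Equiv.swap_apply_of_ne_of_ne (by simp [h1]) (by simp [h2]),
              Equiv.swap_apply_of_ne_of_ne (by simp [h1]) (by simp [h2])] at hj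
            exact hj
      · intro heq
        have hmem : j₁ ∈ Finset.univ.filter fun j : J =>
          (E.symm (j, false)).2 = true ∧ (E.symm (j, true)).2 = true := by simp [ha, hb1]
        rw [← heq] at hmem
        have hmem := (Finset.mem_filter.1 hmem).2
        simp only [Equiv.symm_trans_apply, Equiv.symm_swap, Equiv.swap_apply_left, hcb] at hmem
        simp at hmem
    · intro j
      simp only [Equiv.symm_trans_apply, Equiv.symm_swap]
      rw [hloc, hloc, hE]
  exact S.add_mem (key false) (key true)

end matching
end QInv


namespace QInv

section tpsec
variable {B : Type} [CommRing B] {P J V : Type} [Fintype P] [Fintype J]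

/-- splitting the two slots -/
def slotSplit (J : Type) : (J × Bool → Fin 2) ≃ (J → Fin 2) × (J → Fin 2) where
  toFun φ := (fun j => φ (j, false), fun j => φ (j, true))
  invFun p := fun x => match x.2 with
    | true => p.2 x.1
    | false => p.1 x.1
  left_inv φ := by
    funext x; rcases x with ⟨j, b⟩; cases b <;> rfl
  right_inv p := rfl

/-- product of traces attached to a permutation -/
noncomputable def tp (N : J → Matrix (Fin 2) (Fin 2) B) (ρ : Equiv.Perm J) : B :=
  ∑ u : J → Fin 2, ∏ j, N j (u (ρ j)) (u j)

lemma tp_eq [inst : Fintype (J → Fin 2)] (N : J → Matrix (Fin 2) (Fin 2) B) (ρ : Equiv.Perm J) :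
    tp N ρ = ∑ u : J → Fin 2, ∏ j, N j (u (ρ j)) (u j) := by
  unfold tp
  congr!

lemma eps_contract (a k : Fin 2) : ∑ b, (eps a b : B) * (eps k b : B) = if k = a then 1 else 0 := by
  fin_cases a <;> fin_cases k <;> simp [eps]

lemma val_tp (N : P → Matrix (Fin 2) (Fin 2) B) (E : P × Bool ≃ J × Bool) (h t : J ≃ P)
    (hh : ∀ p, E (p, true) = (h.symm p, false)) (ht : ∀ p, E (p, false) = (t.symm p, true)) :
    val (fun p i j => ∑ k, N p i k * (eps k j : B)) E =
      tp (fun j => N (t j)) (t.trans h.symm) := by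
  unfold val tp
  rw [Fintype.sum_equiv (slotSplit J) _ (fun q : (J → Fin 2) × (J → Fin 2) =>
    (∏ j, (eps (q.1 j) (q.2 j) : B)) *
      ∏ p, ∑ k, N p (q.1 (h.symm p)) k * (eps k (q.2 (t.symm p)) : B))
    (fun φ => by simp only [hh, ht]; rfl), Fintype.sum_prod_type]
  refine Finset.sum_congr rfl fun u _ => ?_
  have : ∀ w : J → Fin 2, (∏ j, (eps (u j) (w j) : B)) *
      ∏ p, ∑ k, N p (u (h.symm p)) k * (eps k (w (t.symm p)) : B) =
      ∏ j, (eps (u j) (w j) : B) * ∑ k, N (t j) (u (h.symm (t j))) k * (eps k (w j) : B) := by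
    intro w
    rw [Finset.prod_mul_distrib]
    congr 1
    rw [← Equiv.prod_comp t]
    simp
  simp only [this]
  rw [← Fintype.prod_sum (fun j b => (eps (u j) b : B) *
    ∑ k, N (t j) (u (h.symm (t j))) k * (eps k b : B))]
  refine Finset.prod_congr rfl fun j _ => ?_
  simp only [Finset.mul_sum]
  rw [Finset.sum_comm]
  have : ∀ k, ∑ b, (eps (u j) b : B) * (N (t j) (u (h.symm (t j))) k * (eps k b : B)) =
      N (t j) (u (h.symm (t j))) k * if k = u j then 1 else 0 := by
    intro k
    rw [← eps_contract, Finset.mul_sum]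
    exact Finset.sum_congr rfl fun b _ => by ring
  simp [this]

/-- normalisation: put the heads in the slot `false` -/
lemma val_norm (Y : P → Fin 2 → Fin 2 → B) (S : AddSubgroup B) (E : P × Bool ≃ J × Bool)
    (hE : ∀ j, (E.symm (j, false)).2 ≠ (E.symm (j, true)).2) (hv tv : P → V)
    (hc : Compat hv tv E)
    (hS : ∀ (E' : P × Bool ≃ J × Bool), Compat hv tv E' →
      (∀ j, (E'.symm (j, false)).2 = true ∧ (E'.symm (j, true)).2 = false) → val Y E' ∈ S) :
    val Y E ∈ S := by
  let s : J → Bool := fun j => !(E.symm (j, false)).2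
  let σ : Equiv.Perm (J × Bool) :=
    { toFun := fun x => (x.1, xor x.2 (s x.1))
      invFun := fun x => (x.1, xor x.2 (s x.1))
      left_inv := fun x => by simp
      right_inv := fun x => by simp }
  have hσ : ∀ j b, (E.trans σ).symm (j, b) = E.symm (j, xor b (s j)) := fun j b => rfl
  have h1 := hS (E.trans σ) (fun j => by
    rw [hσ, hσ]
    cases hs : s j
    · simpa using hc j
    · simpa using (hc j).symm) (fun j => by
    rw [hσ, hσ]
    have := hE j
    cases h1 : (E.symm (j, false)).2 <;> cases h2 : (E.symm (j, true)).2 <;>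
      simp [s, h1, h2] at this ⊢)
  have h2 : val Y (E.trans σ) = ((∏ j, (if s j then -1 else 1 : ℤ) : ℤ) : B) * val Y E := by
    rw [val_trans]
    unfold val
    rw [Finset.mul_sum]
    refine Finset.sum_congr rfl fun φ _ => ?_
    rw [← mul_assoc]
    congr 1
    push_cast
    rw [← Finset.prod_mul_distrib]
    refine Finset.prod_congr rfl fun j _ => ?_
    have e1 : ∀ b, σ.symm (j, b) = (j, xor b (s j)) := fun b => rfl
    rw [e1, e1]
    have anti : ∀ a b : Fin 2, eps a b = - eps b a := by
      intro a b; fin_cases a <;> fin_cases b <;> simp [eps]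
    cases hs : s j
    · simp
    · simp [anti (φ (j, true))]
  have h3 : (∏ j, (if s j then -1 else 1 : ℤ)) = 1 ∨ (∏ j, (if s j then -1 else 1 : ℤ)) = -1 := by
    apply Int.isUnit_iff.1
    rw [IsUnit.prod_univ_iff]
    intro j
    split_ifs <;> simp
  rcases h3 with h3 | h3
  · rw [h2, h3] at h1; simpa using h1
  · rw [h2, h3] at h1; simpa using h1

lemma tp_equiv {J' : Type} [Fintype J'] (e : J ≃ J') (N : J' → Matrix (Fin 2) (Fin 2) B)
    (ρ : Equiv.Perm J') :
    tp N ρ = tp (fun j => N (e j)) ((e.trans ρ).trans e.symm) := by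
  unfold tp
  refine Fintype.sum_equiv (Equiv.arrowCongr e.symm (Equiv.refl _)) _ _ (fun u => ?_)
  rw [← Equiv.prod_comp e]
  simp

lemma tp_option_none (N : Option J → Matrix (Fin 2) (Fin 2) B) (ρ : Equiv.Perm (Option J))
    (ρ' : Equiv.Perm J) (h0 : ρ none = none) (h1 : ∀ j, ρ (some j) = some (ρ' j)) :
    tp N ρ = (N none).trace * tp (fun j => N (some j)) ρ' := by
  rw [tp_eq N ρ, tp_eq _ ρ']
  refine (Fintype.sum_equiv (Equiv.piOptionEquivProd (β := fun _ => Fin 2))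
    (fun u : Option J → Fin 2 => ∏ j, N j (u (ρ j)) (u j))
    (fun q : Fin 2 × (J → Fin 2) => N none q.1 q.1 * ∏ j, N (some j) (q.2 (ρ' j)) (q.2 j))
    (fun u => by rw [Fintype.prod_option, h0]; simp only [h1]; rfl)).trans ?_
  rw [Fintype.sum_prod_type]
  rw [Matrix.trace, Finset.sum_mul]
  refine Finset.sum_congr rfl fun a _ => ?_
  rw [Finset.mul_sum]
  rfl

lemma tp_option_some (N : Option J → Matrix (Fin 2) (Fin 2) B) (ρ : Equiv.Perm (Option J))
    (ρ' : Equiv.Perm J) (i₀ : J) (h0 : ρ none = some (ρ' i₀)) (hi : ρ (some i₀) = none)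
    (h1 : ∀ j, j ≠ i₀ → ρ (some j) = some (ρ' j)) :
    tp N ρ = tp (fun j => if j = i₀ then N none * N (some i₀) else N (some j)) ρ' := by
  rw [tp_eq N ρ, tp_eq _ ρ']
  refine (Fintype.sum_equiv (Equiv.piOptionEquivProd (β := fun _ => Fin 2))
    (fun u : Option J → Fin 2 => ∏ j, N j (u (ρ j)) (u j))
    (fun q : Fin 2 × (J → Fin 2) => N none (q.2 (ρ' i₀)) q.1 * (N (some i₀) q.1 (q.2 i₀) *
      ∏ j ∈ Finset.univ.erase i₀, N (some j) (q.2 (ρ' j)) (q.2 j)))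
    (fun u => by
      rw [Fintype.prod_option, h0, ← Finset.mul_prod_erase _ _ (Finset.mem_univ i₀), hi]
      congr 2
      refine Finset.prod_congr rfl fun j hj => ?_
      rw [h1 j (Finset.ne_of_mem_erase hj)]; rfl)).trans ?_
  rw [Fintype.sum_prod_type, Finset.sum_comm]
  refine Finset.sum_congr rfl fun u _ => ?_
  rw [← Finset.mul_prod_erase _ _ (Finset.mem_univ i₀), if_pos rfl, Matrix.mul_apply, Finset.sum_mul]
  refine Finset.sum_congr rfl fun a _ => ?_
  rw [mul_assoc]
  congr 2
  refine Finset.prod_congr rfl fun j hj => ?_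
  rw [if_neg (Finset.ne_of_mem_erase hj)]

end tpsec

section paths
variable (Q : QuiverData) (K : Type) [Field K]

lemma path_append {u v w : Q.V} {l₁ l₂ : List Q.A} (h₁ : Q.IsPathFrom u v l₁)
    (h₂ : Q.IsPathFrom v w l₂) : Q.IsPathFrom u w (l₁ ++ l₂) := by
  induction l₁ generalizing u with
  | nil => simp only [QuiverData.IsPathFrom] at h₁; subst h₁; exact h₂
  | cons a l ih => exact ⟨h₁.1, ih h₁.2⟩

lemma pathMat_append (l₁ l₂ : List Q.A) :
    Q.pathMat K (l₁ ++ l₂) = Q.pathMat K l₂ * Q.pathMat K l₁ := by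
  simp [QuiverData.pathMat]

lemma tp_paths : ∀ (J : Type) [Fintype J] (vt : J → Q.V) (ρ : Equiv.Perm J) (l : J → List Q.A),
    (∀ j, l j ≠ []) → (∀ j, Q.IsPathFrom (vt j) (vt (ρ j)) (l j)) →
    ∃ L : List (List Q.A), (∀ x ∈ L, Q.IsClosed x) ∧
      (L.map List.length).sum = ∑ j, (l j).length ∧
      tp (fun j => Q.pathMat K (l j)) ρ = (L.map (Q.pathTr K)).prod := by
  intro J hJ
  refine Fintype.induction_empty_option (P := fun J hJ => ∀ (vt : J → Q.V) (ρ : Equiv.Perm J) (l : J → List Q.A),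
    (∀ j, l j ≠ []) → (∀ j, Q.IsPathFrom (vt j) (vt (ρ j)) (l j)) →
    ∃ L : List (List Q.A), (∀ x ∈ L, Q.IsClosed x) ∧
      (L.map List.length).sum = ∑ j, (l j).length ∧
      tp (fun j => Q.pathMat K (l j)) ρ = (L.map (Q.pathTr K)).prod) ?_ ?_ ?_ J
  · intro α β hβ e ih vt ρ l hl hp
    let _ : Fintype α := Fintype.ofEquiv β e.symm
    obtain ⟨L, h1, h2, h3⟩ := ih (fun j => vt (e j)) ((e.trans ρ).trans e.symm) (fun j => l (e j))
      (fun j => hl _) (fun j => by simpa using hp (e j))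
    refine ⟨L, h1, h2.trans (Equiv.sum_comp e (fun j => (l j).length)), ?_⟩
    rw [tp_equiv e]
    exact h3
  · intro vt ρ l _ _
    exact ⟨[], by simp, by simp, by simp [tp]⟩
  · intro α hα ih vt ρ l hl hp
    let ρ' := Equiv.removeNone ρ
    by_cases h0 : ρ none = none
    · have h1 : ∀ j, ρ (some j) = some (ρ' j) := by
        intro j
        refine (Equiv.removeNone_some ρ ?_).symm
        apply Option.ne_none_iff_exists'.1
        intro hc
        exact absurd (ρ.injective (hc.trans h0.symm)) (by simp)
      obtain ⟨L, i1, i2, i3⟩ := ih (fun j => vt (some j)) ρ' (fun j => l (some j))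
        (fun j => hl _) (fun j => by rw [← h1]; exact hp _)
      refine ⟨l none :: L, ?_, ?_, ?_⟩
      · intro x hx
        rcases List.mem_cons.1 hx with rfl | hx
        · have := hp none
          rw [h0] at this
          exact ⟨vt none, hl _, this⟩
        · exact i1 x hx
      · rw [List.map_cons, List.sum_cons, i2, Fintype.sum_option]
      · rw [List.map_cons, List.prod_cons, ← i3, tp_option_none _ ρ ρ' h0 h1]
        rfl
    · obtain ⟨j₀, hj₀⟩ := Option.ne_none_iff_exists'.1 h0
      obtain ⟨i₀, hi₀⟩ : ∃ i₀, ρ (some i₀) = none := by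
        have : ρ.symm none ≠ none := by
          intro hc
          apply h0
          conv_lhs => rw [← hc]
          simp
        obtain ⟨i, hi⟩ := Option.ne_none_iff_exists'.1 this
        exact ⟨i, by rw [← hi]; simp⟩
      have h1 : ∀ j, j ≠ i₀ → ρ (some j) = some (ρ' j) := by
        intro j hj
        refine (Equiv.removeNone_some ρ ?_).symm
        apply Option.ne_none_iff_exists'.1
        intro hc
        exact hj (Option.some_injective _ (ρ.injective (hc.trans hi₀.symm)))
      have h2 : ρ none = some (ρ' i₀) := (Equiv.removeNone_none ρ hi₀).symm
      obtain ⟨L, i1, i2, i3⟩ := ih (fun j => vt (some j)) ρ'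
        (fun j => if j = i₀ then l (some i₀) ++ l none else l (some j))
        (fun j => by
          split_ifs
          · simp [hl]
          · exact hl _) (fun j => by
          split_ifs with h
          · subst h
            have e1 := hp (some j)
            have e2 := hp none
            rw [hi₀] at e1
            rw [h2] at e2
            exact path_append Q e1 e2
          · rw [← h1 j h]; exact hp _)
      refine ⟨L, i1, ?_, ?_⟩
      · rw [i2, Fintype.sum_option, ← Finset.add_sum_erase _ _ (Finset.mem_univ i₀),
          ← Finset.add_sum_erase _ (fun j => (l (some j)).length) (Finset.mem_univ i₀), if_pos rfl,
          List.length_append, ← add_assoc, add_comm (l none).length]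
        congr 1
        refine Finset.sum_congr rfl fun j hj => ?_
        rw [if_neg (Finset.ne_of_mem_erase hj)]
      · rw [tp_option_some _ ρ ρ' i₀ h2 hi₀ h1, ← i3]
        congr 1
        funext j
        split_ifs
        · rw [pathMat_append]
        · rfl

end paths
end QInv


namespace QInv
open MvPolynomial

section upper
variable (Q : QuiverData) {K : Type} [Field K]

/-- polynomial ring with the variables unfolded -/
abbrev PR (Q : QuiverData) (K : Type) [Field K] := MvPolynomial (Q.A × Fin 2 × Fin 2) K

/-- the action on variables -/
noncomputable def qact (g : Q.V → Matrix (Fin 2) (Fin 2) K) (v : Q.A × Fin 2 × Fin 2) : PR Q K :=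
  ∑ k : Fin 2, ∑ l : Fin 2,
    C (g (Q.tgt v.1) v.2.1 k * (g (Q.src v.1))⁻¹ l v.2.2) * X (v.1, k, l)

lemma inv_iff (f : PR Q K) : Q.IsInvariant K f ↔
    ∀ g : Q.V → Matrix (Fin 2) (Fin 2) K, (∀ v, IsUnit (g v).det) → aeval (qact Q g) f = f :=
  Iff.rfl

lemma MH_lin {A : Type} (a : A) (i j : Fin 2) (c : Fin 2 → Fin 2 → K) :
    MH (Prod.fst : A × Fin 2 × Fin 2 → A) (∑ k : Fin 2, ∑ l : Fin 2, C (c k l) * X (a, k, l))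
      (fun l => if (a, i, j).1 = l then 1 else 0) := by
  refine IsWeightedHomogeneous.sum _ _ _ fun k _ => IsWeightedHomogeneous.sum _ _ _ fun l _ => ?_
  exact IsWeightedHomogeneous.C_mul (MH_X Prod.fst (a, k, l)) _

lemma qact_MH (g : Q.V → Matrix (Fin 2) (Fin 2) K) (v : Q.A × Fin 2 × Fin 2) :
    MH Prod.fst (qact Q g v) (fun l => if v.1 = l then 1 else 0) :=
  MH_lin v.1 v.2.1 v.2.2 _

lemma comp_inv [Fintype Q.A] {f : PR Q K} (hf : Q.IsInvariant K f) (r : Q.A → ℕ) :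
    Q.IsInvariant K (comp (Prod.fst : Q.A × Fin 2 × Fin 2 → Q.A) r f) := by
  rw [inv_iff] at hf ⊢
  intro g hg
  rw [← comp_aeval _ _ (qact_MH Q g), hf g hg]

/-- scalar matrices: balance -/
lemma balance [Infinite K] [Fintype Q.A] {f : PR Q K} (hf : Q.IsInvariant K f) (h0 : f ≠ 0)
    {r : Q.A → ℕ} (hr : MH Prod.fst f r) (v : Q.V) :
    ∑ a, (if Q.tgt a = v then r a else 0) = ∑ a, if Q.src a = v then r a else 0 := by
  rw [inv_iff] at hf
  have key : ∀ t : K, t ≠ 0 → t ^ (∑ a, (if Q.tgt a = v then r a else 0)) =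
      t ^ (∑ a, if Q.src a = v then r a else 0) := by
    intro t ht
    have h1 := hf (fun w => if w = v then t • 1 else 1) (fun w => by
      split_ifs
      · simp [ht]
      · simp)
    have h2 : aeval (qact Q (fun w => if w = v then t • (1 : Matrix (Fin 2) (Fin 2) K) else 1)) f =
        aeval (fun x : Q.A × Fin 2 × Fin 2 =>
          (C ((if Q.tgt x.1 = v then t else 1) * (if Q.src x.1 = v then t⁻¹ else 1)) : PR Q K) * X x) f := by
      congr 2
      funext x
      rcases x with ⟨a, i, j⟩
      have e1 : ∀ w : Q.V, ∀ i j, (if w = v then t • (1 : Matrix (Fin 2) (Fin 2) K) else 1) i j =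
          (if w = v then t else 1) * if i = j then 1 else 0 := by
        intro w i j
        split_ifs <;> simp_all [Matrix.one_apply]
      have e2 : ∀ w : Q.V, ∀ i j, (if w = v then t • (1 : Matrix (Fin 2) (Fin 2) K) else 1)⁻¹ i j =
          (if w = v then t⁻¹ else 1) * if i = j then 1 else 0 := by
        intro w i j
        have : (if w = v then t • (1 : Matrix (Fin 2) (Fin 2) K) else 1)⁻¹ =
            (if w = v then t⁻¹ else 1) • 1 := by
          apply Matrix.inv_eq_right_inv
          split_ifs <;> simp [ht, smul_smul]
        rw [this]
        simp [Matrix.one_apply]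
      unfold qact
      simp only [e1, e2]
      fin_cases i <;> fin_cases j <;> simp
    rw [h2, hr.scale X (fun a => C ((if Q.tgt a = v then t else 1) * (if Q.src a = v then t⁻¹ else 1))),
      aeval_X_left_apply] at h1
    have h3 : (∏ a, (C ((if Q.tgt a = v then t else 1) * (if Q.src a = v then t⁻¹ else 1)) : PR Q K) ^ r a) = 1 :=
      mul_right_cancel₀ h0 (h1.trans (one_mul f).symm)
    simp only [← map_pow] at h3
    rw [← map_prod, ← C_1] at h3
    have h4 := C_injective _ _ h3
    simp only [mul_pow] at h4
    rw [Finset.prod_mul_distrib] at h4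
    have e3 : ∀ s : K, ∀ w : Q.A → Q.V, ∏ a, (if w a = v then s else 1) ^ r a =
        s ^ (∑ a, if w a = v then r a else 0) := by
      intro s w
      rw [← Finset.prod_pow_eq_pow_sum]
      refine Finset.prod_congr rfl fun a _ => ?_
      split_ifs <;> simp
    rw [e3, e3, inv_pow] at h4
    exact (mul_inv_eq_one₀ (pow_ne_zero _ ht)).1 h4
  by_contra hne
  rcases Nat.lt_or_gt_of_ne hne with h | h
  · obtain ⟨c, hc, hp⟩ := exists_pow_ne_one (K := K) (Nat.sub_ne_zero_of_lt h)
    apply hp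
    have := key c hc
    rw [pow_sub₀ _ hc h.le, ← this, mul_inv_cancel₀ (pow_ne_zero _ hc)]
  · obtain ⟨c, hc, hp⟩ := exists_pow_ne_one (K := K) (Nat.sub_ne_zero_of_lt h)
    apply hp
    have := key c hc
    rw [pow_sub₀ _ hc h.le, this, mul_inv_cancel₀ (pow_ne_zero _ hc)]

/-- twist -/
noncomputable def tw (K : Type) [Field K] (A : Type) (v : A × Fin 2 × Fin 2) :
    MvPolynomial (A × Fin 2 × Fin 2) K :=
  ∑ k : Fin 2, ∑ l : Fin 2, C ((if k = v.2.1 then 1 else 0) * (eps v.2.2 l : K)) * X (v.1, k, l)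

/-- inverse twist -/
noncomputable def ct (K : Type) [Field K] (A : Type) (v : A × Fin 2 × Fin 2) :
    MvPolynomial (A × Fin 2 × Fin 2) K :=
  ∑ k : Fin 2, X (v.1, v.2.1, k) * (eps k v.2.2 : MvPolynomial (A × Fin 2 × Fin 2) K)

lemma ct_tw {A : Type} (f : MvPolynomial (A × Fin 2 × Fin 2) K) :
    aeval (ct K A) (aeval (tw K A) f) = f := by
  rw [aeval_aeval]
  conv_rhs => rw [← aeval_X_left_apply f]
  congr 2
  funext v
  rcases v with ⟨a, i, j⟩
  fin_cases i <;> fin_cases j <;> simp [tw, ct, eps]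

lemma tw_act (g : Q.V → Matrix (Fin 2) (Fin 2) K) (hg : ∀ v, (g v).det = 1)
    (v : Q.A × Fin 2 × Fin 2) :
    aeval (fun v : Q.A × Fin 2 × Fin 2 => ∑ k, ∑ l,
      (C (g (Q.tgt v.1) v.2.1 k * g (Q.src v.1) v.2.2 l) * X (v.1, k, l) : PR Q K)) (tw K Q.A v) =
    aeval (tw K Q.A) (qact Q g v) := by
  rcases v with ⟨a, i, j⟩
  have hinv : (g (Q.src a))⁻¹ = (g (Q.src a)).adjugate := by
    rw [Matrix.inv_def, hg]; simp
  simp only [tw, qact, hinv, Matrix.adjugate_fin_two]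
  fin_cases i <;> fin_cases j <;> simp [eps, tw] <;> ring

lemma tw_inv {f : PR Q K} (hf : ∀ g : Q.V → Matrix (Fin 2) (Fin 2) K, (∀ v, IsUnit (g v).det) →
      aeval (qact Q g) f = f) (g : Q.V → Matrix (Fin 2) (Fin 2) K) (hg : ∀ v, (g v).det = 1) :
    aeval (fun v : Q.A × Fin 2 × Fin 2 => ∑ k, ∑ l,
      (C (g (Q.tgt v.1) v.2.1 k * g (Q.src v.1) v.2.2 l) * X (v.1, k, l) : PR Q K))
      (aeval (tw K Q.A) f) = aeval (tw K Q.A) f := by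
  have h1 := aeval_aeval (fun v : Q.A × Fin 2 × Fin 2 => ∑ k, ∑ l,
      (C (g (Q.tgt v.1) v.2.1 k * g (Q.src v.1) v.2.2 l) * X (v.1, k, l) : PR Q K)) (tw K Q.A) f
  have h2 := aeval_aeval (tw K Q.A) (qact Q g) f
  have h3 := hf g fun v => by rw [hg]; exact isUnit_one
  rw [funext (tw_act Q g hg)] at h1
  exact h1.trans (h2.symm.trans (congrArg _ h3))

/-- products of traces of closed paths -/
noncomputable def TSpan (K : Type) [Field K] (k : ℕ) : Submodule K (PR Q K) :=
  Submodule.span K {y | ∃ L : List (List Q.A), (∀ x ∈ L, Q.IsClosed x) ∧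
    (L.map List.length).sum = k ∧ y = (L.map (Q.pathTr K)).prod}

lemma pathMat_singleton (a : Q.A) : Q.pathMat K [a] = Q.genMat K a := by
  simp [QuiverData.pathMat]

/-- generic matrix with unfolded variables -/
noncomputable def gm (K : Type) [Field K] (a : Q.A) : Matrix (Fin 2) (Fin 2) (PR Q K) := Q.genMat K a

lemma mem_TSpan_of_MH [Infinite K] [Fintype Q.A] (h2 : (2 : K) ≠ 0) {f : PR Q K}
    (hf : Q.IsInvariant K f) {r : Q.A → ℕ} (hr : MH Prod.fst f r) :
    f ∈ TSpan Q K (∑ a, r a) := by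
  by_cases h0 : f = 0
  · rw [h0]; exact Submodule.zero_mem _
  have hbal := balance Q hf h0 hr
  rw [inv_iff] at hf
  have hψ : aeval (tw K Q.A) f ∈ VSpan K Q.tgt Q.src r := by
    refine arrow_fft h2 Q.tgt Q.src r _ (fun g hg => ?_)
      (hr.map_same Prod.fst _ fun v _ => MH_lin v.1 v.2.1 v.2.2 _)
    exact tw_inv Q hf g hg
  rw [← ct_tw f]
  generalize aeval (tw K Q.A) f = F at hψ
  induction hψ using Submodule.span_induction with
  | zero => rw [map_zero]; exact Submodule.zero_mem _
  | add x y _ _ hx hy => rw [map_add]; exact Submodule.add_mem _ hx hy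
  | smul c x _ hx => rw [map_smul]; exact Submodule.smul_mem _ _ hx
  | mem x hx =>
    obtain ⟨P, J, _, _, c, E, hc, hE, rfl⟩ := hx
    have e1 : aeval (ct K Q.A) (val (fun p => gen K Q.A (c p)) E) =
        val (fun p i j => ∑ k, gm Q K (c p) i k * (eps k j : PR Q K)) E := by
      refine (val_map (aeval (ct K Q.A) : PR Q K →ₐ[K] PR Q K).toRingHom _ E).trans ?_
      congr 1
      funext p i j
      exact (aeval_X _ _)
    rw [e1]
    have cnt : ∀ (w : Q.A → Q.V) (v : Q.V), ∑ p, (if w (c p) = v then (1 : ℤ) else 0) =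
        ((∑ a, if w a = v then r a else 0 : ℕ) : ℤ) := by
      intro w v
      push_cast
      have : ∀ p, (if w (c p) = v then (1 : ℤ) else 0) =
          ∑ a, if c p = a then (if w a = v then (1 : ℤ) else 0) else 0 := by
        intro p; simp
      simp only [this]
      rw [Finset.sum_comm]
      refine Finset.sum_congr rfl fun a _ => ?_
      rw [← hc a, natcard_fiber]
      split_ifs <;> simp
    have hb : ∀ v, ∑ p, (if Q.tgt (c p) = v then (1 : ℤ) else 0) =
        ∑ p, if Q.src (c p) = v then (1 : ℤ) else 0 := by
      intro v
      rw [cnt Q.tgt, cnt Q.src, hbal v]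
    have hcard : Fintype.card P = ∑ a, r a := by
      have : ∀ p : P, (1 : ℕ) = ∑ a, if c p = a then 1 else 0 := by intro p; simp
      rw [Fintype.card_eq_sum_ones, Finset.sum_congr rfl fun p _ => this p, Finset.sum_comm]
      refine Finset.sum_congr rfl fun a _ => ?_
      rw [← hc a, natcard_fiber]
    refine reduce (hv := fun p => Q.tgt (c p)) (tv := fun p => Q.src (c p)) hb _
      (TSpan Q K (∑ a, r a)).toAddSubgroup ?_ _ E le_rfl hE
    intro E' hE' hne
    refine val_norm _ _ E' hne _ _ hE' ?_
    intro E'' hE'' hs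
    let h : J ≃ P := Equiv.ofBijective (fun j => (E''.symm (j, false)).1) (by
      constructor
      · intro j j' hjj
        have : E''.symm (j, false) = E''.symm (j', false) :=
          Prod.ext hjj ((hs j).1.trans (hs j').1.symm)
        simpa using this
      · intro p
        obtain ⟨⟨j, b⟩, hj⟩ := E''.symm.surjective (p, true)
        cases b
        · exact ⟨j, by simp [hj]⟩
        · have := (hs j).2
          rw [hj] at this
          simp at this)
    let t : J ≃ P := Equiv.ofBijective (fun j => (E''.symm (j, true)).1) (by
      constructor
      · intro j j' hjj
        have : E''.symm (j, true) = E''.symm (j', true) :=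
          Prod.ext hjj ((hs j).2.trans (hs j').2.symm)
        simpa using this
      · intro p
        obtain ⟨⟨j, b⟩, hj⟩ := E''.symm.surjective (p, false)
        cases b
        · have := (hs j).1
          rw [hj] at this
          simp at this
        · exact ⟨j, by simp [hj]⟩)
    have hh : ∀ j, E''.symm (j, false) = (h j, true) := fun j => Prod.ext rfl (hs j).1
    have ht : ∀ j, E''.symm (j, true) = (t j, false) := fun j => Prod.ext rfl (hs j).2
    have hval := val_tp (fun p => gm Q K (c p)) E'' h t
      (fun p => by rw [← Equiv.eq_symm_apply, hh]; simp)
      (fun p => by rw [← Equiv.eq_symm_apply, ht]; simp)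
    rw [hval]
    have hcompat : ∀ j, Q.tgt (c (h j)) = Q.src (c (t j)) := by
      intro j
      have := hE'' j
      rw [hh, ht] at this
      exact this
    obtain ⟨L, l1, l2, l3⟩ := tp_paths Q K J (fun j => Q.src (c (t j))) (t.trans h.symm)
      (fun j => [c (t j)]) (fun j => by simp) (fun j => by
        refine ⟨rfl, ?_⟩
        show Q.tgt (c (t j)) = Q.src (c (t ((t.trans h.symm) j)))
        rw [← hcompat]
        simp)
    refine Submodule.subset_span ⟨L, l1, ?_, ?_⟩
    · rw [l2]
      simp only [List.length_singleton, Finset.sum_const, smul_eq_mul, mul_one]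
      rw [← hcard, Finset.card_univ, Fintype.card_congr t]
    · rw [← l3]
      congr 1
      funext j
      exact (pathMat_singleton Q _).symm

end upper
end QInv


namespace QInv
open MvPolynomial

section dec
variable (Q : QuiverData) {K : Type} [Field K]

lemma map_pathMat (g : Q.V → Matrix (Fin 2) (Fin 2) K) (hg : ∀ v, IsUnit (g v).det)
    (l : List Q.A) (u v : Q.V) (h : Q.IsPathFrom u v l) :
    (Q.pathMat K l).map (aeval (Q.actVar K g)) =
      (g v).map C * Q.pathMat K l * ((g u)⁻¹).map C := by
  have hgg : ∀ v, ((g v)⁻¹).map (C : K →+* MvPolynomial Q.Var K) * (g v).map C = 1 := by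
    intro v
    rw [← Matrix.map_mul, Matrix.nonsing_inv_mul _ (hg v), Matrix.map_one _ (map_zero _) (map_one _)]
  have hgg' : ∀ v, (g v).map C * ((g v)⁻¹).map (C : K →+* MvPolynomial Q.Var K) = 1 := by
    intro v
    rw [← Matrix.map_mul, Matrix.mul_nonsing_inv _ (hg v), Matrix.map_one _ (map_zero _) (map_one _)]
  induction l generalizing u with
  | nil =>
    simp only [QuiverData.IsPathFrom] at h
    subst h
    have : Q.pathMat K [] = 1 := by simp [QuiverData.pathMat]
    rw [this, Matrix.map_one _ (map_zero _) (map_one _), mul_one, hgg']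
  | cons a l ih =>
    obtain ⟨h1, h2⟩ := h
    have e : Q.pathMat K (a :: l) = Q.pathMat K l * Q.genMat K a := by
      have := pathMat_append Q K [a] l
      rw [pathMat_singleton] at this
      exact this
    have e2 : (Q.genMat K a).map (aeval (Q.actVar K g)) =
        (g (Q.tgt a)).map C * Q.genMat K a * ((g (Q.src a))⁻¹).map C := by
      ext1 i j
      rw [Matrix.map_apply]
      refine (aeval_X _ _).trans ?_
      have e3 : Q.actVar K g (a, i, j) = ∑ k : Fin 2, ∑ l : Fin 2,
          C (g (Q.tgt a) i k * (g (Q.src a))⁻¹ l j) * Q.genMat K a k l := rfl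
      rw [e3]
      simp only [Matrix.mul_apply, Matrix.map_apply, Fin.sum_univ_two, map_mul]
      ring
    rw [e, Matrix.map_mul, ih _ h2, e2, h1]
    simp only [Matrix.mul_assoc]
    rw [← Matrix.mul_assoc (((g (Q.tgt a))⁻¹).map C) ((g (Q.tgt a)).map C), hgg, Matrix.one_mul]

lemma pathTr_inv {l : List Q.A} (h : Q.IsClosed l) : Q.IsInvariant K (Q.pathTr K l) := by
  obtain ⟨v, _, hp⟩ := h
  intro g hg
  have := map_pathMat Q g hg l v v hp
  have h2 : aeval (Q.actVar K g) (Q.pathTr K l) =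
      ((Q.pathMat K l).map (aeval (Q.actVar K g))).trace := by
    simp [QuiverData.pathTr, Matrix.trace]
  rw [h2, this, Matrix.trace_mul_comm, ← Matrix.mul_assoc, ← Matrix.map_mul,
    Matrix.nonsing_inv_mul _ (hg v), Matrix.map_one _ (map_zero _) (map_one _), Matrix.one_mul]
  rfl

lemma pathTr_plus {l : List Q.A} (h : Q.IsClosed l) : Q.pathTr K l ∈ Q.PlusSet K := by
  refine ⟨pathTr_inv Q h, ?_⟩
  obtain ⟨v, hne, _⟩ := h
  obtain ⟨a, l, rfl⟩ := List.exists_cons_of_ne_nil hne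
  have e : Q.pathMat K (a :: l) = Q.pathMat K l * Q.genMat K a := by
    have := pathMat_append Q K [a] l
    rw [pathMat_singleton] at this
    exact this
  have e0 : ∀ i j, constantCoeff (Q.genMat K a i j) = 0 := fun i j => constantCoeff_X K _
  simp [QuiverData.pathTr, Matrix.trace, e, Matrix.mul_apply, e0]

lemma plus_mul {p q : MvPolynomial Q.Var K} (hp : p ∈ Q.PlusSet K) (hq : q ∈ Q.PlusSet K) :
    p * q ∈ Q.PlusSet K :=
  ⟨fun g hg => by rw [map_mul, hp.1 g hg, hq.1 g hg], by rw [map_mul, hp.2, zero_mul]⟩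

/-- the decomposables -/
noncomputable def DS (K : Type) [Field K] : Submodule K (MvPolynomial Q.Var K) :=
  Submodule.span K
    {x : MvPolynomial Q.Var K | ∃ p ∈ Q.PlusSet K, ∃ q ∈ Q.PlusSet K, x = p * q}

lemma DS_mul {p q : MvPolynomial Q.Var K} (hp : p ∈ Q.PlusSet K) (hq : q ∈ Q.PlusSet K) :
    p * q ∈ DS Q K := Submodule.subset_span ⟨p, hp, q, hq, rfl⟩

lemma plus_prod (l : List Q.A) (L : List (List Q.A)) (h : ∀ x ∈ l :: L, Q.IsClosed x) :
    ((l :: L).map (Q.pathTr K)).prod ∈ Q.PlusSet K := by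
  induction L generalizing l with
  | nil => simpa using pathTr_plus Q (h l (by simp))
  | cons l' L ih =>
    rw [List.map_cons, List.prod_cons]
    exact plus_mul Q (pathTr_plus Q (h l (by simp))) (ih l' fun x hx => h x (List.mem_cons_of_mem _ hx))

lemma trid {B : Type} [CommRing B] (X Y Z : Matrix (Fin 2) (Fin 2) B) :
    (X * Y * Z).trace + (X * Z * Y).trace = X.trace * (Y * Z).trace + Y.trace * (X * Z).trace +
      Z.trace * (X * Y).trace - X.trace * (Y.trace * Z.trace) := by
  simp only [Matrix.trace_fin_two, Matrix.mul_apply, Fin.sum_univ_two]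
  ring

lemma closed_append {w : Q.V} {a b : List Q.A} (ha : Q.IsClosedAt w a) (hb : Q.IsClosedAt w b) :
    Q.IsClosedAt w (a ++ b) := ⟨by simp [ha.1], path_append Q ha.2 hb.2⟩

lemma three {w : Q.V} {a b c : List Q.A} (ha : Q.IsClosedAt w a) (hb : Q.IsClosedAt w b)
    (hc : Q.IsClosedAt w c) :
    Q.pathTr K (a ++ (b ++ c)) + Q.pathTr K (a ++ (c ++ b)) ∈ DS Q K := by
  have h := trid (Q.pathMat K c) (Q.pathMat K b) (Q.pathMat K a)
  have h1 : Q.pathTr K (a ++ (b ++ c)) + Q.pathTr K (a ++ (c ++ b)) =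
      Q.pathTr K c * Q.pathTr K (a ++ b) + Q.pathTr K b * Q.pathTr K (a ++ c) +
      Q.pathTr K a * Q.pathTr K (b ++ c) - Q.pathTr K c * (Q.pathTr K b * Q.pathTr K a) := by
    simp only [QuiverData.pathTr, pathMat_append]
    rw [← h, Matrix.mul_assoc (Q.pathMat K b), Matrix.trace_mul_comm (Q.pathMat K b)]
  rw [h1]
  have pa : Q.pathTr K a ∈ Q.PlusSet K := pathTr_plus Q ⟨w, ha⟩
  have pb : Q.pathTr K b ∈ Q.PlusSet K := pathTr_plus Q ⟨w, hb⟩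
  have pc : Q.pathTr K c ∈ Q.PlusSet K := pathTr_plus Q ⟨w, hc⟩
  refine Submodule.sub_mem _ (Submodule.add_mem _ (Submodule.add_mem _ ?_ ?_) ?_) ?_
  · exact DS_mul Q pc (pathTr_plus Q ⟨w, closed_append Q ha hb⟩)
  · exact DS_mul Q pb (pathTr_plus Q ⟨w, closed_append Q ha hc⟩)
  · exact DS_mul Q pa (pathTr_plus Q ⟨w, closed_append Q hb hc⟩)
  · exact DS_mul Q pc (plus_mul Q pb pa)

lemma four (h2 : (2 : K) ≠ 0) {w : Q.V} {a b c d : List Q.A} (ha : Q.IsClosedAt w a)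
    (hb : Q.IsClosedAt w b) (hc : Q.IsClosedAt w c) (hd : Q.IsClosedAt w d) :
    Q.pathTr K (a ++ (b ++ (c ++ d))) ∈ DS Q K := by
  have e1 := three Q (K := K) (closed_append Q ha hb) hc hd
  have e2 := three Q (K := K) ha hb (closed_append Q hd hc)
  have e3 := three Q (K := K) ha hd (closed_append Q hc hb)
  have e4 := three Q (K := K) ha hc (closed_append Q hb hd)
  simp only [List.append_assoc] at e1 e2 e3 e4
  have h := (DS Q K).sub_mem ((DS Q K).add_mem ((DS Q K).sub_mem ((DS Q K).add_mem e1 e1) e2) e3) e4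
  have h3 : (2 : K) • Q.pathTr K (a ++ (b ++ (c ++ d))) ∈ DS Q K := by
    convert h using 1
    rw [two_smul]
    ring
  exact (Submodule.smul_mem_iff _ h2).1 h3

lemma split_visit {u v w : Q.V} {j : ℕ} {l : List Q.A} (h : Q.IsPathFrom u v l)
    (hc : j + 1 ≤ (l.map Q.tgt).count w) :
    ∃ a b, l = a ++ b ∧ a ≠ [] ∧ Q.IsPathFrom u w a ∧ Q.IsPathFrom w v b ∧
      j ≤ (b.map Q.tgt).count w := by
  induction l generalizing u with
  | nil => simp at hc
  | cons x l ih =>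
    obtain ⟨h1, h2⟩ := h
    by_cases hx : Q.tgt x = w
    · refine ⟨[x], l, rfl, by simp, ⟨h1, hx⟩, hx ▸ h2, ?_⟩
      rw [List.map_cons, hx, List.count_cons_self] at hc
      omega
    · rw [List.map_cons, List.count_cons_of_ne hx] at hc
      obtain ⟨a, b, rfl, _, ha, hb, hj⟩ := ih h2 hc
      exact ⟨x :: a, b, rfl, by simp, ⟨h1, ha⟩, hb, hj⟩

lemma long_dec [Fintype Q.V] (h2 : (2 : K) ≠ 0) {l : List Q.A} (hl : Q.IsClosed l)
    (hlen : 3 * Fintype.card Q.V < l.length) : Q.pathTr K l ∈ DS Q K := by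
  obtain ⟨v, _, hp⟩ := hl
  obtain ⟨w, hw⟩ : ∃ w, 4 ≤ (l.map Q.tgt).count w := by
    by_contra! H
    have : (l.map Q.tgt).length = ∑ w, (l.map Q.tgt).count w := by
      have := Multiset.toFinset_sum_count_eq (l.map Q.tgt : Multiset Q.V)
      rw [Multiset.coe_card] at this
      rw [← this]
      refine Finset.sum_subset (Finset.subset_univ _) ?_ |>.trans ?_
      · intro x _ hx
        apply Multiset.count_eq_zero.2
        simpa using hx
      · simp
    rw [List.length_map] at this
    have h3 : ∑ w, (l.map Q.tgt).count w ≤ ∑ _w : Q.V, 3 :=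
      Finset.sum_le_sum fun w _ => Nat.le_of_lt_succ (H w)
    simp only [Finset.sum_const, Finset.card_univ, smul_eq_mul] at h3
    omega
  obtain ⟨a, l1, rfl, ha, pa, hp1, c1⟩ := split_visit Q hp hw
  obtain ⟨b, l2, rfl, hb, pb, hp2, c2⟩ := split_visit Q hp1 c1
  obtain ⟨c, l3, rfl, hc, pc, hp3, c3⟩ := split_visit Q hp2 c2
  obtain ⟨d, l4, rfl, hd, pd, hp4, c4⟩ := split_visit Q hp3 c3
  have h := four Q (K := K) h2 (w := w) (a := l4 ++ a) ⟨by simp [ha], path_append Q hp4 pa⟩ ⟨hb, pb⟩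
    ⟨hc, pc⟩ ⟨hd, pd⟩
  convert h using 1
  unfold QuiverData.pathTr
  have e : l4 ++ a ++ (b ++ (c ++ d)) = l4 ++ (a ++ (b ++ (c ++ d))) := by simp
  have e' : a ++ (b ++ (c ++ (d ++ l4))) = (a ++ (b ++ (c ++ d))) ++ l4 := by simp
  rw [e, e', pathMat_append Q K _ l4, pathMat_append Q K l4, Matrix.trace_mul_comm]

lemma TSpan_dec [Fintype Q.V] (h2 : (2 : K) ≠ 0) {k : ℕ} (hk : 3 * Fintype.card Q.V < k)
    {f : MvPolynomial Q.Var K} (hf : f ∈ TSpan Q K k) : f ∈ DS Q K := by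
  have : TSpan Q K k ≤ (DS Q K : Submodule K (PR Q K)) := by
    refine Submodule.span_le.2 ?_
    rintro x ⟨L, h1, h3, rfl⟩
    match L, h1, h3 with
    | [], h1, h3 => simp at h3; omega
    | [l], h1, h3 =>
      simp only [List.map_cons, List.map_nil, List.sum_cons, List.sum_nil, add_zero] at h3
      have := long_dec Q (K := K) h2 (h1 l (by simp)) (h3 ▸ hk)
      rw [List.map_singleton, List.prod_singleton]
      exact this
    | l :: l' :: L, h1, h3 =>
      rw [List.map_cons, List.prod_cons]
      exact DS_mul Q (pathTr_plus Q (h1 l (by simp)))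
        (plus_prod Q l' L fun x hx => h1 x (List.mem_cons_of_mem _ hx))
  exact this hf

lemma sum_of_comp_ne [Fintype Q.A] {f : PR Q K} {k : ℕ} (hk : f.IsHomogeneous k) {r : Q.A → ℕ}
    (h : comp (Prod.fst : Q.A × Fin 2 × Fin 2 → Q.A) r f ≠ 0) : ∑ a, r a = k := by
  obtain ⟨d, hd⟩ := ne_zero_iff.1 h
  have hw := comp_MH (Prod.fst : Q.A × Fin 2 × Fin 2 → Q.A) r f hd
  unfold comp at hd
  rw [coeff_weightedHomogeneousComponent, if_pos hw] at hd
  have h1 := hk hd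
  rw [← h1, ← hw]
  simp only [weight_wt]
  rw [Finset.sum_comm]
  simp [Finsupp.weight_apply, Finsupp.sum]

theorem upper [Infinite K] [Fintype Q.A] [Fintype Q.V] (h2 : (2 : K) ≠ 0)
    {f : MvPolynomial Q.Var K} (hf : Q.IsInvariant K f) {k : ℕ} (hk : f.IsHomogeneous k)
    (hkn : 3 * Fintype.card Q.V < k) : Q.Decomposable K f := by
  obtain ⟨s, hs⟩ := exists_sum_comp (Prod.fst : Q.A × Fin 2 × Fin 2 → Q.A) (f : PR Q K)
  show f ∈ DS Q K
  rw [hs]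
  refine Submodule.sum_mem _ fun r _ => ?_
  by_cases h0 : comp (Prod.fst : Q.A × Fin 2 × Fin 2 → Q.A) r (f : PR Q K) = 0
  · rw [h0]; exact Submodule.zero_mem _
  · have h1 := mem_TSpan_of_MH Q h2 (comp_inv Q hf r) (comp_MH _ r f)
    rw [sum_of_comp_ne Q hk h0] at h1
    exact TSpan_dec Q h2 hkn h1

theorem Dnum_le [Infinite K] [Fintype Q.A] [Fintype Q.V] (h2 : (2 : K) ≠ 0) :
    ∀ k ∈ {k | ∃ f : MvPolynomial Q.Var K,
      Q.IsInvariant K f ∧ f.IsHomogeneous k ∧ ¬ Q.Decomposable K f}, k ≤ 3 * Fintype.card Q.V := by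
  rintro k ⟨f, h1, h3, h4⟩
  by_contra h
  exact h4 (upper Q h2 h1 h3 (not_le.1 h))

end dec
end QInv


namespace QInv
open MvPolynomial

section lam
variable {K : Type} [Field K] {T : Type} [Fintype T]

/-- multilinear monomials -/
noncomputable def mo (φ : T → Fin 2 × Fin 2) : (T × Fin 2 × Fin 2) →₀ ℕ :=
  ∑ t, Finsupp.single (t, φ t) 1

lemma mo_apply (φ : T → Fin 2 × Fin 2) (t : T) (x : Fin 2 × Fin 2) :
    mo φ (t, x) = if φ t = x then 1 else 0 := by
  unfold mo
  rw [Finsupp.finsetSum_apply, Finset.sum_eq_single t]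
  · by_cases h : φ t = x
    · rw [if_pos h, h]; simp
    · rw [if_neg h, Finsupp.single_eq_of_ne]
      intro hc
      exact h (Prod.ext_iff.1 hc).2.symm
  · intro b _ hb
    rw [Finsupp.single_eq_of_ne]
    intro hc
    exact hb (Prod.ext_iff.1 hc).1.symm
  · intro h; exact absurd (Finset.mem_univ _) h

lemma mo_inj {φ ψ : T → Fin 2 × Fin 2} (h : mo φ = mo ψ) : φ = ψ := by
  funext t
  have h1 := mo_apply φ t (φ t)
  rw [h, mo_apply, if_pos rfl] at h1
  by_contra hc
  rw [if_neg (Ne.symm hc)] at h1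
  simp at h1

lemma weight_fst (d : (T × Fin 2 × Fin 2) →₀ ℕ) (t : T) :
    Finsupp.weight (wt (Prod.fst : T × Fin 2 × Fin 2 → T)) d t = ∑ x, d (t, x) := by
  rw [weight_wt]
  have : ∑ v ∈ d.support, (if v.1 = t then d v else 0) = ∑ v, if v.1 = t then d v else 0 := by
    refine Finset.sum_subset (Finset.subset_univ _) fun v _ hv => ?_
    rw [Finsupp.notMem_support_iff.1 hv]; simp
  rw [this, Fintype.sum_prod_type, Finset.sum_eq_single t]
  · simp
  · intro b _ hb; simp [hb]
  · simp

lemma weight_mo (φ : T → Fin 2 × Fin 2) :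
    Finsupp.weight (wt (Prod.fst : T × Fin 2 × Fin 2 → T)) (mo φ) = 1 := by
  funext t
  rw [weight_fst]
  simp [mo_apply]

lemma eq_mo {d : (T × Fin 2 × Fin 2) →₀ ℕ}
    (h : Finsupp.weight (wt (Prod.fst : T × Fin 2 × Fin 2 → T)) d = 1) : ∃ φ, d = mo φ := by
  have h1 : ∀ t, ∑ x, d (t, x) = 1 := fun t => by rw [← weight_fst, h]; rfl
  have h2 : ∀ t, ∃ x, d (t, x) ≠ 0 := by
    intro t
    by_contra! H
    have := h1 t
    simp [H] at this
  choose φ hφ using h2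
  refine ⟨φ, ?_⟩
  ext ⟨t, x⟩
  rw [mo_apply]
  have h3 := h1 t
  rw [← Finset.add_sum_erase _ _ (Finset.mem_univ (φ t))] at h3
  have h4 := hφ t
  split_ifs with hx
  · rw [← hx]; omega
  · have h5 := Finset.single_le_sum (f := fun x => d (t, x)) (fun i _ => Nat.zero_le _)
      (Finset.mem_erase.2 ⟨Ne.symm hx, Finset.mem_univ x⟩)
    omega

lemma monomial_mo (φ : T → Fin 2 × Fin 2) :
    (monomial (mo φ) 1 : MvPolynomial (T × Fin 2 × Fin 2) K) = ∏ t, X (t, φ t) := by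
  unfold mo
  rw [monomial_sum_one]
  rfl

/-- the functional -/
noncomputable def lam (W : (T → Fin 2 × Fin 2) → K) (F : MvPolynomial (T × Fin 2 × Fin 2) K) : K :=
  ∑ φ, coeff (mo φ) F * W φ

lemma lam_add (W : (T → Fin 2 × Fin 2) → K) (F G : MvPolynomial (T × Fin 2 × Fin 2) K) :
    lam W (F + G) = lam W F + lam W G := by
  simp [lam, add_mul, Finset.sum_add_distrib]

lemma lam_smul (W : (T → Fin 2 × Fin 2) → K) (c : K) (F : MvPolynomial (T × Fin 2 × Fin 2) K) :
    lam W (c • F) = c * lam W F := by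
  simp [lam, mul_assoc, Finset.mul_sum]

lemma lam_zero (W : (T → Fin 2 × Fin 2) → K) : lam W 0 = 0 := by
  simp [lam]

lemma lam_sum (W : (T → Fin 2 × Fin 2) → K) {ι : Type} (s : Finset ι)
    (F : ι → MvPolynomial (T × Fin 2 × Fin 2) K) :
    lam W (∑ i ∈ s, F i) = ∑ i ∈ s, lam W (F i) := by
  induction s using Finset.induction_on with
  | empty => simp [lam_zero]
  | insert a s ha ih => rw [Finset.sum_insert ha, Finset.sum_insert ha, lam_add, ih]

lemma lam_prod (W : (T → Fin 2 × Fin 2) → K) (φ : T → Fin 2 × Fin 2) :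
    lam W (∏ t, X (t, φ t)) = W φ := by
  rw [← monomial_mo]
  unfold lam
  rw [Finset.sum_eq_single φ]
  · simp
  · intro ψ _ hψ
    rw [coeff_monomial, if_neg (fun h => hψ (mo_inj h).symm), zero_mul]
  · simp

lemma lam_of_ne (W : (T → Fin 2 × Fin 2) → K) {F : MvPolynomial (T × Fin 2 × Fin 2) K} {r : T → ℕ}
    (hF : MH Prod.fst F r) (hr : r ≠ 1) : lam W F = 0 := by
  unfold lam
  refine Finset.sum_eq_zero fun φ _ => ?_
  by_cases h : coeff (mo φ) F = 0
  · rw [h, zero_mul]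
  · exact absurd ((hF h).symm.trans (weight_mo φ)) hr

lemma MH_one_eq {F : MvPolynomial (T × Fin 2 × Fin 2) K} (hF : MH Prod.fst F 1) :
    F = ∑ φ : T → Fin 2 × Fin 2, coeff (mo φ) F • ∏ t, X (t, φ t) := by
  simp only [← monomial_mo]
  ext d
  rw [coeff_sum]
  simp only [coeff_smul, coeff_monomial, smul_eq_mul, mul_ite, mul_one, mul_zero]
  by_cases h : coeff d F = 0
  · rw [h]
    symm
    refine Finset.sum_eq_zero fun φ _ => ?_
    split_ifs with h'
    · rw [h', h]
    · rfl
  · obtain ⟨φ, rfl⟩ := eq_mo (hF h)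
    rw [Finset.sum_eq_single φ]
    · rw [if_pos rfl]
    · intro ψ _ hψ
      rw [if_neg (fun h => hψ (mo_inj h))]
    · simp

/-- the weights -/
noncomputable def Wt (β : Equiv.Perm T) (s : T → Fin 2 → Fin 2 → K) (φ : T → Fin 2 × Fin 2) : K :=
  ∏ t, s t (φ (β t)).2 (φ t).1

/-- shear equivalence -/
def shear (β : Equiv.Perm T) : (T → Fin 2 × Fin 2) ≃ (T → Fin 2 × Fin 2) where
  toFun φ t := ((φ t).1, (φ (β t)).2)
  invFun χ t := ((χ t).1, (χ (β.symm t)).2)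
  left_inv φ := by funext t; simp
  right_inv χ := by funext t; simp

lemma lam_subst (β : Equiv.Perm T) (s : T → Fin 2 → Fin 2 → K)
    (G G' : T → Matrix (Fin 2) (Fin 2) K) (ε : T → K)
    (h : ∀ t i j, ∑ k, ∑ l, G t i k * s t l k * G' (β t) l j = ε t * s t j i)
    {F : MvPolynomial (T × Fin 2 × Fin 2) K} (hF : MH Prod.fst F 1) :
    lam (Wt β s) (aeval (fun v : T × Fin 2 × Fin 2 => ∑ k, ∑ l,
      (C (G v.1 v.2.1 k * G' v.1 l v.2.2) * X (v.1, k, l) : MvPolynomial (T × Fin 2 × Fin 2) K)) F) =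
      (∏ t, ε t) * lam (Wt β s) F := by
  have key : ∀ φ : T → Fin 2 × Fin 2, lam (Wt β s) (aeval (fun v : T × Fin 2 × Fin 2 => ∑ k, ∑ l,
      (C (G v.1 v.2.1 k * G' v.1 l v.2.2) * X (v.1, k, l) : MvPolynomial (T × Fin 2 × Fin 2) K))
      (∏ t, X (t, φ t) : MvPolynomial (T × Fin 2 × Fin 2) K)) = (∏ t, ε t) * Wt β s φ := by
    intro φ
    have e1 : aeval (fun v : T × Fin 2 × Fin 2 => ∑ k, ∑ l,
      (C (G v.1 v.2.1 k * G' v.1 l v.2.2) * X (v.1, k, l) : MvPolynomial (T × Fin 2 × Fin 2) K))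
      (∏ t, X (t, φ t) : MvPolynomial (T × Fin 2 × Fin 2) K) = ∑ φ' : T → Fin 2 × Fin 2,
        (∏ t, G t (φ t).1 (φ' t).1 * G' t (φ' t).2 (φ t).2) • ∏ t, X (t, φ' t) := by
      rw [map_prod]
      simp only [aeval_X]
      have : ∀ t, ∑ k, ∑ l, (C (G t (φ t).1 k * G' t l (φ t).2) * X (t, k, l) :
          MvPolynomial (T × Fin 2 × Fin 2) K) =
          ∑ x : Fin 2 × Fin 2, C (G t (φ t).1 x.1 * G' t x.2 (φ t).2) * X (t, x) := by
        intro t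
        rw [Fintype.sum_prod_type]
      simp only [this]
      rw [Fintype.prod_sum]
      refine Finset.sum_congr rfl fun φ' _ => ?_
      rw [Finset.prod_mul_distrib, ← map_prod, C_mul']
    rw [e1, lam_sum]
    simp only [lam_smul, lam_prod]
    unfold Wt
    have e2 : ∀ φ' : T → Fin 2 × Fin 2, (∏ t, G t (φ t).1 (φ' t).1 * G' t (φ' t).2 (φ t).2) *
        ∏ t, s t (φ' (β t)).2 (φ' t).1 =
        ∏ t, G t (φ t).1 (shear β φ' t).1 * s t (shear β φ' t).2 (shear β φ' t).1 *
          G' (β t) (shear β φ' t).2 (φ (β t)).2 := by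
      intro φ'
      rw [Finset.prod_mul_distrib, Finset.prod_mul_distrib, Finset.prod_mul_distrib,
        ← Equiv.prod_comp β (fun t => G' t (φ' t).2 (φ t).2)]
      simp only [shear, Equiv.coe_fn_mk]
      ring
    rw [Finset.sum_congr rfl fun φ' _ => e2 φ']
    rw [Equiv.sum_comp (shear β) (fun χ => ∏ t, G t (φ t).1 (χ t).1 * s t (χ t).2 (χ t).1 *
          G' (β t) (χ t).2 (φ (β t)).2)]
    rw [← Fintype.prod_sum (fun t (x : Fin 2 × Fin 2) => G t (φ t).1 x.1 * s t x.2 x.1 *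
          G' (β t) x.2 (φ (β t)).2), ← Finset.prod_mul_distrib]
    refine Finset.prod_congr rfl fun t _ => ?_
    rw [Fintype.sum_prod_type, h]
  have hd := MH_one_eq hF
  conv_lhs => rw [hd]
  rw [map_sum, lam_sum]
  simp only [map_smul, lam_smul, key]
  unfold lam
  rw [Finset.mul_sum]
  refine Finset.sum_congr rfl fun φ _ => ?_
  ring

end lam
end QInv


namespace QInv
open MvPolynomial

section quiver0
variable (n m : ℕ) (hm : 2 ≤ m) (hmn : m ≤ n)

/-- the permutation linking the heads and tails of arrows -/
def bf : Fin n × Fin 3 → Fin n × Fin 3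
  | (v, 0) => if _h : v.1 < m then
      (if h' : v.1 + 1 < m then (⟨v.1 + 1, lt_of_lt_of_le h' hmn⟩, 0) else (⟨0, v.pos⟩, 0))
      else (⟨v.1 - 1, lt_of_le_of_lt (Nat.sub_le _ _) v.2⟩, 1)
  | (v, 1) => if h : m ≤ v.1 + 1 ∧ v.1 + 1 < n then (⟨v.1 + 1, h.2⟩, 0) else (v, 1)
  | (v, 2) => (v, 2)

/-- its inverse -/
def bi : Fin n × Fin 3 → Fin n × Fin 3
  | (v, 0) => if v.1 < m then
      (if v.1 = 0 then (⟨m - 1, by omega⟩, 0) else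
        (⟨v.1 - 1, lt_of_le_of_lt (Nat.sub_le _ _) v.2⟩, 0))
      else (⟨v.1 - 1, lt_of_le_of_lt (Nat.sub_le _ _) v.2⟩, 1)
  | (v, 1) => if h : m ≤ v.1 + 1 ∧ v.1 + 1 < n then (⟨v.1 + 1, h.2⟩, 0) else (v, 1)
  | (v, 2) => (v, 2)

lemma bi_bf (x : Fin n × Fin 3) : bi n m hm hmn (bf n m hmn x) = x := by
  obtain ⟨⟨v, hv⟩, k⟩ := x
  fin_cases k
  · show bi n m hm hmn (bf n m hmn (⟨v, hv⟩, 0)) = (⟨v, hv⟩, 0)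
    simp only [bf]
    split_ifs with h h'
    · simp [bi, h']
    · have : v = m - 1 := by omega
      subst this
      have : 0 < m := by omega
      simp [bi, this]
    · simp only [bi]
      rw [dif_pos (by constructor <;> omega)]
      have : v - 1 + 1 = v := by omega
      simp [this]
  · show bi n m hm hmn (bf n m hmn (⟨v, hv⟩, 1)) = (⟨v, hv⟩, 1)
    simp only [bf]
    split_ifs with h
    · simp only [bi]
      rw [if_neg (by omega)]
      simp
    · simp only [bi]
      rw [dif_neg h]
  · rfl

lemma bf_bi (x : Fin n × Fin 3) : bf n m hmn (bi n m hm hmn x) = x := by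
  obtain ⟨⟨v, hv⟩, k⟩ := x
  fin_cases k
  · show bf n m hmn (bi n m hm hmn (⟨v, hv⟩, 0)) = (⟨v, hv⟩, 0)
    simp only [bi]
    split_ifs with h h'
    · simp only [bf]
      rw [dif_pos (by omega), dif_neg (by omega)]
      simp [h']
    · simp only [bf]
      rw [dif_pos (by omega), dif_pos (by omega)]
      have : v - 1 + 1 = v := by omega
      simp [this]
    · simp only [bf]
      rw [dif_pos (by constructor <;> omega)]
      have : v - 1 + 1 = v := by omega
      simp [this]
  · show bf n m hmn (bi n m hm hmn (⟨v, hv⟩, 1)) = (⟨v, hv⟩, 1)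
    simp only [bi]
    split_ifs with h
    · simp only [bf]
      rw [dif_neg (by omega)]
      simp
    · simp only [bf]
      rw [dif_neg h]
  · rfl

/-- the permutation -/
def be : Equiv.Perm (Fin n × Fin 3) := ⟨bf n m hmn, bi n m hm hmn, bi_bf n m hm hmn, bf_bi n m hm hmn⟩

/-- the quiver -/
def Q0 : QuiverData := ⟨Fin n, Fin n × Fin 3, fun a => ((be n m hm hmn).symm a).1, fun a => a.1⟩

/-- the rotation -/
def rot3 : Equiv.Perm (Fin n × Fin 3) := Equiv.prodCongr (Equiv.refl _) (Equiv.addRight 1)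

lemma bal0 (r : Fin n × Fin 3 → ℕ)
    (h : ∀ v : Fin n, ∑ a : Fin n × Fin 3, (if a.1 = v then r a else 0) =
      ∑ a : Fin n × Fin 3, if ((be n m hm hmn).symm a).1 = v then r a else 0) (v : Fin n) :
    r (v, 0) + r (v, 1) = r (bf n m hmn (v, 0)) + r (bf n m hmn (v, 1)) := by
  have aux : ∀ r : Fin n × Fin 3 → ℕ, ∑ a : Fin n × Fin 3, (if a.1 = v then r a else 0) =
      r (v, 0) + r (v, 1) + r (v, 2) := by
    intro r
    rw [Fintype.sum_prod_type, Finset.sum_eq_single v]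
    · simp [Fin.sum_univ_three]
    · intro b _ hb; simp [hb]
    · simp
  have h1 := h v
  rw [aux, ← Equiv.sum_comp (be n m hm hmn)] at h1
  simp only [Equiv.symm_apply_apply] at h1
  rw [aux (fun a => r (be n m hm hmn a))] at h1
  have h2 : (be n m hm hmn (v, 2)) = (v, 2) := rfl
  have h3 : (be n m hm hmn (v, 0)) = bf n m hmn (v, 0) := rfl
  have h4 : (be n m hm hmn (v, 1)) = bf n m hmn (v, 1) := rfl
  rw [h2, h3, h4] at h1
  omega

lemma bf0_lt {v : ℕ} (hv : v < n) (h : v + 1 < m) :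
    bf n m hmn (⟨v, hv⟩, 0) = (⟨v + 1, lt_of_lt_of_le h hmn⟩, 0) := by
  simp only [bf]; rw [dif_pos (by omega), dif_pos h]

lemma bf0_eq {v : ℕ} (hv : v < n) (h : v + 1 = m) :
    bf n m hmn (⟨v, hv⟩, 0) = (⟨0, by omega⟩, 0) := by
  simp only [bf]; rw [dif_pos (by omega), dif_neg (by omega)]

lemma bf0_ge {v : ℕ} (hv : v < n) (h : m ≤ v) :
    bf n m hmn (⟨v, hv⟩, 0) = (⟨v - 1, lt_of_le_of_lt (Nat.sub_le _ _) hv⟩, 1) := by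
  simp only [bf]; rw [dif_neg (by omega)]

lemma bf1_pos {v : ℕ} (hv : v < n) (h : m ≤ v + 1) (h' : v + 1 < n) :
    bf n m hmn (⟨v, hv⟩, 1) = (⟨v + 1, h'⟩, 0) := by
  simp only [bf]; rw [dif_pos ⟨h, h'⟩]

lemma bf1_neg {v : ℕ} (hv : v < n) (h : ¬ (m ≤ v + 1 ∧ v + 1 < n)) :
    bf n m hmn (⟨v, hv⟩, 1) = (⟨v, hv⟩, 1) := by
  simp only [bf]; rw [dif_neg h]

lemma bal_link (r : Fin n × Fin 3 → ℕ)
    (h : ∀ v : Fin n, r (v, 0) + r (v, 1) = r (bf n m hmn (v, 0)) + r (bf n m hmn (v, 1))) :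
    ∀ (j v : ℕ) (hv : v < n), m ≤ v → n - v = j + 1 → r (⟨v, hv⟩, 0) = r (⟨v - 1, lt_of_le_of_lt (Nat.sub_le _ _) hv⟩, 1) := by
  intro j
  induction j with
  | zero =>
    intro v hv hmv hj
    have := h ⟨v, hv⟩
    rw [bf0_ge n m hmn hv hmv, bf1_neg n m hmn hv (by omega)] at this
    omega
  | succ j ih =>
    intro v hv hmv hj
    have h1 := h ⟨v, hv⟩
    have h2 := ih (v + 1) (by omega) (by omega) (by omega)
    rw [bf0_ge n m hmn hv hmv, bf1_pos n m hmn hv (by omega) (by omega)] at h1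
    simp only [Nat.add_sub_cancel] at h2
    omega

lemma bal_be (r : Fin n × Fin 3 → ℕ)
    (h : ∀ v : Fin n, r (v, 0) + r (v, 1) = r (bf n m hmn (v, 0)) + r (bf n m hmn (v, 1)))
    (t : Fin n × Fin 3) : r (bf n m hmn t) = r t := by
  have L : ∀ (v : ℕ) (hv : v < n), m ≤ v → r (⟨v, hv⟩, 0) = r (⟨v - 1, lt_of_le_of_lt (Nat.sub_le _ _) hv⟩, 1) :=
    fun v hv hmv => bal_link n m hmn r h (n - v - 1) v hv hmv (by omega)
  have h1 : ∀ v, r (bf n m hmn (v, 1)) = r (v, 1) := by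
    rintro ⟨v, hv⟩
    by_cases hc : m ≤ v + 1 ∧ v + 1 < n
    · rw [bf1_pos n m hmn hv hc.1 hc.2, L _ _ hc.1]; rfl
    · rw [bf1_neg n m hmn hv hc]
  obtain ⟨v, k⟩ := t
  fin_cases k
  · have := h v
    rw [h1] at this
    show r (bf n m hmn (v, 0)) = r (v, 0)
    omega
  · exact h1 v
  · rfl

lemma const_all (r : Fin n × Fin 3 → ℕ) (h : ∀ t, r (bf n m hmn t) = r t)
    (hc : ∀ v, r (v, 0) = r (v, 1) ∧ r (v, 0) = r (v, 2)) (hn : 0 < n) :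
    ∀ t, r t = r (⟨0, hn⟩, 0) := by
  have key : ∀ (v : ℕ) (hv : v < n), r (⟨v, hv⟩, 0) = r (⟨0, hn⟩, 0) := by
    intro v
    induction v with
    | zero => intro _; rfl
    | succ v ih =>
      intro hv
      rw [← ih (by omega)]
      by_cases hvm : v + 1 < m
      · rw [← h (⟨v, by omega⟩, 0), bf0_lt n m hmn _ hvm]
      · rw [(hc ⟨v, by omega⟩).1, ← h (⟨v, by omega⟩, 1), bf1_pos n m hmn _ (by omega) hv]
  rintro ⟨⟨v, hv⟩, k⟩
  rw [← key v hv]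
  fin_cases k
  · rfl
  · exact (hc _).1.symm
  · exact (hc _).2.symm

end quiver0

/-- integer matrices -/
def SI : Fin 3 → Fin 2 → Fin 2 → ℤ
  | 0, i, j => if i = j then (if i = 0 then 1 else -1) else 0
  | 1, i, j => if i = j then 0 else 1
  | 2, i, j => if i = j then 0 else (if i = 0 then 1 else -1)

/-- inverses -/
def SJ : Fin 3 → Fin 2 → Fin 2 → ℤ
  | 0, i, j => if i = j then (if i = 0 then 1 else -1) else 0
  | 1, i, j => if i = j then 0 else 1
  | 2, i, j => if i = j then 0 else (if i = 0 then -1 else 1)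

lemma SJ_SI : ∀ i a b, ∑ x, SJ i a x * SI i x b = if a = b then 1 else 0 := by decide

lemma SI_conj : ∀ i k a b, ∑ x, ∑ y, SI i a x * SI k y x * SJ i y b =
    (if k = i then 1 else -1) * SI k b a := by decide

lemma SI_sum : ∑ x : Fin 3 → Fin 2, ∏ k, SI k (x k) (x (k - 1)) = 2 := by decide

lemma sign_choice : ∀ b : Fin 3 → Bool, ¬ (b 0 = b 1 ∧ b 0 = b 2) →
    ∃ i : Fin 3, ∏ k, (if b k = true then (if k = i then 1 else -1) else 1 : ℤ) = -1 := by decide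

end QInv


namespace QInv
open MvPolynomial

section lower
variable {K : Type} [Field K] (n m : ℕ) (hm : 2 ≤ m) (hmn : m ≤ n)

/-- matrices over K -/
def GI (K : Type) [Field K] (i : Fin 3) : Matrix (Fin 2) (Fin 2) K := fun a b => (SI i a b : K)
/-- inverse matrices over K -/
def GJ (K : Type) [Field K] (i : Fin 3) : Matrix (Fin 2) (Fin 2) K := fun a b => (SJ i a b : K)

lemma GJ_GI (i : Fin 3) : GJ K i * GI K i = 1 := by
  ext a b
  rw [Matrix.mul_apply, Matrix.one_apply]
  have := congrArg (Int.cast : ℤ → K) (SJ_SI i a b)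
  push_cast at this
  exact this

lemma GI_inv (i : Fin 3) : (GI K i)⁻¹ = GJ K i := Matrix.inv_eq_left_inv (GJ_GI i)

lemma GI_unit (i : Fin 3) : IsUnit (GI K i).det := by
  have := congrArg Matrix.det (GJ_GI (K := K) i)
  rw [Matrix.det_mul, Matrix.det_one] at this
  exact IsUnit.of_mul_eq_one_right _ this

lemma GI_conj (i k : Fin 3) (a b : Fin 2) :
    ∑ x, ∑ y, GI K i a x * (SI k y x : K) * GJ K i y b =
      (if k = i then 1 else -1 : K) * (SI k b a : K) := by
  have := congrArg (Int.cast : ℤ → K) (SI_conj i k a b)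
  push_cast at this
  exact this

/-- the functional for our quiver -/
noncomputable def lam0 (F : MvPolynomial ((Fin n × Fin 3) × Fin 2 × Fin 2) K) : K :=
  lam (Wt (be n m hm hmn) fun t i j => (SI t.2 i j : K)) F

lemma lam0_core (h2 : (2 : K) ≠ 0) {p q : MvPolynomial ((Fin n × Fin 3) × Fin 2 × Fin 2) K}
    (hp : (Q0 n m hm hmn).IsInvariant K p) {r r' : Fin n × Fin 3 → ℕ}
    (hq : MH Prod.fst q r') (hpr : MH Prod.fst p r) (hrr : r + r' = 1)
    (hbe : ∀ t, r (be n m hm hmn t) = r t) (v : Fin n)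
    (hv : ¬ (r (v, 0) = r (v, 1) ∧ r (v, 0) = r (v, 2))) : lam0 n m hm hmn (p * q) = 0 := by
  have hr1 : ∀ t, r t + r' t = 1 := fun t => congrFun hrr t
  obtain ⟨i, hi⟩ := sign_choice (fun k => decide (r (v, k) ≠ 0)) (by
    intro hc
    apply hv
    have a0 := hr1 (v, 0)
    have a1 := hr1 (v, 1)
    have a2 := hr1 (v, 2)
    simp only [decide_eq_decide] at hc
    omega)
  let g : Fin n → Matrix (Fin 2) (Fin 2) K := fun w => if w = v then GI K i else 1
  have hg : ∀ w, IsUnit (g w).det := by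
    intro w
    by_cases hw : w = v
    · simp only [g, if_pos hw]; exact GI_unit i
    · simp only [g, if_neg hw, Matrix.det_one, isUnit_one]
  let src : Fin n × Fin 3 → Fin n := fun t => ((be n m hm hmn).symm t).1
  let G : Fin n × Fin 3 → Matrix (Fin 2) (Fin 2) K := fun t => if r t ≠ 0 then g t.1 else 1
  let G' : Fin n × Fin 3 → Matrix (Fin 2) (Fin 2) K := fun t => if r t ≠ 0 then (g (src t))⁻¹ else 1
  let ε : Fin n × Fin 3 → K := fun t => if t.1 = v then
    (if r t ≠ 0 then (if t.2 = i then 1 else -1) else 1) else 1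
  have one : ∀ (k : Fin 3) (a b : Fin 2), ∑ x, ∑ y, (1 : Matrix (Fin 2) (Fin 2) K) a x *
      (SI k y x : K) * (1 : Matrix (Fin 2) (Fin 2) K) y b = 1 * (SI k b a : K) := by
    intro k a b
    simp [Matrix.one_apply]
  have hS := lam_subst (be n m hm hmn) (fun t i j => (SI t.2 i j : K)) G G' ε (by
    intro t a b
    simp only [G, G', ε, hbe]
    by_cases hr : r t ≠ 0
    · simp only [if_pos hr, src, Equiv.symm_apply_apply]
      by_cases htv : t.1 = v
      · simp only [g, if_pos htv, GI_inv]
        exact GI_conj i t.2 a b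
      · simp only [g, if_neg htv, inv_one]
        exact one _ _ _
    · simp only [if_neg hr, ite_self]
      exact one _ _ _) (F := p * q) (by rw [← hrr]; exact IsWeightedHomogeneous.mul hpr hq)
  have hε : ∏ t, ε t = -1 := by
    rw [Fintype.prod_prod_type, Finset.prod_eq_single v]
    · have := congrArg (Int.cast : ℤ → K) hi
      push_cast at this
      rw [← this]
      refine Finset.prod_congr rfl fun k _ => ?_
      simp [ε]
    · intro w _ hw
      simp [ε, hw]
    · simp
  have e1 : aeval (fun v : (Fin n × Fin 3) × Fin 2 × Fin 2 => ∑ k, ∑ l,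
      (C (G v.1 v.2.1 k * G' v.1 l v.2.2) * X (v.1, k, l) :
        MvPolynomial ((Fin n × Fin 3) × Fin 2 × Fin 2) K)) p = p := by
    have h3 := (inv_iff (Q0 n m hm hmn) p).1 hp g hg
    refine Eq.trans ?_ h3
    refine hpr.congr fun x hx => ?_
    have hx' : r x.1 ≠ 0 := hx
    simp only [G, G', if_pos hx']
    rfl
  have e2 : aeval (fun v : (Fin n × Fin 3) × Fin 2 × Fin 2 => ∑ k, ∑ l,
      (C (G v.1 v.2.1 k * G' v.1 l v.2.2) * X (v.1, k, l) :
        MvPolynomial ((Fin n × Fin 3) × Fin 2 × Fin 2) K)) q = q := by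
    refine Eq.trans ?_ (aeval_X_left_apply q)
    refine hq.congr fun x hx => ?_
    have hx' : ¬ (r x.1 ≠ 0) := by
      have := hr1 x.1
      have : r' x.1 ≠ 0 := hx
      omega
    simp only [G, G', if_neg hx']
    obtain ⟨a, i, j⟩ := x
    fin_cases i <;> fin_cases j <;> simp [Matrix.one_apply]
  rw [map_mul, e1, e2, hε] at hS
  have h4 : lam0 n m hm hmn (p * q) = -1 * lam0 n m hm hmn (p * q) := hS
  have h5 : 2 * lam0 n m hm hmn (p * q) = 0 := by linear_combination h4
  exact (mul_eq_zero.1 h5).resolve_left h2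

lemma zero_of_MH_zero {σ : Type} {L : Type} {lt : σ → L} {f : MvPolynomial σ K} (h : MH lt f 0)
    (hc : coeff 0 f = 0) : f = 0 := by
  rw [h.eq_C, hc, C_0]

lemma coeff_zero_comp {σ : Type} {L : Type} (lt : σ → L) (r : L → ℕ) {f : MvPolynomial σ K}
    (hc : coeff 0 f = 0) : coeff 0 (comp lt r f) = 0 := by
  unfold comp
  rw [coeff_weightedHomogeneousComponent]
  split_ifs
  · exact hc
  · rfl

lemma lam0_mul [Infinite K] (h2 : (2 : K) ≠ 0)
    {p q : MvPolynomial ((Fin n × Fin 3) × Fin 2 × Fin 2) K}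
    (hp : p ∈ (Q0 n m hm hmn).PlusSet K) (hq : q ∈ (Q0 n m hm hmn).PlusSet K) :
    lam0 n m hm hmn (p * q) = 0 := by
  have hp0 : coeff 0 p = 0 := hp.2
  have hq0 : coeff 0 q = 0 := hq.2
  let lt : (Fin n × Fin 3) × Fin 2 × Fin 2 → Fin n × Fin 3 := Prod.fst
  obtain ⟨S, hS⟩ := exists_sum_comp lt p
  obtain ⟨S', hS'⟩ := exists_sum_comp lt q
  have hpq : p * q = ∑ r ∈ S, ∑ r' ∈ S', comp lt r p * comp lt r' q := by
    rw [← Finset.sum_mul_sum, ← hS, ← hS']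
  rw [hpq]
  unfold lam0
  rw [lam_sum]
  refine Finset.sum_eq_zero fun r _ => ?_
  rw [lam_sum]
  refine Finset.sum_eq_zero fun r' _ => ?_
  by_cases h0 : comp lt r p = 0
  · rw [h0, zero_mul, lam_zero]
  by_cases h0' : comp lt r' q = 0
  · rw [h0', mul_zero, lam_zero]
  by_cases hrr : r + r' = 1
  swap
  · exact lam_of_ne _ (IsWeightedHomogeneous.mul (comp_MH lt r p) (comp_MH lt r' q)) hrr
  let inst : Fintype (Q0 n m hm hmn).A := instFintypeProd (Fin n) (Fin 3)
  have hpi : (Q0 n m hm hmn).IsInvariant K (comp lt r p) := comp_inv (Q0 n m hm hmn) hp.1 r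
  have hbal := balance (Q0 n m hm hmn) hpi h0 (comp_MH lt r p)
  have hb1 := bal0 n m hm hmn r (fun v => by
    have h' : (∑ a : Fin n × Fin 3, @ite _ (a.1 = v) (Classical.propDecidable _) (r a) 0) =
      ∑ a : Fin n × Fin 3, @ite _ (((be n m hm hmn).symm a).1 = v) (Classical.propDecidable _)
        (r a) 0 := hbal v
    convert h')
  have hb2 := bal_be n m hmn r hb1
  by_cases hc : ∀ v, r (v, 0) = r (v, 1) ∧ r (v, 0) = r (v, 2)
  · exfalso
    have hn : 0 < n := by omega
    have hall := const_all n m hmn r hb2 hc hn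
    have h1 : r (⟨0, hn⟩, 0) + r' (⟨0, hn⟩, 0) = 1 := congrFun hrr _
    by_cases hz : r (⟨0, hn⟩, 0) = 0
    · have : r = 0 := by funext t; rw [hall t, hz]; rfl
      subst this
      exact h0 (zero_of_MH_zero (comp_MH lt 0 p) (coeff_zero_comp lt _ hp0))
    · have : r' = 0 := by
        funext t
        have h3 : r t + r' t = 1 := congrFun hrr t
        have h4 := hall t
        show r' t = 0
        omega
      subst this
      exact h0' (zero_of_MH_zero (comp_MH lt 0 q) (coeff_zero_comp lt _ hq0))
  · push Not at hc
    obtain ⟨v, hv⟩ := hc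
    exact lam0_core n m hm hmn h2 hpi (comp_MH lt r' q) (comp_MH lt r p) hrr hb2 v
      (fun h => hv h.1 h.2)

/-- the indecomposable invariant -/
noncomputable def f0 (K : Type) [Field K] : MvPolynomial ((Fin n × Fin 3) × Fin 2 × Fin 2) K :=
  ∑ u : Fin n × Fin 3 → Fin 2, ∏ t, X (t, u (be n m hm hmn ((rot3 n).symm t)), u t)

lemma lam0_f0 : lam0 n m hm hmn (f0 n m hm hmn K) = 2 ^ n := by
  unfold lam0 f0
  rw [lam_sum]
  have : ∀ u : Fin n × Fin 3 → Fin 2, lam (Wt (be n m hm hmn) fun t i j => (SI t.2 i j : K))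
      (∏ t, X (t, u (be n m hm hmn ((rot3 n).symm t)), u t)) =
      ∏ t, (SI t.2 (u (be n m hm hmn t)) (u (be n m hm hmn ((rot3 n).symm t))) : K) := by
    intro u
    exact lam_prod _ (fun t => (u (be n m hm hmn ((rot3 n).symm t)), u t))
  simp only [this]
  refine (Fintype.sum_equiv (Equiv.arrowCongr (be n m hm hmn).symm (Equiv.refl (Fin 2))) _
    (fun x : Fin n × Fin 3 → Fin 2 => ∏ t, (SI t.2 (x t) (x ((rot3 n).symm t)) : K)) ?_).trans ?_
  · intro u
    rfl
  refine (Fintype.sum_equiv (Equiv.curry (Fin n) (Fin 3) (Fin 2)) _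
    (fun x : Fin n → Fin 3 → Fin 2 => ∏ v, ∏ k, (SI k (x v k) (x v (k - 1)) : K)) ?_).trans ?_
  · intro x
    rw [Fintype.prod_prod_type]
    rfl
  rw [← Fintype.prod_sum (fun (_ : Fin n) (y : Fin 3 → Fin 2) => ∏ k, (SI k (y k) (y (k - 1)) : K))]
  have h := congrArg (Int.cast : ℤ → K) SI_sum
  push_cast at h
  rw [h]
  simp

lemma not_dec0 [Infinite K] (h2 : (2 : K) ≠ 0) :
    ¬ (Q0 n m hm hmn).Decomposable K (f0 n m hm hmn K) := by
  intro h
  have key : ∀ F : MvPolynomial (Q0 n m hm hmn).Var K,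
      F ∈ DS (Q0 n m hm hmn) K → lam0 n m hm hmn F = 0 := by
    intro F hF
    refine Submodule.span_induction (p := fun (F : MvPolynomial (Q0 n m hm hmn).Var K) _ => lam0 n m hm hmn F = 0) ?_ ?_ ?_ ?_ hF
    · rintro x ⟨p, hp, q, hq, rfl⟩
      exact lam0_mul n m hm hmn h2 hp hq
    · exact lam_zero _
    · intro x y _ _ hx hy
      refine (lam_add _ _ _).trans ?_
      show lam0 n m hm hmn x + lam0 n m hm hmn y = 0
      rw [hx, hy, add_zero]
    · intro c x _ hx
      refine (lam_smul _ _ _).trans ?_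
      show c * lam0 n m hm hmn x = 0
      rw [hx, mul_zero]
  have h1 := key _ h
  rw [lam0_f0] at h1
  exact pow_ne_zero n h2 h1

end lower
end QInv


namespace QInv
open MvPolynomial

section restrict
variable {K : Type} [Field K] {V A A' : Type} (s t : A → V) (s' t' : A' → V) (pr : A → Option A')

/-- restriction to a subquiver -/
noncomputable def RR (K : Type) [Field K] (v : A × Fin 2 × Fin 2) : MvPolynomial (A' × Fin 2 × Fin 2) K :=
  match pr v.1 with
  | some b => X (b, v.2)
  | none => 0

lemma RR_inv (hs : ∀ a b, pr a = some b → s a = s' b) (ht : ∀ a b, pr a = some b → t a = t' b)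
    {f : MvPolynomial (A × Fin 2 × Fin 2) K} (hf : (QuiverData.mk V A s t).IsInvariant K f) :
    (QuiverData.mk V A' s' t').IsInvariant K (aeval (RR pr K) f) := by
  intro g hg
  have h1 := (inv_iff (QuiverData.mk V A s t) f).1 hf g hg
  show aeval (qact (QuiverData.mk V A' s' t') g) (aeval (RR pr K) f) = aeval (RR pr K) f
  conv_rhs => rw [← h1]
  refine (aeval_aeval _ _ _).trans ?_
  refine Eq.trans ?_ (aeval_aeval _ _ _).symm
  congr 2
  funext v
  obtain ⟨a, i, j⟩ := v
  unfold qact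
  simp only [map_sum, map_mul, aeval_C, algebraMap_eq, aeval_X]
  cases hp : pr a with
  | none => simp [RR, hp]
  | some b =>
    simp only [RR, hp, aeval_X]
    simp only [hs a b hp, ht a b hp, ← C_mul]

lemma RR_plus (hs : ∀ a b, pr a = some b → s a = s' b) (ht : ∀ a b, pr a = some b → t a = t' b)
    {f : MvPolynomial (A × Fin 2 × Fin 2) K} (hf : f ∈ (QuiverData.mk V A s t).PlusSet K) :
    aeval (RR pr K) f ∈ (QuiverData.mk V A' s' t').PlusSet K := by
  refine ⟨RR_inv s t s' t' pr hs ht hf.1, ?_⟩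
  have h1 : constantCoeff f = 0 := hf.2
  have h2 : ∀ f : MvPolynomial (A × Fin 2 × Fin 2) K,
      constantCoeff (aeval (RR pr K) f : MvPolynomial (A' × Fin 2 × Fin 2) K) = constantCoeff f := by
    intro f
    induction f using MvPolynomial.induction_on with
    | C c => simp
    | add p q hp hq => simp only [map_add, hp, hq]
    | mul_X p v hp =>
      simp only [map_mul, hp, aeval_X, constantCoeff_X, mul_zero]
      unfold RR
      cases pr v.1 <;> simp
  exact (h2 f).trans h1

lemma RR_dec (hs : ∀ a b, pr a = some b → s a = s' b) (ht : ∀ a b, pr a = some b → t a = t' b)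
    {f : MvPolynomial (A × Fin 2 × Fin 2) K} (hf : (QuiverData.mk V A s t).Decomposable K f) :
    (QuiverData.mk V A' s' t').Decomposable K (aeval (RR pr K) f) := by
  refine Submodule.span_induction (p := fun (F : MvPolynomial (A × Fin 2 × Fin 2) K) _ =>
    (QuiverData.mk V A' s' t').Decomposable K (aeval (RR pr K) F)) ?_ ?_ ?_ ?_ hf
  · rintro x ⟨p, hp, q, hq, rfl⟩
    have e : aeval (RR pr K) (p * q) = aeval (RR pr K) p * aeval (RR pr K) q := map_mul _ _ _
    have := DS_mul (QuiverData.mk V A' s' t') (RR_plus s t s' t' pr hs ht hp) (RR_plus s t s' t' pr hs ht hq)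
    show aeval (RR pr K) (p * q) ∈ _
    exact e ▸ this
  · show aeval (RR pr K) 0 ∈ DS (QuiverData.mk V A' s' t') K
    rw [map_zero]
    exact Submodule.zero_mem _
  · intro x y _ _ hx hy
    show aeval (RR pr K) (x + y) ∈ DS (QuiverData.mk V A' s' t') K
    rw [map_add]
    exact Submodule.add_mem _ hx hy
  · intro c x _ hx
    show aeval (RR pr K) (c • x) ∈ DS (QuiverData.mk V A' s' t') K
    rw [map_smul]
    exact Submodule.smul_mem _ _ hx

end restrict

section q1
variable (n m d : ℕ) (hm : 2 ≤ m) (hmn : m ≤ n) (hd : n * 3 ≤ d)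

/-- the partial projection of arrows -/
def prT (a : Fin d) : Option (Fin n × Fin 3) :=
  if h : a.1 < n * 3 then some (finProdFinEquiv.symm ⟨a.1, h⟩) else none

/-- the inclusion of arrows -/
def ioT (x : Fin n × Fin 3) : Fin d := Fin.castLE hd (finProdFinEquiv x)

lemma prT_ioT (x : Fin n × Fin 3) : prT n d (ioT n d hd x) = some x := by
  unfold prT
  have h : (ioT n d hd x).1 < n * 3 := (finProdFinEquiv x).2
  rw [dif_pos h]
  have : (⟨(ioT n d hd x).1, h⟩ : Fin (n * 3)) = finProdFinEquiv x := rfl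
  rw [this, Equiv.symm_apply_apply]

/-- source -/
def s1 (a : Fin d) : Fin n :=
  match prT n d a with
  | some x => ((be n m hm hmn).symm x).1
  | none => ⟨0, by omega⟩

/-- target -/
def t1 (a : Fin d) : Fin n :=
  match prT n d a with
  | some x => x.1
  | none => ⟨0, by omega⟩

lemma s1_some (a : Fin d) (x) (h : prT n d a = some x) :
    s1 n m d hm hmn a = ((be n m hm hmn).symm x).1 := by
  unfold s1; rw [h]

lemma t1_some (a : Fin d) (x) (h : prT n d a = some x) : t1 n m d hm hmn a = x.1 := by
  unfold t1; rw [h]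

/-- the big quiver -/
abbrev Q1 : QuiverData := ⟨Fin n, Fin d, s1 n m d hm hmn, t1 n m d hm hmn⟩

/-- the permutation of the invariant -/
def pi0 : Equiv.Perm (Fin n × Fin 3) := (rot3 n).symm.trans (be n m hm hmn)

/-- the invariant -/
noncomputable def f1 (K : Type) [Field K] : MvPolynomial (Fin d × Fin 2 × Fin 2) K :=
  ∑ u : Fin n × Fin 3 → Fin 2, ∏ t, X (ioT n d hd t, u (pi0 n m hm hmn t), u t)

variable {K : Type} [Field K]

lemma f1_hom : (f1 n m d hm hmn hd K).IsHomogeneous (3 * n) := by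
  unfold f1
  refine IsHomogeneous.sum _ _ _ fun u _ => ?_
  have := IsHomogeneous.prod (R := K) (Finset.univ : Finset (Fin n × Fin 3))
    (fun t => (X (ioT n d hd t, u (pi0 n m hm hmn t), u t) : MvPolynomial (Fin d × Fin 2 × Fin 2) K))
    (fun _ => 1) (fun t _ => isHomogeneous_X _ _)
  have e : ∑ _t : Fin n × Fin 3, 1 = 3 * n := by simp [mul_comm]
  rw [e] at this
  exact this

lemma f1_inv : (Q1 n m d hm hmn).IsInvariant K (f1 n m d hm hmn hd K) := by
  obtain ⟨L, hL, _, he⟩ := tp_paths (Q1 n m d hm hmn) K (Fin n × Fin 3)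
    (fun x => ((be n m hm hmn).symm x).1) (pi0 n m hm hmn) (fun x => [ioT n d hd x])
    (fun x => List.cons_ne_nil _ _) (fun x => by
      refine ⟨s1_some n m d hm hmn _ _ (prT_ioT n d hd x), ?_⟩
      show t1 n m d hm hmn _ = _
      rw [t1_some n m d hm hmn _ _ (prT_ioT n d hd x)]
      simp [pi0, rot3])
  have e : f1 n m d hm hmn hd K = tp (fun x => (Q1 n m d hm hmn).pathMat K [ioT n d hd x]) (pi0 n m hm hmn) := by
    rw [tp_eq]
    unfold f1
    refine Finset.sum_congr rfl fun u _ => Finset.prod_congr rfl fun t _ => ?_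
    rw [pathMat_singleton]
    rfl
  have e2 := e.trans he
  intro g hg
  have key : ∀ L : List (List (Fin d)), (∀ x ∈ L, (Q1 n m d hm hmn).IsClosed x) →
      aeval ((Q1 n m d hm hmn).actVar K g) (L.map ((Q1 n m d hm hmn).pathTr K)).prod =
        (L.map ((Q1 n m d hm hmn).pathTr K)).prod := by
    intro L hL
    induction L with
    | nil => simp
    | cons x L ih =>
      rw [List.map_cons, List.prod_cons, map_mul, ih (fun y hy => hL y (List.mem_cons_of_mem _ hy)),
        pathTr_inv _ (hL x List.mem_cons_self) g hg]
  have h3 := key L hL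
  exact (congrArg (aeval ((Q1 n m d hm hmn).actVar K g)) e2).trans (h3.trans e2.symm)

lemma f1_restrict : aeval (RR (prT n d) K) (f1 n m d hm hmn hd K) = f0 n m hm hmn K := by
  unfold f1 f0
  rw [map_sum]
  refine Finset.sum_congr rfl fun u _ => ?_
  rw [map_prod]
  refine Finset.prod_congr rfl fun t _ => ?_
  rw [aeval_X]
  unfold RR
  simp only [prT_ioT]
  rfl

lemma f1_not_dec [Infinite K] (h2 : (2 : K) ≠ 0) :
    ¬ (Q1 n m d hm hmn).Decomposable K (f1 n m d hm hmn hd K) := by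
  intro h
  have h1 := RR_dec _ _ (fun x => ((be n m hm hmn).symm x).1) (fun x : Fin n × Fin 3 => x.1) (prT n d)
    (s1_some n m d hm hmn) (t1_some n m d hm hmn) h
  rw [f1_restrict] at h1
  exact not_dec0 n m hm hmn h2 h1

lemma Dnum_Q1 (hd : n * 3 ≤ d) [Infinite K] (h2 : (2 : K) ≠ 0) : (Q1 n m d hm hmn).Dnum K = 3 * n := by
  have hle := Dnum_le (K := K) (⟨Fin n, Fin d, s1 n m d hm hmn, t1 n m d hm hmn⟩ : QuiverData) h2
  have hc : Fintype.card (QuiverData.V ⟨Fin n, Fin d, s1 n m d hm hmn, t1 n m d hm hmn⟩) = n :=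
    Fintype.card_fin n
  rw [hc] at hle
  refine le_antisymm (csSup_le' hle) ?_
  exact le_csSup ⟨3 * n, hle⟩ ⟨f1 n m d hm hmn hd K, f1_inv n m d hm hmn hd, f1_hom n m d hm hmn hd,
    f1_not_dec n m d hm hmn hd h2⟩

lemma Dnum_le' [Infinite K] (h2 : (2 : K) ≠ 0) (s t : Fin d → Fin n) :
    (QuiverData.mk (Fin n) (Fin d) s t).Dnum K ≤ 3 * n := by
  have hle := Dnum_le (K := K) (⟨Fin n, Fin d, s, t⟩ : QuiverData) h2
  have hc : Fintype.card (QuiverData.V ⟨Fin n, Fin d, s, t⟩) = n := Fintype.card_fin n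
  rw [hc] at hle
  exact csSup_le' hle

end q1
end QInv


namespace QInv

section arrows
variable (n m d : ℕ) (hm : 2 ≤ m) (hmn : m ≤ n) (hd : n * 3 ≤ d)

lemma arr_of_be (x y : Fin n × Fin 3) (h : bf n m hmn x = y) (hd : n * 3 ≤ d) :
    ∃ a, s1 n m d hm hmn a = x.1 ∧ t1 n m d hm hmn a = y.1 := by
  refine ⟨ioT n d hd y, ?_, t1_some n m d hm hmn _ _ (prT_ioT n d hd y)⟩
  rw [s1_some n m d hm hmn _ _ (prT_ioT n d hd y)]
  have : be n m hm hmn x = y := h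
  rw [← this, Equiv.symm_apply_apply]

lemma arr_loop (hd : n * 3 ≤ d) (v : Fin n) : ∃ a, s1 n m d hm hmn a = v ∧ t1 n m d hm hmn a = v :=
  arr_of_be n m d hm hmn (v, 2) (v, 2) rfl hd

lemma arr_up (hd : n * 3 ≤ d) {v : ℕ} (hv : v + 1 < n) : ∃ a, s1 n m d hm hmn a = ⟨v, by omega⟩ ∧
    t1 n m d hm hmn a = ⟨v + 1, hv⟩ := by
  by_cases h : v + 1 < m
  · exact arr_of_be n m d hm hmn _ _ (bf0_lt n m hmn (by omega) h) hd
  · exact arr_of_be n m d hm hmn _ _ (bf1_pos n m hmn (by omega) (by omega) hv) hd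

lemma arr_back (hd : n * 3 ≤ d) : ∃ a, s1 n m d hm hmn a = ⟨m - 1, by omega⟩ ∧
    t1 n m d hm hmn a = ⟨0, by omega⟩ :=
  arr_of_be n m d hm hmn _ _ (bf0_eq n m hm hmn (by omega) (by omega)) hd

lemma arr_down (hd : n * 3 ≤ d) {v : ℕ} (hv : v + 1 < n) (h : m ≤ v + 1) :
    ∃ a, s1 n m d hm hmn a = ⟨v + 1, hv⟩ ∧ t1 n m d hm hmn a = ⟨v, by omega⟩ :=
  arr_of_be n m d hm hmn _ _ (bf0_ge n m hmn hv h) hd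

lemma arr_cases (a : Fin d) :
    (s1 n m d hm hmn a).1 = (t1 n m d hm hmn a).1 ∨
    (t1 n m d hm hmn a).1 = (s1 n m d hm hmn a).1 + 1 ∨
    ((s1 n m d hm hmn a).1 < m ∧ (t1 n m d hm hmn a).1 < m) ∨
    (s1 n m d hm hmn a).1 = (t1 n m d hm hmn a).1 + 1 := by
  cases h : prT n d a with
  | none =>
    left
    unfold s1 t1
    rw [h]
  | some y =>
    rw [s1_some n m d hm hmn _ _ h, t1_some n m d hm hmn _ _ h]
    generalize hx : (be n m hm hmn).symm y = x
    have hy : y = bf n m hmn x := by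
      have : be n m hm hmn x = y := by rw [← hx, Equiv.apply_symm_apply]
      exact this.symm
    rw [hy]
    obtain ⟨⟨v, hv⟩, k⟩ := x
    fin_cases k
    · show v = (bf n m hmn (⟨v, hv⟩, 0)).1.1 ∨ (bf n m hmn (⟨v, hv⟩, 0)).1.1 = v + 1 ∨
        (v < m ∧ (bf n m hmn (⟨v, hv⟩, 0)).1.1 < m) ∨ v = (bf n m hmn (⟨v, hv⟩, 0)).1.1 + 1
      by_cases h1 : v + 1 < m
      · rw [bf0_lt n m hmn hv h1]; simp
      by_cases h2 : v + 1 = m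
      · rw [bf0_eq n m hm hmn hv h2]
        right; right; left
        constructor
        · omega
        · show 0 < m
          omega
      · rw [bf0_ge n m hmn hv (by omega)]
        right; right; right
        show v = v - 1 + 1
        omega
    · show v = (bf n m hmn (⟨v, hv⟩, 1)).1.1 ∨ (bf n m hmn (⟨v, hv⟩, 1)).1.1 = v + 1 ∨
        (v < m ∧ (bf n m hmn (⟨v, hv⟩, 1)).1.1 < m) ∨ v = (bf n m hmn (⟨v, hv⟩, 1)).1.1 + 1
      by_cases h1 : m ≤ v + 1 ∧ v + 1 < n
      · rw [bf1_pos n m hmn hv h1.1 h1.2]; simp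
      · rw [bf1_neg n m hmn hv h1]; simp
    · left; rfl

end arrows

section paths
variable (Q : QuiverData)

lemma reach_trans {u v w : Q.V} (h₁ : ∃ l, Q.IsPathFrom u v l) (h₂ : ∃ l, Q.IsPathFrom v w l) :
    ∃ l, Q.IsPathFrom u w l := by
  obtain ⟨l₁, h₁⟩ := h₁
  obtain ⟨l₂, h₂⟩ := h₂
  exact ⟨_, path_append Q h₁ h₂⟩

lemma reach_arr {u v : Q.V} (h : ∃ a, Q.src a = u ∧ Q.tgt a = v) : ∃ l, Q.IsPathFrom u v l := by
  obtain ⟨a, h1, h2⟩ := h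
  exact ⟨[a], h1, h2⟩

lemma map_src_tgt : ∀ (l : List Q.A) (u v : Q.V), Q.IsPathFrom u v l →
    u :: l.map Q.tgt = l.map Q.src ++ [v]
  | [], u, v, h => by
    have : u = v := h
    simp [this]
  | a :: l, u, v, h => by
    have h2 := map_src_tgt l _ _ h.2
    simp only [List.map_cons, List.cons_append]
    rw [h2, h.1]

lemma conn_end (S : Set Q.V) : ∀ (l : List Q.A) (u v : Q.V), Q.IsPathFrom u v l →
    (∀ a ∈ l, Q.src a ∈ S → Q.tgt a ∈ S) → u ∈ S → (v ∈ S ∧ ∀ a ∈ l, Q.tgt a ∈ S)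
  | [], u, v, h, _, hu => by
    have : u = v := h
    subst this
    exact ⟨hu, by simp⟩
  | a :: l, u, v, h, hS, hu => by
    have ha : Q.tgt a ∈ S := hS a List.mem_cons_self (by rw [h.1]; exact hu)
    have h2 := conn_end S l _ _ h.2 (fun b hb => hS b (List.mem_cons_of_mem _ hb)) ha
    refine ⟨h2.1, fun b hb => ?_⟩
    rcases List.mem_cons.1 hb with rfl | hb
    · exact ha
    · exact h2.2 b hb

lemma conn_mid (S : Set Q.V) : ∀ (l : List Q.A) (u v : Q.V), Q.IsPathFrom u v l →
    (∀ a ∈ l, Q.src a ∈ S → Q.tgt a ∈ S) → (∃ a ∈ l, Q.tgt a ∈ S) → v ∈ S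
  | [], u, v, h, _, hu => by simp at hu
  | a :: l, u, v, h, hS, hu => by
    have hS' : ∀ b ∈ l, Q.src b ∈ S → Q.tgt b ∈ S := fun b hb => hS b (List.mem_cons_of_mem _ hb)
    obtain ⟨b, hb, hbS⟩ := hu
    rcases List.mem_cons.1 hb with rfl | hb
    · exact (conn_end Q S l _ _ h.2 hS' hbS).1
    · exact conn_mid S l _ _ h.2 hS' ⟨b, hb, hbS⟩

lemma conn_closed (S : Set Q.V) (l : List Q.A) (u : Q.V) (h : Q.IsPathFrom u u l)
    (hS : ∀ a ∈ l, Q.src a ∈ S → Q.tgt a ∈ S) (hu : ∃ a ∈ l, Q.tgt a ∈ S) :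
    ∀ a ∈ l, Q.tgt a ∈ S :=
  (conn_end Q S l u u h hS (conn_mid Q S l u u h hS hu)).2

lemma prim_iff (l : List Q.A) : (∀ a ∈ l, Q.vdeg l (Q.tgt a) = 1) ↔ (l.map Q.tgt).Nodup := by
  have e : l.map Q.tgt = List.ofFn fun i => Q.tgt (l.get i) := by
    conv_lhs => rw [← List.ofFn_get l, List.map_ofFn]
    rfl
  rw [e, List.nodup_ofFn]
  constructor
  · intro h i j hij
    have h1 := h (l.get j) (List.get_mem l j)
    unfold QuiverData.vdeg at h1
    have h2 := (Nat.card_eq_one_iff_unique.1 h1).1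
    have := @Subsingleton.elim _ h2 ⟨i, hij⟩ ⟨j, rfl⟩
    exact congrArg Subtype.val this
  · intro h a ha
    obtain ⟨j, rfl⟩ := List.get_of_mem ha
    unfold QuiverData.vdeg
    rw [Nat.card_eq_one_iff_unique]
    exact ⟨⟨fun x y => Subtype.ext (h (x.2.trans y.2.symm))⟩, ⟨⟨j, rfl⟩⟩⟩

lemma nodup_inj {α β : Type} (f : α → β) {l : List α} (h : (l.map f).Nodup) {a b : α} (ha : a ∈ l)
    (hb : b ∈ l) (hab : f a = f b) : a = b :=
  List.inj_on_of_nodup_map h ha hb hab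

lemma len_le {α β : Type} (f : α → β) {l : List α} (h : (l.map f).Nodup) (S : Finset β)
    (hS : ∀ a ∈ l, f a ∈ S) : l.length ≤ S.card := by
  rw [← List.length_map f, ← List.toFinset_card_of_nodup h]
  refine Finset.card_le_card fun x hx => ?_
  obtain ⟨a, ha, rfl⟩ := List.mem_map.1 (List.mem_toFinset.1 hx)
  exact hS a ha

end paths

section final
variable (n m d : ℕ) (hm : 2 ≤ m) (hmn : m ≤ n) (hd : n * 3 ≤ d)

lemma reach_from0 (hd : n * 3 ≤ d) : ∀ (v : ℕ) (hv : v < n),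
    ∃ l, (Q1 n m d hm hmn).IsPathFrom (⟨0, by omega⟩ : Fin n) (⟨v, hv⟩ : Fin n) l
  | 0, hv => ⟨[], rfl⟩
  | v + 1, hv => reach_trans (Q1 n m d hm hmn) (reach_from0 hd v (by omega))
      (reach_arr (Q1 n m d hm hmn) (arr_up n m d hm hmn hd hv))

lemma reach_to_m (hd : n * 3 ≤ d) : ∀ (j v : ℕ) (hv : v < n), v + j + 1 = m →
    ∃ l, (Q1 n m d hm hmn).IsPathFrom (⟨v, hv⟩ : Fin n) (⟨m - 1, by omega⟩ : Fin n) l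
  | 0, v, hv, h => ⟨[], Fin.ext (by show v = m - 1; omega)⟩
  | j + 1, v, hv, h => reach_trans (Q1 n m d hm hmn)
      (reach_arr (Q1 n m d hm hmn) (arr_up n m d hm hmn hd (v := v) (by omega)))
      (reach_to_m hd j (v + 1) (by omega) (by omega))

lemma reach_down (hd : n * 3 ≤ d) : ∀ (j v : ℕ) (hv : v < n), v + 1 = m + j →
    ∃ l, (Q1 n m d hm hmn).IsPathFrom (⟨v, hv⟩ : Fin n) (⟨m - 1, by omega⟩ : Fin n) l
  | 0, v, hv, h => ⟨[], Fin.ext (by show v = m - 1; omega)⟩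
  | j + 1, 0, hv, h => by omega
  | j + 1, v + 1, hv, h => reach_trans (Q1 n m d hm hmn)
      (reach_arr (Q1 n m d hm hmn) (arr_down n m d hm hmn hd (v := v) hv (by omega)))
      (reach_down hd j v (by omega) (by omega))

lemma reach_to0 (hd : n * 3 ≤ d) (v : Fin n) :
    ∃ l, (Q1 n m d hm hmn).IsPathFrom v (⟨0, by omega⟩ : Fin n) l := by
  refine reach_trans (Q1 n m d hm hmn) (v := (⟨m - 1, by omega⟩ : Fin n)) ?_
    (reach_arr (Q1 n m d hm hmn) (arr_back n m d hm hmn hd))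
  by_cases h : v.1 + 1 ≤ m
  · exact reach_to_m n m d hm hmn hd (m - v.1 - 1) v.1 v.2 (by omega)
  · exact reach_down n m d hm hmn hd (v.1 + 1 - m) v.1 v.2 (by omega)

lemma strong (hd : n * 3 ≤ d) : (Q1 n m d hm hmn).StronglyConnected := by
  left
  let z : Fin n := ⟨0, by omega⟩
  have key : ∀ k, k ≤ n → ∃ l, (Q1 n m d hm hmn).IsPathFrom z z l ∧
      ∀ w : Fin n, w.1 < k → ∃ a ∈ l, t1 n m d hm hmn a = w := by
    intro k
    induction k with
    | zero => intro _; exact ⟨[], rfl, fun w hw => absurd hw (Nat.not_lt_zero _)⟩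
    | succ k ih =>
      intro hk
      obtain ⟨l, hl, hw⟩ := ih (by omega)
      obtain ⟨l1, h1⟩ := reach_from0 n m d hm hmn hd k (by omega)
      obtain ⟨a, ha, ha'⟩ := arr_loop n m d hm hmn hd ⟨k, by omega⟩
      obtain ⟨l2, h2⟩ := reach_to0 n m d hm hmn hd ⟨k, by omega⟩
      have h3 : (Q1 n m d hm hmn).IsPathFrom (⟨k, by omega⟩ : Fin n) z (a :: l2) := by
        refine ⟨ha, ?_⟩
        have : (Q1 n m d hm hmn).tgt a = (⟨k, by omega⟩ : Fin n) := ha'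
        rw [this]; exact h2
      refine ⟨l ++ (l1 ++ a :: l2), path_append _ hl (path_append _ h1 h3), fun w hwk => ?_⟩
      by_cases hwk' : w.1 < k
      · obtain ⟨b, hb, hb'⟩ := hw w hwk'
        exact ⟨b, by simp [hb], hb'⟩
      · refine ⟨a, by simp, ha'.trans (Fin.ext ?_)⟩
        show k = w.1
        omega
  obtain ⟨l, hl, hw⟩ := key n le_rfl
  refine ⟨z, l, ⟨?_, hl⟩, fun w => hw w w.2⟩
  rintro rfl
  obtain ⟨a, ha, _⟩ := hw z z.2
  simp at ha

lemma prim_path (hd : n * 3 ≤ d) : ∀ k, (hk : k < m) → ∃ l : List (Fin d),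
    (Q1 n m d hm hmn).IsPathFrom (⟨m - 1, by omega⟩ : Fin n) (⟨k, by omega⟩ : Fin n) l ∧
    l.map (fun a => (t1 n m d hm hmn a).1) = List.range (k + 1) := by
  intro k
  induction k with
  | zero =>
    intro hk
    obtain ⟨a, h1, h2⟩ := arr_back n m d hm hmn hd
    exact ⟨[a], ⟨h1, h2⟩, by simp [h2]⟩
  | succ k ih =>
    intro hk
    obtain ⟨l, h1, h2⟩ := ih (by omega)
    obtain ⟨a, h3, h4⟩ := arr_up n m d hm hmn hd (v := k) (by omega)
    refine ⟨l ++ [a], path_append _ h1 ⟨h3, h4⟩, ?_⟩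
    rw [List.map_append, h2, List.range_succ (n := k + 1)]
    simp [h4]

lemma prim_bound (l : List (Fin d)) (u : Fin n) (hne : l ≠ [])
    (hp : (Q1 n m d hm hmn).IsPathFrom u u l) (hnd : (l.map (t1 n m d hm hmn)).Nodup) :
    l.length ≤ m := by
  have hst := map_src_tgt (Q1 n m d hm hmn) l u u hp
  have hperm : (l.map (t1 n m d hm hmn)).Perm (l.map (s1 n m d hm hmn)) := by
    have h1 : (u :: l.map (t1 n m d hm hmn)).Perm (u :: l.map (s1 n m d hm hmn)) := by
      have h2 : u :: l.map (t1 n m d hm hmn) = l.map (s1 n m d hm hmn) ++ [u] := hst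
      rw [h2]
      exact List.perm_append_singleton _ _
    exact List.Perm.cons_inv h1
  have hnds : (l.map (s1 n m d hm hmn)).Nodup := hperm.nodup_iff.1 hnd
  have hsrc : ∀ a ∈ l, ∃ b ∈ l, t1 n m d hm hmn b = s1 n m d hm hmn a := by
    intro a ha
    have : s1 n m d hm hmn a ∈ l.map (t1 n m d hm hmn) :=
      hperm.mem_iff.2 (List.mem_map_of_mem ha)
    exact List.mem_map.1 this
  have htgt : ∀ a ∈ l, ∃ b ∈ l, s1 n m d hm hmn b = t1 n m d hm hmn a := by
    intro a ha
    have : t1 n m d hm hmn a ∈ l.map (s1 n m d hm hmn) :=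
      hperm.mem_iff.1 (List.mem_map_of_mem ha)
    exact List.mem_map.1 this
  obtain ⟨a, ha, hmax⟩ : ∃ a ∈ l, ∀ b ∈ l, (t1 n m d hm hmn b).1 ≤ (t1 n m d hm hmn a).1 := by
    obtain ⟨a, ha, hmax⟩ := Finset.exists_max_image l.toFinset (fun b => (t1 n m d hm hmn b).1)
      (List.toFinset_nonempty_iff l |>.2 hne)
    exact ⟨a, List.mem_toFinset.1 ha, fun b hb => hmax b (List.mem_toFinset.2 hb)⟩
  have hsmax : ∀ b ∈ l, (s1 n m d hm hmn b).1 ≤ (t1 n m d hm hmn a).1 := by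
    intro b hb
    obtain ⟨c, hc, hcb⟩ := hsrc b hb
    rw [← hcb]; exact hmax c hc
  by_cases hw : (t1 n m d hm hmn a).1 < m
  · have hnd' : (l.map (fun b => (t1 n m d hm hmn b).1)).Nodup := by
      have := hnd.map Fin.val_injective
      rw [List.map_map] at this
      exact this
    have := len_le _ hnd' (Finset.range m)
      (fun b hb => Finset.mem_range.2 (lt_of_le_of_lt (hmax b hb) hw))
    simpa using this
  · have hsa := hsmax a ha
    have hca := arr_cases n m d hm hmn a
    by_cases hloop : (s1 n m d hm hmn a).1 = (t1 n m d hm hmn a).1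
    · have := conn_closed (Q1 n m d hm hmn) {x | x = t1 n m d hm hmn a} l u hp (by
        intro b hb hbs
        have hbs' : s1 n m d hm hmn b = t1 n m d hm hmn a := hbs
        have : b = a := nodup_inj _ hnds hb ha (hbs'.trans (Fin.ext hloop).symm)
        rw [this]; rfl) ⟨a, ha, rfl⟩
      have h1 := len_le _ hnd {t1 n m d hm hmn a} (fun b hb => Finset.mem_singleton.2 (this b hb))
      rw [Finset.card_singleton] at h1
      omega
    · have hsa' : (t1 n m d hm hmn a).1 = (s1 n m d hm hmn a).1 + 1 := by omega
      obtain ⟨b, hb, hbs⟩ := htgt a ha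
      have hcb := arr_cases n m d hm hmn b
      have hbm := hmax b hb
      have hbs1 := congrArg Fin.val hbs
      have hbt : (t1 n m d hm hmn b).1 = (s1 n m d hm hmn a).1 := by
        by_contra hc
        have h5 : t1 n m d hm hmn b = t1 n m d hm hmn a := Fin.ext (by omega)
        have h6 : b = a := nodup_inj _ hnd hb ha h5
        rw [h6] at hbs1
        exact hloop hbs1
      have := conn_closed (Q1 n m d hm hmn) {x | x = t1 n m d hm hmn a ∨ x = s1 n m d hm hmn a} l u hp (by
        intro c hc hcs
        have hcs' : s1 n m d hm hmn c = t1 n m d hm hmn a ∨ s1 n m d hm hmn c = s1 n m d hm hmn a := hcs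
        rcases hcs' with h | h
        · have : c = b := nodup_inj _ hnds hc hb (h.trans hbs.symm)
          rw [this]; exact Or.inr (Fin.ext hbt)
        · have : c = a := nodup_inj _ hnds hc ha h
          rw [this]; exact Or.inl rfl) ⟨a, ha, Or.inl rfl⟩
      have h1 := len_le _ hnd {t1 n m d hm hmn a, s1 n m d hm hmn a} (fun b hb => by
        rcases this b hb with h | h
        · exact Finset.mem_insert.2 (Or.inl h)
        · exact Finset.mem_insert.2 (Or.inr (Finset.mem_singleton.2 h)))
      exact h1.trans (Finset.card_le_two.trans hm)

lemma maxPrim (hd : n * 3 ≤ d) : (Q1 n m d hm hmn).MaxPrimDeg m := by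
  constructor
  · obtain ⟨l, h1, h2⟩ := prim_path n m d hm hmn hd (m - 1) (by omega)
    have hlen : l.length = m := by
      have := congrArg List.length h2
      simp only [List.length_map, List.length_range] at this
      omega
    refine ⟨l, ⟨_, ⟨?_, h1⟩, ?_⟩, hlen⟩
    · rintro rfl
      simp at hlen
      omega
    · rw [prim_iff]
      have h3 : (l.map (fun a => (t1 n m d hm hmn a).1)).Nodup := by
        rw [h2]; exact List.nodup_range
      have h4 : l.map (fun a => (t1 n m d hm hmn a).1) = (l.map (t1 n m d hm hmn)).map Fin.val := by
        rw [List.map_map]; rfl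
      rw [h4] at h3
      exact List.Nodup.of_map _ h3
  · rintro l ⟨u, ⟨hne, hp⟩, hv⟩
    rw [prim_iff] at hv
    exact prim_bound n m d hm hmn l u hne hp hv

end final
end QInv


/-- **Theorem (sharpness, char ≠ 2).** Let `K` be an infinite field with `char K ≠ 2`
and fix integers `n ≥ m ≥ 2`. Then for all `d` sufficiently large with respect to
`n` and `m`, `max {D(Q,(2,…,2)) | Q ∈ 𝒬(n,d,m)} = 3n`. -/
theorem maxD_eq_three_n_char_ne_two
    (K : Type) [Field K] [Infinite K] (hchar : ringChar K ≠ 2)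
    (n m : ℕ) (hm : 2 ≤ m) (hmn : m ≤ n) :
    ∃ d₀ : ℕ, ∀ d : ℕ, d₀ ≤ d → QuiverData.maxD K n d m = 3 * n := by
  have h2 : (2 : K) ≠ 0 := Ring.two_ne_zero hchar
  refine ⟨n * 3, fun d hd => ?_⟩
  have hub : ∀ N ∈ {N | ∃ s t : Fin d → Fin n,
      (QuiverData.mk (Fin n) (Fin d) s t).StronglyConnected ∧
      (QuiverData.mk (Fin n) (Fin d) s t).MaxPrimDeg m ∧
      N = (QuiverData.mk (Fin n) (Fin d) s t).Dnum K}, N ≤ 3 * n := by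
    rintro N ⟨s, t, _, _, rfl⟩
    exact QInv.Dnum_le' n d h2 s t
  refine le_antisymm (csSup_le' hub) ?_
  refine le_csSup ⟨3 * n, hub⟩ ?_
  exact ⟨QInv.s1 n m d hm hmn, QInv.t1 n m d hm hmn, QInv.strong n m d hm hmn hd,
    QInv.maxPrim n m d hm hmn hd, (QInv.Dnum_Q1 n m d hm hmn hd h2).symm⟩
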